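/- arXiv:2011.11533 — 2 statements merged into one kernel-verified Lean document; each statement's English description precedes it below -/
import Mathlib

section
/- Properties of the set R₀: under the mean-field assumptions, the set R₀ is compact (in P([0,T]×Ō) × V with the topologies of weak convergence), convex, and nonempty; for every m̄ ∈ V one has R[m̄] ⊆ R₀; and every (μ, m) ∈ R₀ satisfies m_t(Ō×A) ≤ 1 for Lebesgue-a.e. t ∈ [0,T]. -/
open MeasureTheory Filter Set Topology

noncomputable section

/-- Membership in `C_b^{1,2}([0,T] × closure O)`: `u` together with its partial
derivatives `ut = ∂_t u`, `ux = ∂_x u`, `uxx = ∂_xx u`, all continuous and bounded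
on `[0,T] × closure O`. -/
structure IsCb12 (T : ℝ) (O : Set ℝ) (u ut ux uxx : ℝ → ℝ → ℝ) : Prop where
  cont : ContinuousOn (fun p : ℝ × ℝ => u p.1 p.2) (Set.Icc 0 T ×ˢ closure O)
  cont_t : ContinuousOn (fun p : ℝ × ℝ => ut p.1 p.2) (Set.Icc 0 T ×ˢ closure O)
  cont_x : ContinuousOn (fun p : ℝ × ℝ => ux p.1 p.2) (Set.Icc 0 T ×ˢ closure O)
  cont_xx : ContinuousOn (fun p : ℝ × ℝ => uxx p.1 p.2) (Set.Icc 0 T ×ˢ closure O)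
  deriv_t : ∀ t ∈ Set.Icc (0:ℝ) T, ∀ x ∈ closure O,
    HasDerivWithinAt (fun s => u s x) (ut t x) (Set.Icc 0 T) t
  deriv_x : ∀ t ∈ Set.Icc (0:ℝ) T, ∀ x ∈ closure O,
    HasDerivWithinAt (fun y => u t y) (ux t x) (closure O) x
  deriv_xx : ∀ t ∈ Set.Icc (0:ℝ) T, ∀ x ∈ closure O,
    HasDerivWithinAt (fun y => ux t y) (uxx t x) (closure O) x
  bdd : ∃ C : ℝ, ∀ t ∈ Set.Icc (0:ℝ) T, ∀ x ∈ closure O,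
    |u t x| ≤ C ∧ |ut t x| ≤ C ∧ |ux t x| ≤ C ∧ |uxx t x| ≤ C

/-- Membership in `V`: a flow of finite positive Borel measures on
`closure O × A`, measurable in `t`, with integrable total mass on `[0,T]`. -/
def MemV (T : ℝ) (O A : Set ℝ) (m : ℝ → Measure (ℝ × ℝ)) : Prop :=
  (∀ t, m t Set.univ < ⊤) ∧
  (∀ t, m t ((closure O ×ˢ A)ᶜ) = 0) ∧
  (∀ B : Set (ℝ × ℝ), MeasurableSet B → Measurable fun t => m t B) ∧
  IntegrableOn (fun t => (m t Set.univ).toReal) (Set.Icc 0 T)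

/-- Weak convergence of (finite) measures on `[0,T] × closure O` (tested against
bounded continuous functions). -/
def WeakConv (μn : ℕ → Measure (ℝ × ℝ)) (μ : Measure (ℝ × ℝ)) : Prop :=
  ∀ h : ℝ × ℝ → ℝ, Continuous h → (∃ C : ℝ, ∀ p, |h p| ≤ C) →
    Tendsto (fun n => ∫ p, h p ∂(μn n)) atTop (nhds (∫ p, h p ∂μ))

/-- Convergence `mⁿ → m` in `V`: weak convergence of the associated finite
measures `m_tⁿ(dx,da)dt` on `[0,T] × closure O × A`. -/
def ConvV (T : ℝ) (mn : ℕ → ℝ → Measure (ℝ × ℝ)) (m : ℝ → Measure (ℝ × ℝ)) : Prop :=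
  ∀ h : ℝ → ℝ × ℝ → ℝ, Continuous (fun q : ℝ × ℝ × ℝ => h q.1 q.2) →
    (∃ C : ℝ, ∀ t p, |h t p| ≤ C) →
    Tendsto (fun n => ∫ t in Set.Icc 0 T, (∫ p, h t p ∂(mn n t))) atTop
      (nhds (∫ t in Set.Icc 0 T, (∫ p, h t p ∂(m t))))

/-- Mean-field structural assumptions on a coefficient
`c(t,x,m,a) = c̄(t, x, ∫ ĉ(t,y) m(dy,du), a)`: Lipschitz in `x` uniformly in the
other variables; `c̄` bounded, measurable and continuous in the variables other than
`t` for each fixed `t`; `ĉ` continuous and bounded on `[0,T] × closure O`. -/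
def MFCoeff (T : ℝ) (O A : Set ℝ) (d : ℕ)
    (c : ℝ → ℝ → Measure (ℝ × ℝ) → ℝ → ℝ)
    (cbar : ℝ → ℝ → (Fin d → ℝ) → ℝ → ℝ)
    (chat : ℝ → ℝ → Fin d → ℝ) : Prop :=
  (∃ K : ℝ, ∀ t (ν : Measure (ℝ × ℝ)) a x y, |c t x ν a - c t y ν a| ≤ K * |x - y|) ∧
  (∀ t x (ν : Measure (ℝ × ℝ)) a, c t x ν a = cbar t x (fun i => ∫ p, chat t p.1 i ∂ν) a) ∧
  (∃ C : ℝ, ∀ t x z a, |cbar t x z a| ≤ C) ∧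
  Measurable (fun q : ℝ × ℝ × (Fin d → ℝ) × ℝ => cbar q.1 q.2.1 q.2.2.1 q.2.2.2) ∧
  (∀ t, ContinuousOn (fun q : ℝ × (Fin d → ℝ) × ℝ => cbar t q.1 q.2.1 q.2.2)
      (Set.univ ×ˢ Set.univ ×ˢ A)) ∧
  ContinuousOn (fun p : ℝ × ℝ => chat p.1 p.2) (Set.Icc 0 T ×ˢ closure O) ∧
  (∃ C : ℝ, ∀ t x, ‖chat t x‖ ≤ C)

/-- Mean-field structural assumptions on the running reward
`f(t,x,m,a) = f̄(t, x, ∫ f̂(t,y) m(dy,du), a)` with `f̄` bounded, measurable,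
continuous in the variables other than `t` for each fixed `t`, and `f̂` continuous
and bounded. -/
def MFRunning (T : ℝ) (O A : Set ℝ) (d : ℕ)
    (f : ℝ → ℝ → Measure (ℝ × ℝ) → ℝ → ℝ)
    (fbar : ℝ → ℝ → (Fin d → ℝ) → ℝ → ℝ)
    (fhat : ℝ → ℝ → Fin d → ℝ) : Prop :=
  (∀ t x (ν : Measure (ℝ × ℝ)) a, f t x ν a = fbar t x (fun i => ∫ p, fhat t p.1 i ∂ν) a) ∧
  (∃ C : ℝ, ∀ t x z a, |fbar t x z a| ≤ C) ∧
  Measurable (fun q : ℝ × ℝ × (Fin d → ℝ) × ℝ => fbar q.1 q.2.1 q.2.2.1 q.2.2.2) ∧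
  (∀ t, ContinuousOn (fun q : ℝ × (Fin d → ℝ) × ℝ => fbar t q.1 q.2.1 q.2.2)
      (closure O ×ˢ Set.univ ×ˢ A)) ∧
  ContinuousOn (fun p : ℝ × ℝ => fhat p.1 p.2) (Set.Icc 0 T ×ˢ closure O) ∧
  (∃ C : ℝ, ∀ t x, ‖fhat t x‖ ≤ C)

/-- Mean-field structural assumptions on the terminal reward
`g(t,x,μ) = ḡ(t, x, ∫ ĝ(s,y) μ(ds,dy))` with `ḡ` and `ĝ` continuous and bounded. -/
def MFTerminal (T : ℝ) (O : Set ℝ) (d : ℕ)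
    (g : ℝ → ℝ → Measure (ℝ × ℝ) → ℝ)
    (gbar : ℝ → ℝ → (Fin d → ℝ) → ℝ)
    (ghat : ℝ → ℝ → Fin d → ℝ) : Prop :=
  (∀ t x (ν : Measure (ℝ × ℝ)), g t x ν = gbar t x (fun i => ∫ p, ghat p.1 p.2 i ∂ν)) ∧
  ContinuousOn (fun q : ℝ × ℝ × (Fin d → ℝ) => gbar q.1 q.2.1 q.2.2)
    (Set.Icc 0 T ×ˢ closure O ×ˢ Set.univ) ∧
  (∃ C : ℝ, ∀ t x z, |gbar t x z| ≤ C) ∧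
  ContinuousOn (fun p : ℝ × ℝ => ghat p.1 p.2) (Set.Icc 0 T ×ˢ closure O) ∧
  (∃ C : ℝ, ∀ t x, ‖ghat t x‖ ≤ C)

/-- Standing assumption on the initial measure in the mean-field setting: a
probability measure on `O` with `∫ |x|² dm₀* < ∞`. -/
def InitAssumption2 (O : Set ℝ) (m0 : Measure ℝ) : Prop :=
  IsProbabilityMeasure m0 ∧ m0 Oᶜ = 0 ∧ Integrable (fun x => x ^ 2) m0

/-- Membership in `R[m̄]`: the Fokker–Planck constraint with coefficients frozen
along the flow `m̄`. -/
def MemRm (T : ℝ) (O A : Set ℝ)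
    (b σ : ℝ → ℝ → Measure (ℝ × ℝ) → ℝ → ℝ) (m0 : Measure ℝ)
    (mbar : ℝ → Measure (ℝ × ℝ))
    (μ : Measure (ℝ × ℝ)) (m : ℝ → Measure (ℝ × ℝ)) : Prop :=
  IsProbabilityMeasure μ ∧ μ ((Set.Icc 0 T ×ˢ closure O)ᶜ) = 0 ∧ MemV T O A m ∧
  ∀ u ut ux uxx : ℝ → ℝ → ℝ, IsCb12 T O u ut ux uxx →
    ∫ p, u p.1 p.2 ∂μ
      = (∫ x, u 0 x ∂m0)
        + ∫ t in Set.Icc 0 T,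
            (∫ p, (ut t p.1 + (b t p.1 (mbar t) p.2 * ux t p.1
                + σ t p.1 (mbar t) p.2 ^ 2 / 2 * uxx t p.1)) ∂(m t))

/-- Membership in `R₀`: for every test function `u ∈ C_b^{1,2}` and every constant
`C` dominating `|L u|` uniformly over `[0,T] × closure O × M(Ō×A) × A`, the relaxed
Fokker–Planck inequality holds. -/
def MemR0 (T : ℝ) (O A : Set ℝ)
    (b σ : ℝ → ℝ → Measure (ℝ × ℝ) → ℝ → ℝ) (m0 : Measure ℝ)
    (μ : Measure (ℝ × ℝ)) (m : ℝ → Measure (ℝ × ℝ)) : Prop :=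
  IsProbabilityMeasure μ ∧ μ ((Set.Icc 0 T ×ˢ closure O)ᶜ) = 0 ∧ MemV T O A m ∧
  ∀ u ut ux uxx : ℝ → ℝ → ℝ, IsCb12 T O u ut ux uxx →
    ∀ C : ℝ,
      (∀ t ∈ Set.Icc (0:ℝ) T, ∀ x ∈ closure O, ∀ ν : Measure (ℝ × ℝ),
          ν Set.univ < ⊤ → ν ((closure O ×ˢ A)ᶜ) = 0 → ∀ a ∈ A,
          |b t x ν a * ux t x + σ t x ν a ^ 2 / 2 * uxx t x| ≤ C) →
      ∫ p, u p.1 p.2 ∂μ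
        ≤ (∫ x, u 0 x ∂m0)
          + (∫ t in Set.Icc 0 T, (∫ p, ut t p.1 ∂(m t)))
          + C * ∫ t in Set.Icc 0 T, ((m t) Set.univ).toReal

/-- The mean-field reward functional
`Γ[μ̄,m̄](μ,m) = ∫₀^T ∫ f(t,x,m̄_t,a) m_t(dx,da) dt + ∫ g(t,x,μ̄) μ(dt,dx)`. -/
def GammaMF (T : ℝ)
    (f : ℝ → ℝ → Measure (ℝ × ℝ) → ℝ → ℝ) (g : ℝ → ℝ → Measure (ℝ × ℝ) → ℝ)
    (μbar : Measure (ℝ × ℝ)) (mbar : ℝ → Measure (ℝ × ℝ))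
    (μ : Measure (ℝ × ℝ)) (m : ℝ → Measure (ℝ × ℝ)) : ℝ :=
  (∫ t in Set.Icc 0 T, ∫ p, f t p.1 (mbar t) p.2 ∂(m t)) + ∫ p, g p.1 p.2 μbar ∂μ

/-- `(μ⋆, m⋆)` is an LP MFG Nash equilibrium: `(μ⋆, m⋆) ∈ R[m⋆]` and it maximizes
`Γ[μ⋆, m⋆]` over `R[m⋆]`. -/
def IsLPNash (T : ℝ) (O A : Set ℝ)
    (b σ f : ℝ → ℝ → Measure (ℝ × ℝ) → ℝ → ℝ) (g : ℝ → ℝ → Measure (ℝ × ℝ) → ℝ)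
    (m0 : Measure ℝ)
    (μs : Measure (ℝ × ℝ)) (ms : ℝ → Measure (ℝ × ℝ)) : Prop :=
  MemRm T O A b σ m0 ms μs ms ∧
  ∀ (μ : Measure (ℝ × ℝ)) (m : ℝ → Measure (ℝ × ℝ)), MemRm T O A b σ m0 ms μ m →
    GammaMF T f g μs ms μ m ≤ GammaMF T f g μs ms μs ms

/-- The additional assumption (5)(a) or (5)(c): either `b` and `σ` do not depend on
the measure argument, or `O` is an open interval, `σ` does not depend on the control
argument and is uniformly bounded below by a positive constant. -/
def MeasIndepOrInterval (O : Set ℝ)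
    (b σ : ℝ → ℝ → Measure (ℝ × ℝ) → ℝ → ℝ) : Prop :=
  (∀ t x (ν ν' : Measure (ℝ × ℝ)) a, b t x ν a = b t x ν' a ∧ σ t x ν a = σ t x ν' a) ∨
  ((∃ c1 c2 : ℝ, c1 < c2 ∧ O = Set.Ioo c1 c2) ∧
   (∀ t x (ν : Measure (ℝ × ℝ)) a a', σ t x ν a = σ t x ν a') ∧
   (∃ cσ : ℝ, 0 < cσ ∧ ∀ t x (ν : Measure (ℝ × ℝ)) a, cσ ≤ σ t x ν a))

section Helpers

open ProbabilityTheory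

lemma isCb12_prod (T : ℝ) (O : Set ℝ) (f f' g g' g'' : ℝ → ℝ)
    (hf : ∀ t, HasDerivAt f (f' t) t) (hf' : Continuous f')
    (hg : ∀ x, HasDerivAt g (g' x) x) (hg' : ∀ x, HasDerivAt g' (g'' x) x)
    (hg'' : Continuous g'') (B : ℝ)
    (hB : ∀ x, |g x| ≤ B ∧ |g' x| ≤ B ∧ |g'' x| ≤ B) :
    IsCb12 T O (fun t x => f t * g x) (fun t x => f' t * g x)
      (fun t x => f t * g' x) (fun t x => f t * g'' x) := by
  have cf : Continuous f := continuous_iff_continuousAt.2 fun t => (hf t).continuousAt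
  have cg : Continuous g := continuous_iff_continuousAt.2 fun t => (hg t).continuousAt
  have cg' : Continuous g' := continuous_iff_continuousAt.2 fun t => (hg' t).continuousAt
  refine ⟨?_, ?_, ?_, ?_, ?_, ?_, ?_, ?_⟩
  · exact Continuous.continuousOn (by fun_prop)
  · exact Continuous.continuousOn (by fun_prop)
  · exact Continuous.continuousOn (by fun_prop)
  · exact Continuous.continuousOn (by fun_prop)
  · intro t _ x _
    exact ((hf t).mul_const (g x)).hasDerivWithinAt
  · intro t _ x _
    exact ((hg x).const_mul (f t)).hasDerivWithinAt
  · intro t _ x _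
    exact ((hg' x).const_mul (f t)).hasDerivWithinAt
  · obtain ⟨C1, h1⟩ := (isCompact_Icc (a := (0:ℝ)) (b := T)).exists_bound_of_continuousOn
      cf.continuousOn
    obtain ⟨C2, h2⟩ := (isCompact_Icc (a := (0:ℝ)) (b := T)).exists_bound_of_continuousOn
      hf'.continuousOn
    refine ⟨(max C1 C2) * B, fun t ht x _ => ?_⟩
    have e1 : |f t| ≤ max C1 C2 := (h1 t ht).trans (le_max_left _ _)
    have e2 : |f' t| ≤ max C1 C2 := (h2 t ht).trans (le_max_right _ _)
    have e0 : 0 ≤ max C1 C2 := (abs_nonneg _).trans e1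
    obtain ⟨b1, b2, b3⟩ := hB x
    simp only [abs_mul]
    refine ⟨?_, ?_, ?_, ?_⟩ <;> gcongr

/-- Bounded functions continuous on a closed full-measure set are integrable. -/
lemma integrable_of_contOn {E : Type*} [TopologicalSpace E] [MeasurableSpace E] [BorelSpace E]
    [SecondCountableTopology E]
    (μ : Measure E) [IsFiniteMeasure μ] (S : Set E) (hS : MeasurableSet S) (hμ : μ Sᶜ = 0)
    (h : E → ℝ) (hc : ContinuousOn h S) (C : ℝ) (hC : ∀ x ∈ S, |h x| ≤ C) :
    Integrable h μ := by
  have hr : μ.restrict S = μ := Measure.restrict_eq_self_of_ae_mem (by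
    rw [ae_iff]; exact hμ)
  have hm : AEStronglyMeasurable h μ := by
    rw [← hr]; exact hc.aestronglyMeasurable hS
  refine Integrable.of_bound hm C ?_
  have : ∀ᵐ x ∂μ, x ∈ S := by rw [ae_iff]; exact hμ
  filter_upwards [this] with x hx using hC x hx

/-- The kernel associated to a flow. -/
def kerV (m : ℝ → Measure (ℝ × ℝ))
    (hm : ∀ B : Set (ℝ × ℝ), MeasurableSet B → Measurable fun t => m t B) :
    Kernel ℝ (ℝ × ℝ) :=
  ⟨m, Measure.measurable_of_measurable_coe _ hm⟩

lemma kerV_apply (m : ℝ → Measure (ℝ × ℝ))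
    (hm : ∀ B : Set (ℝ × ℝ), MeasurableSet B → Measurable fun t => m t B) (t : ℝ) :
    kerV m hm t = m t := rfl

lemma kerV_sfinite (m : ℝ → Measure (ℝ × ℝ))
    (hm : ∀ B : Set (ℝ × ℝ), MeasurableSet B → Measurable fun t => m t B)
    (hfin : ∀ t, m t Set.univ < ⊤) : IsSFiniteKernel (kerV m hm) := by
  have hmass : Measurable fun t => m t univ := hm _ MeasurableSet.univ
  have hmeas : ∀ B : Set (ℝ × ℝ), MeasurableSet B →
      Measurable fun t => ((1 + m t univ)⁻¹ • m t) B := by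
    intro B hB
    simp only [Measure.smul_apply, smul_eq_mul]
    exact ((measurable_const.add hmass).inv).mul (hm B hB)
  let κ := kerV (fun t => (1 + m t univ)⁻¹ • m t) hmeas
  have hκ : IsFiniteKernel κ := by
    refine ⟨1, ENNReal.one_lt_top, fun t => ?_⟩
    rw [kerV_apply]
    simp only [Measure.smul_apply, smul_eq_mul]
    rw [mul_comm, ← div_eq_mul_inv]
    apply ENNReal.div_le_of_le_mul
    rw [one_mul]
    exact le_add_self
  have hne : ∀ t, 1 + m t univ ≠ ⊤ := fun t => by
    simp [(hfin t).ne]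
  have hu : Measurable (Function.uncurry fun (t : ℝ) (_ : ℝ × ℝ) => 1 + m t univ) := by
    have : Measurable fun t => 1 + m t univ := measurable_const.add hmass
    exact this.comp measurable_fst
  have : kerV m hm = Kernel.withDensity κ (fun t _ => 1 + m t univ) := by
    ext t s hs
    rw [Kernel.withDensity_apply _ hu, withDensity_const, kerV_apply, kerV_apply, smul_smul,
      ENNReal.mul_inv_cancel (by simp) (hne t), one_smul]
  rw [this]
  exact Kernel.IsSFiniteKernel.withDensity κ (fun t _ => hne t)

/-- The measure `m_t(dx,da)dt`. -/
def Lam (T : ℝ) (m : ℝ → Measure (ℝ × ℝ))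
    (hm : ∀ B : Set (ℝ × ℝ), MeasurableSet B → Measurable fun t => m t B) :
    Measure (ℝ × ℝ × ℝ) :=
  (volume.restrict (Icc 0 T)) ⊗ₘ kerV m hm

lemma Lam_apply {T : ℝ} {O A : Set ℝ} {m : ℝ → Measure (ℝ × ℝ)} (hm : MemV T O A m)
    {s : Set (ℝ × ℝ × ℝ)} (hs : MeasurableSet s) :
    Lam T m hm.2.2.1 s = ∫⁻ t in Icc 0 T, m t (Prod.mk t ⁻¹' s) := by
  have := kerV_sfinite m hm.2.2.1 hm.1
  rw [Lam, Measure.compProd_apply hs]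
  rfl

lemma Lam_finite {T : ℝ} {O A : Set ℝ} {m : ℝ → Measure (ℝ × ℝ)} (hm : MemV T O A m) :
    IsFiniteMeasure (Lam T m hm.2.2.1) := by
  constructor
  rw [Lam_apply hm MeasurableSet.univ]
  simp only [preimage_univ]
  have h := hm.2.2.2
  have h2 := h.lintegral_lt_top
  simpa [ENNReal.ofReal_toReal (hm.1 _).ne] using h2

lemma Lam_compl {T : ℝ} {O A : Set ℝ} (hA : IsCompact A) {m : ℝ → Measure (ℝ × ℝ)}
    (hm : MemV T O A m) :
    Lam T m hm.2.2.1 ((Icc 0 T ×ˢ closure O ×ˢ A)ᶜ) = 0 := by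
  have hS : MeasurableSet (Icc (0:ℝ) T ×ˢ closure O ×ˢ A) :=
    measurableSet_Icc.prod (isClosed_closure.measurableSet.prod hA.measurableSet)
  rw [Lam_apply hm hS.compl]
  rw [lintegral_eq_zero_iff']
  · filter_upwards [ae_restrict_mem measurableSet_Icc] with t ht
    refine measure_mono_null ?_ (hm.2.1 t)
    intro p hp
    simp only [mem_preimage, mem_compl_iff, mem_prod, not_and] at hp ⊢
    exact fun h => hp ht h
  · have := kerV_sfinite m hm.2.2.1 hm.1
    have h := Kernel.measurable_kernel_prodMk_left (κ := kerV m hm.2.2.1) hS.compl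
    exact h.aemeasurable

lemma integral_Lam {T : ℝ} {O A : Set ℝ} {m : ℝ → Measure (ℝ × ℝ)} (hm : MemV T O A m)
    {h : ℝ × ℝ × ℝ → ℝ} (hi : Integrable h (Lam T m hm.2.2.1)) :
    ∫ q, h q ∂(Lam T m hm.2.2.1) = ∫ t in Icc 0 T, ∫ p, h (t, p) ∂(m t) := by
  have := kerV_sfinite m hm.2.2.1 hm.1
  rw [Lam, Measure.integral_compProd hi]
  rfl

lemma Lam_mass {T : ℝ} {O A : Set ℝ} {m : ℝ → Measure (ℝ × ℝ)} (hm : MemV T O A m) :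
    ∫ t in Icc 0 T, (m t univ).toReal = (Lam T m hm.2.2.1).real univ := by
  have := Lam_finite hm
  have h := integral_Lam hm (h := fun _ => 1) (integrable_const _)
  simpa [Measure.real] using h.symm

lemma integrable_Lam_ut {T : ℝ} {O A : Set ℝ} (hA : IsCompact A) {m : ℝ → Measure (ℝ × ℝ)}
    (hm : MemV T O A m) {v : ℝ → ℝ → ℝ}
    (hv : ContinuousOn (fun p : ℝ × ℝ => v p.1 p.2) (Set.Icc 0 T ×ˢ closure O))
    {C : ℝ} (hC : ∀ t ∈ Icc (0:ℝ) T, ∀ x ∈ closure O, |v t x| ≤ C) :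
    Integrable (fun q : ℝ × ℝ × ℝ => v q.1 q.2.1) (Lam T m hm.2.2.1) := by
  have := Lam_finite hm
  have hS : MeasurableSet (Icc (0:ℝ) T ×ˢ closure O ×ˢ A) :=
    measurableSet_Icc.prod (isClosed_closure.measurableSet.prod hA.measurableSet)
  refine integrable_of_contOn _ _ hS (Lam_compl hA hm) _ ?_ C ?_
  · have : Continuous fun q : ℝ × ℝ × ℝ => (q.1, q.2.1) := by fun_prop
    exact hv.comp this.continuousOn fun q hq => ⟨hq.1, hq.2.1⟩
  · exact fun q hq => hC _ hq.1 _ hq.2.1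

/-- Reformulation of `MemR0` with the measure `Lam`. -/
lemma memR0_iff {T : ℝ} {O A : Set ℝ} (hA : IsCompact A)
    {b σ : ℝ → ℝ → Measure (ℝ × ℝ) → ℝ → ℝ} {m0 : Measure ℝ}
    {μ : Measure (ℝ × ℝ)} {m : ℝ → Measure (ℝ × ℝ)} (hm : MemV T O A m) :
    MemR0 T O A b σ m0 μ m ↔
      IsProbabilityMeasure μ ∧ μ ((Set.Icc 0 T ×ˢ closure O)ᶜ) = 0 ∧
      ∀ u ut ux uxx : ℝ → ℝ → ℝ, IsCb12 T O u ut ux uxx →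
      ∀ C : ℝ,
      (∀ t ∈ Set.Icc (0:ℝ) T, ∀ x ∈ closure O, ∀ ν : Measure (ℝ × ℝ),
          ν Set.univ < ⊤ → ν ((closure O ×ˢ A)ᶜ) = 0 → ∀ a ∈ A,
          |b t x ν a * ux t x + σ t x ν a ^ 2 / 2 * uxx t x| ≤ C) →
      ∫ p, u p.1 p.2 ∂μ
        ≤ (∫ x, u 0 x ∂m0)
          + (∫ q, ut q.1 q.2.1 ∂(Lam T m hm.2.2.1))
          + C * (Lam T m hm.2.2.1).real univ := by
  have key : ∀ u ut ux uxx : ℝ → ℝ → ℝ, IsCb12 T O u ut ux uxx →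
      (∫ t in Set.Icc 0 T, (∫ p, ut t p.1 ∂(m t))) = ∫ q, ut q.1 q.2.1 ∂(Lam T m hm.2.2.1) := by
    intro u ut ux uxx hu
    obtain ⟨C, hC⟩ := hu.bdd
    exact (integral_Lam hm (integrable_Lam_ut hA hm hu.cont_t
      fun t ht x hx => (hC t ht x hx).2.1)).symm
  constructor
  · rintro ⟨h1, h2, _, h4⟩
    refine ⟨h1, h2, fun u ut ux uxx hu C hC => ?_⟩
    rw [← key u ut ux uxx hu, ← Lam_mass hm]
    exact h4 u ut ux uxx hu C hC
  · rintro ⟨h1, h2, h4⟩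
    refine ⟨h1, h2, hm, fun u ut ux uxx hu C hC => ?_⟩
    rw [key u ut ux uxx hu, Lam_mass hm]
    exact h4 u ut ux uxx hu C hC


lemma memR0_nonempty {T : ℝ} (hT : 0 < T) {O A : Set ℝ} 
    {b σ : ℝ → ℝ → Measure (ℝ × ℝ) → ℝ → ℝ} {m0 : Measure ℝ} (hm0 : InitAssumption2 O m0) :
    ∃ (μ : Measure (ℝ × ℝ)) (m : ℝ → Measure (ℝ × ℝ)), MemR0 T O A b σ m0 μ m := by
  obtain ⟨hp, hO, _⟩ := hm0
  have hmeas : Measurable (fun x : ℝ => ((0:ℝ), x)) := by fun_prop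
  have hS : MeasurableSet (Icc (0:ℝ) T ×ˢ closure O) :=
    measurableSet_Icc.prod isClosed_closure.measurableSet
  have hz : (m0.map (fun x : ℝ => ((0:ℝ), x))) ((Icc (0:ℝ) T ×ˢ closure O)ᶜ) = 0 := by
    rw [Measure.map_apply hmeas hS.compl]
    refine measure_mono_null ?_ hO
    intro x hx hxO
    exact hx ⟨⟨le_rfl, hT.le⟩, subset_closure hxO⟩
  have hpm : IsProbabilityMeasure (m0.map (fun x : ℝ => ((0:ℝ), x))) :=
    Measure.isProbabilityMeasure_map hmeas.aemeasurable
  refine ⟨m0.map (fun x => (0, x)), fun _ => 0, ?_, ?_, ?_, ?_⟩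
  · exact hpm
  · exact hz
  · refine ⟨by simp, by simp, by simp, by simp⟩
  · intro u ut ux uxx hu C hC
    obtain ⟨B, hB⟩ := hu.bdd
    have hi := integrable_of_contOn _ _ hS hz _ hu.cont B (fun p hp => (hB _ hp.1 _ hp.2).1)
    rw [integral_map hmeas.aemeasurable hi.aestronglyMeasurable]
    simp

lemma memV_comb {T : ℝ} {O A : Set ℝ} {m1 m2 : ℝ → Measure (ℝ × ℝ)} (h1 : MemV T O A m1)
    (h2 : MemV T O A m2) (θ η : ℝ) :
    MemV T O A (fun t => ENNReal.ofReal θ • m1 t + ENNReal.ofReal η • m2 t) := by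
  refine ⟨fun t => ?_, fun t => ?_, fun B hB => ?_, ?_⟩
  · simp only [Measure.add_apply, Measure.smul_apply, smul_eq_mul]
    exact ENNReal.add_lt_top.2 ⟨ENNReal.mul_lt_top ENNReal.ofReal_lt_top (h1.1 t),
      ENNReal.mul_lt_top ENNReal.ofReal_lt_top (h2.1 t)⟩
  · simp [h1.2.1 t, h2.2.1 t]
  · simp only [Measure.add_apply, Measure.smul_apply, smul_eq_mul]
    exact ((h1.2.2.1 B hB).const_mul _).add ((h2.2.2.1 B hB).const_mul _)
  · have := (h1.2.2.2.const_mul (max θ 0)).add (h2.2.2.2.const_mul (max η 0))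
    refine this.congr (Eventually.of_forall fun t => ?_)
    simp only [Measure.add_apply, Measure.smul_apply, smul_eq_mul, Pi.add_apply]
    rw [ENNReal.toReal_add (ENNReal.mul_lt_top ENNReal.ofReal_lt_top (h1.1 t)).ne
      (ENNReal.mul_lt_top ENNReal.ofReal_lt_top (h2.1 t)).ne, ENNReal.toReal_mul,
      ENNReal.toReal_mul, ENNReal.toReal_ofReal', ENNReal.toReal_ofReal']

lemma Lam_comb {T : ℝ} {O A : Set ℝ} {m1 m2 : ℝ → Measure (ℝ × ℝ)} (h1 : MemV T O A m1)
    (h2 : MemV T O A m2) (θ η : ℝ) :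
    Lam T _ (memV_comb h1 h2 θ η).2.2.1 =
      ENNReal.ofReal θ • Lam T m1 h1.2.2.1 + ENNReal.ofReal η • Lam T m2 h2.2.2.1 := by
  ext s hs
  have := kerV_sfinite m1 h1.2.2.1 h1.1
  have := kerV_sfinite m2 h2.2.2.1 h2.1
  have e1 : Measurable fun t => m1 t (Prod.mk t ⁻¹' s) :=
    Kernel.measurable_kernel_prodMk_left (κ := kerV m1 h1.2.2.1) hs
  have e2 : Measurable fun t => m2 t (Prod.mk t ⁻¹' s) :=
    Kernel.measurable_kernel_prodMk_left (κ := kerV m2 h2.2.2.1) hs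
  simp only [Measure.add_apply, Measure.smul_apply, smul_eq_mul, Lam_apply h1 hs, Lam_apply h2 hs,
    Lam_apply (memV_comb h1 h2 θ η) hs]
  rw [lintegral_add_left (e1.const_mul _), lintegral_const_mul _ e1, lintegral_const_mul _ e2]

lemma memR0_convex {T : ℝ} {O A : Set ℝ} (hA : IsCompact A)
    {b σ : ℝ → ℝ → Measure (ℝ × ℝ) → ℝ → ℝ} {m0 : Measure ℝ}
    (μ1 μ2 : Measure (ℝ × ℝ)) (m1 m2 : ℝ → Measure (ℝ × ℝ))
    (H1 : MemR0 T O A b σ m0 μ1 m1) (H2 : MemR0 T O A b σ m0 μ2 m2)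
    (θ : ℝ) (hθ0 : 0 ≤ θ) (hθ1 : θ ≤ 1) :
    MemR0 T O A b σ m0
      (ENNReal.ofReal θ • μ1 + ENNReal.ofReal (1 - θ) • μ2)
      (fun t => ENNReal.ofReal θ • m1 t + ENNReal.ofReal (1 - θ) • m2 t) := by
  have h1 := H1.2.2.1
  have h2 := H2.2.2.1
  rw [memR0_iff hA h1] at H1
  rw [memR0_iff hA h2] at H2
  rw [memR0_iff hA (memV_comb h1 h2 θ (1 - θ)), Lam_comb h1 h2]
  obtain ⟨p1, s1, I1⟩ := H1
  obtain ⟨p2, s2, I2⟩ := H2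
  have f1 := Lam_finite h1
  have f2 := Lam_finite h2
  have hθ' : 0 ≤ 1 - θ := by linarith
  have hS : MeasurableSet (Icc (0:ℝ) T ×ˢ closure O) :=
    measurableSet_Icc.prod isClosed_closure.measurableSet
  refine ⟨⟨?_⟩, ?_, ?_⟩
  · simp only [Measure.add_apply, Measure.smul_apply, smul_eq_mul, measure_univ, mul_one]
    rw [← ENNReal.ofReal_add hθ0 hθ']
    simp
  · simp [s1, s2]
  · intro u ut ux uxx hu C hC
    obtain ⟨B, hB⟩ := hu.bdd
    have i1 := integrable_of_contOn _ _ hS s1 _ hu.cont B (fun p hp => (hB _ hp.1 _ hp.2).1)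
    have i2 := integrable_of_contOn _ _ hS s2 _ hu.cont B (fun p hp => (hB _ hp.1 _ hp.2).1)
    have j1 := integrable_Lam_ut hA h1 hu.cont_t fun t ht x hx => (hB t ht x hx).2.1
    have j2 := integrable_Lam_ut hA h2 hu.cont_t fun t ht x hx => (hB t ht x hx).2.1
    have I1 := I1 u ut ux uxx hu C hC
    have I2 := I2 u ut ux uxx hu C hC
    rw [integral_add_measure (i1.smul_measure ENNReal.ofReal_ne_top)
      (i2.smul_measure ENNReal.ofReal_ne_top), integral_add_measure
      (j1.smul_measure ENNReal.ofReal_ne_top)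
      (j2.smul_measure ENNReal.ofReal_ne_top), measureReal_add_apply
        (by simpa using ENNReal.mul_ne_top ENNReal.ofReal_ne_top (measure_ne_top _ _))
        (by simpa using ENNReal.mul_ne_top ENNReal.ofReal_ne_top (measure_ne_top _ _)),
      measureReal_ennreal_smul_apply,
      measureReal_ennreal_smul_apply]
    simp only [integral_smul_measure, smul_eq_mul, ENNReal.toReal_ofReal hθ0,
      ENNReal.toReal_ofReal hθ']
    nlinarith [mul_le_mul_of_nonneg_left I1 hθ0, mul_le_mul_of_nonneg_left I2 hθ']

lemma mf_measurable {T : ℝ} {O A : Set ℝ} {d : ℕ}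
    {c : ℝ → ℝ → Measure (ℝ × ℝ) → ℝ → ℝ}
    {cbar : ℝ → ℝ → (Fin d → ℝ) → ℝ → ℝ} {chat : ℝ → ℝ → Fin d → ℝ}
    (hc : MFCoeff T O A d c cbar chat) {mbar : ℝ → Measure (ℝ × ℝ)} (hmb : MemV T O A mbar) :
    ∃ g : ℝ × ℝ × ℝ → ℝ, Measurable g ∧ 
      ∀ t ∈ Icc (0:ℝ) T, ∀ x a, c t x (mbar t) a = g (t, x, a) := by
  obtain ⟨_, hform, _, hmeas, _, hcont, _⟩ := hc
  have := kerV_sfinite mbar hmb.2.2.1 hmb.1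
  have hS : MeasurableSet (Icc (0:ℝ) T ×ˢ closure O) :=
    measurableSet_Icc.prod isClosed_closure.measurableSet
  have hind : Measurable ((Icc (0:ℝ) T ×ˢ closure O).indicator
      (fun p : ℝ × ℝ => chat p.1 p.2)) := by
    classical
    have h := hcont.measurable_piecewise (g := fun _ => 0) continuousOn_const hS
    rw [← piecewise_eq_indicator]
    exact h
  set F := ((Icc (0:ℝ) T ×ˢ closure O).indicator (fun p : ℝ × ℝ => chat p.1 p.2)) with hF
  let z : ℝ → Fin d → ℝ := fun t i => ∫ p, F (t, p.1) i ∂(mbar t)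
  have hz : Measurable z := by
    refine measurable_pi_iff.2 fun i => ?_
    have h1 : Measurable (fun q : ℝ × ℝ × ℝ => F (q.1, q.2.1) i) :=
      (measurable_pi_apply i).comp (hind.comp (by fun_prop))
    exact (MeasureTheory.StronglyMeasurable.integral_kernel_prod_right' (κ := kerV mbar hmb.2.2.1)
      h1.stronglyMeasurable).measurable
  refine ⟨fun q => cbar q.1 q.2.1 (z q.1) q.2.2, ?_, ?_⟩
  · have h2 : Measurable (fun q : ℝ × ℝ × ℝ => (q.1, q.2.1, z q.1, q.2.2)) := by fun_prop
    exact hmeas.comp h2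
  · intro t ht x a
    rw [hform]
    congr 1
    ext i
    refine integral_congr_ae ?_
    have : ∀ᵐ p ∂(mbar t), p ∈ closure O ×ˢ A := by rw [ae_iff]; exact hmb.2.1 t
    filter_upwards [this] with p hp
    have : ((t, p.1) : ℝ × ℝ) ∈ (Icc (0:ℝ) T ×ˢ closure O) := ⟨ht, hp.1⟩
    simp only [hF, indicator_of_mem this]

lemma memRm_sub {T : ℝ} {O A : Set ℝ} (hA : IsCompact A) {d : ℕ}
    {b σ : ℝ → ℝ → Measure (ℝ × ℝ) → ℝ → ℝ}
    {bbar σbar : ℝ → ℝ → (Fin d → ℝ) → ℝ → ℝ} {bhat σhat : ℝ → ℝ → Fin d → ℝ}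
    (hb : MFCoeff T O A d b bbar bhat) (hσ : MFCoeff T O A d σ σbar σhat)
    {m0 : Measure ℝ} {mbar : ℝ → Measure (ℝ × ℝ)} (hmb : MemV T O A mbar)
    {μ : Measure (ℝ × ℝ)} {m : ℝ → Measure (ℝ × ℝ)}
    (H : MemRm T O A b σ m0 mbar μ m) : MemR0 T O A b σ m0 μ m := by
  obtain ⟨h1, h2, hm, h4⟩ := H
  rw [memR0_iff hA hm]
  refine ⟨h1, h2, fun u ut ux uxx hu C hC => ?_⟩
  rw [h4 u ut ux uxx hu]
  have hfin := Lam_finite hm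
  obtain ⟨B, hB⟩ := hu.bdd
  have jt := integrable_Lam_ut hA hm hu.cont_t fun t ht x hx => (hB t ht x hx).2.1
  have jx := integrable_Lam_ut hA hm hu.cont_x fun t ht x hx => (hB t ht x hx).2.2.1
  have jxx := integrable_Lam_ut hA hm hu.cont_xx fun t ht x hx => (hB t ht x hx).2.2.2
  obtain ⟨gb, mgb, egb⟩ := mf_measurable hb hmb
  obtain ⟨gs, mgs, egs⟩ := mf_measurable hσ hmb
  have hae : ∀ᵐ q ∂(Lam T m hm.2.2.1), q ∈ (Icc (0:ℝ) T ×ˢ closure O ×ˢ A) := by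
    rw [ae_iff]; exact Lam_compl hA hm
  let G : ℝ × ℝ × ℝ → ℝ := fun q => b q.1 q.2.1 (mbar q.1) q.2.2 * ux q.1 q.2.1
                + σ q.1 q.2.1 (mbar q.1) q.2.2 ^ 2 / 2 * uxx q.1 q.2.1
  have hGm : AEStronglyMeasurable G (Lam T m hm.2.2.1) := by
    have : AEStronglyMeasurable (fun q => gb q * ux q.1 q.2.1 + gs q ^ 2 / 2 * uxx q.1 q.2.1)
        (Lam T m hm.2.2.1) :=
      (mgb.aestronglyMeasurable.mul jx.aestronglyMeasurable).add
        ((((mgs.pow_const 2).div_const 2).aestronglyMeasurable).mul jxx.aestronglyMeasurable)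
    refine this.congr ?_
    filter_upwards [hae] with q hq
    simp only [G, egb q.1 hq.1, egs q.1 hq.1]
  have hGb : ∀ᵐ q ∂(Lam T m hm.2.2.1), |G q| ≤ C := by
    filter_upwards [hae] with q hq
    exact hC q.1 hq.1 q.2.1 hq.2.1 (mbar q.1) (hmb.1 _) (hmb.2.1 _) q.2.2 hq.2.2
  have hGi : Integrable G (Lam T m hm.2.2.1) := Integrable.of_bound hGm C hGb
  have e := integral_Lam hm (jt.add hGi)
  have e' : (∫ t in Set.Icc 0 T,
            (∫ p, (ut t p.1 + (b t p.1 (mbar t) p.2 * ux t p.1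
                + σ t p.1 (mbar t) p.2 ^ 2 / 2 * uxx t p.1)) ∂(m t)))
      = ∫ q, ut q.1 q.2.1 ∂(Lam T m hm.2.2.1) + ∫ q, G q ∂(Lam T m hm.2.2.1) := by
    rw [← integral_add jt hGi]
    exact e.symm
  rw [e']
  have : ∫ q, G q ∂(Lam T m hm.2.2.1) ≤ ∫ q, C ∂(Lam T m hm.2.2.1) :=
    integral_mono_ae hGi (integrable_const _) (by
      filter_upwards [hGb] with q hq using (le_abs_self _).trans hq)
  rw [integral_const, smul_eq_mul] at this
  linarith


lemma measure_le_of_integral_le {ν1 ν2 : Measure ℝ} [IsFiniteMeasure ν1] [IsFiniteMeasure ν2]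
    (h : ∀ g : ℝ → ℝ, Continuous g → (∀ x, 0 ≤ g x) → (∃ C, ∀ x, g x ≤ C) →
      ∫ x, g x ∂ν1 ≤ ∫ x, g x ∂ν2) : ν1 ≤ ν2 := by
  have hcl : ∀ F : Set ℝ, IsClosed F → ν1 F ≤ ν2 F := by
    intro F hF
    refine le_of_tendsto_of_tendsto' (HasOuterApproxClosed.tendsto_lintegral_apprSeq hF ν1)
      (HasOuterApproxClosed.tendsto_lintegral_apprSeq hF ν2) fun n => ?_
    set f := hF.apprSeq n with hf
    have e : ∀ ν : Measure ℝ, IsFiniteMeasure ν →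
        ∫⁻ x, (f x : ENNReal) ∂ν = ENNReal.ofReal (∫ x, (f x : ℝ) ∂ν) := by
      intro ν hν
      rw [← BoundedContinuousFunction.toReal_lintegral_coe_eq_integral, ENNReal.ofReal_toReal]
      exact (BoundedContinuousFunction.lintegral_lt_top_of_nnreal ν f).ne
    rw [e ν1 inferInstance, e ν2 inferInstance]
    apply ENNReal.ofReal_le_ofReal
    refine h _ (NNReal.continuous_coe.comp f.continuous) (fun x => NNReal.coe_nonneg _) ⟨1, fun x => ?_⟩
    exact_mod_cast HasOuterApproxClosed.apprSeq_apply_le_one hF n x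
  refine Measure.le_iff.2 fun s hs => ?_
  rw [hs.measure_eq_iSup_isClosed_of_ne_top (measure_ne_top _ _)]
  refine iSup_le fun K => iSup_le fun hK => iSup_le fun hKc => ?_
  exact (hcl K hKc).trans (measure_mono hK)

lemma time_marginal {T : ℝ} (hT : 0 < T) {O A : Set ℝ} (hA : IsCompact A)
    {b σ : ℝ → ℝ → Measure (ℝ × ℝ) → ℝ → ℝ} {m0 : Measure ℝ} (_hm0 : InitAssumption2 O m0)
    {μ : Measure (ℝ × ℝ)} {m : ℝ → Measure (ℝ × ℝ)} (hm : MemV T O A m)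
    (H : MemR0 T O A b σ m0 μ m) (g : ℝ → ℝ) (hg : Continuous g) (hg0 : ∀ x, 0 ≤ g x) :
    ∫ q, g q.1 ∂(Lam T m hm.2.2.1) ≤ ∫ t in Icc 0 T, g t := by
  rw [memR0_iff hA hm] at H
  obtain ⟨hp, hs, H⟩ := H
  let f : ℝ → ℝ := fun t => - ∫ s in (0:ℝ)..t, g s
  have hf : ∀ t, HasDerivAt f (- g t) t := fun t =>
    (intervalIntegral.integral_hasDerivAt_right (hg.intervalIntegrable _ _)
      hg.stronglyMeasurable.stronglyMeasurableAtFilter hg.continuousAt).neg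
  have hu := isCb12_prod T O f (fun t => - g t) (fun _ => 1) (fun _ => 0) (fun _ => 0) hf hg.neg
    (fun x => hasDerivAt_const x 1) (fun x => hasDerivAt_const x 0) continuous_const 1
    (by intro x; simp)
  have h := H _ _ _ _ hu 0 (by intros; simp)
  have hS : MeasurableSet (Icc (0:ℝ) T ×ˢ closure O) :=
    measurableSet_Icc.prod isClosed_closure.measurableSet
  obtain ⟨B, hB⟩ := hu.bdd
  have i1 := integrable_of_contOn _ _ hS hs _ hu.cont B (fun p hp => (hB _ hp.1 _ hp.2).1)
  have h0 : f 0 = 0 := by simp [f]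
  simp only [mul_one, h0, zero_mul, add_zero, integral_zero, zero_add, integral_neg] at h i1
  have hae : ∀ᵐ p ∂μ, p ∈ (Icc (0:ℝ) T ×ˢ closure O) := by
    rw [ae_iff]; exact hs
  have h2 : ∫ p, f T ∂μ ≤ ∫ p, f p.1 ∂μ := by
    refine integral_mono_ae (integrable_const _) i1 ?_
    filter_upwards [hae] with p hp
    simp only [f, neg_le_neg_iff]
    exact intervalIntegral.integral_mono_interval le_rfl hp.1.1 hp.1.2
      (Eventually.of_forall hg0) (hg.intervalIntegrable _ _)
  simp only [integral_const, probReal_univ, one_smul] at h2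
  rw [integral_Icc_eq_integral_Ioc, ← intervalIntegral.integral_of_le hT.le]
  simp only [f] at h2 h
  linarith

lemma Lam_fst_le {T : ℝ} (hT : 0 < T) {O A : Set ℝ} (hA : IsCompact A)
    {b σ : ℝ → ℝ → Measure (ℝ × ℝ) → ℝ → ℝ} {m0 : Measure ℝ} (hm0 : InitAssumption2 O m0)
    {μ : Measure (ℝ × ℝ)} {m : ℝ → Measure (ℝ × ℝ)} (hm : MemV T O A m)
    (H : MemR0 T O A b σ m0 μ m) :
    (Lam T m hm.2.2.1).fst ≤ volume.restrict (Icc 0 T) := by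
  have := Lam_finite hm
  refine measure_le_of_integral_le fun g hg hg0 _ => ?_
  rw [Measure.fst, integral_map measurable_fst.aemeasurable hg.aestronglyMeasurable]
  exact time_marginal hT hA hm0 hm H g hg hg0

lemma memR0_subprob {T : ℝ} (hT : 0 < T) {O A : Set ℝ} (hA : IsCompact A)
    {b σ : ℝ → ℝ → Measure (ℝ × ℝ) → ℝ → ℝ} {m0 : Measure ℝ} (hm0 : InitAssumption2 O m0)
    {μ : Measure (ℝ × ℝ)} {m : ℝ → Measure (ℝ × ℝ)}
    (H : MemR0 T O A b σ m0 μ m) :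
    ∀ᵐ t ∂(volume.restrict (Set.Icc 0 T)), m t (closure O ×ˢ A) ≤ 1 := by
  have hm := H.2.2.1
  have hle := Lam_fst_le hT hA hm0 hm H
  have : ∀ᵐ t ∂(volume.restrict (Set.Icc 0 T)), m t univ ≤ 1 := by
    refine ae_le_of_forall_setLIntegral_le_of_sigmaFinite (hm.2.2.1 _ MeasurableSet.univ) ?_
    intro s hs _
    have h1 := Measure.le_iff.1 hle s hs
    rw [Measure.fst_apply hs, Lam_apply hm (measurable_fst hs)] at h1
    rw [setLIntegral_const, one_mul]
    refine le_trans (le_of_eq ?_) h1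
    rw [← lintegral_indicator hs]
    refine lintegral_congr fun t => ?_
    by_cases ht : t ∈ s
    · rw [indicator_of_mem ht]
      congr 1
      ext p; simp [ht]
    · rw [indicator_of_notMem ht]
      symm
      have : (Prod.mk t ⁻¹' (Prod.fst ⁻¹' s) : Set (ℝ × ℝ)) = ∅ := by ext p; simp [ht]
      rw [this, measure_empty]
  filter_upwards [this] with t ht
  exact (measure_mono (subset_univ _)).trans ht

lemma Lam_mass_le {T : ℝ} (hT : 0 < T) {O A : Set ℝ} (hA : IsCompact A)
    {b σ : ℝ → ℝ → Measure (ℝ × ℝ) → ℝ → ℝ} {m0 : Measure ℝ} (hm0 : InitAssumption2 O m0)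
    {μ : Measure (ℝ × ℝ)} {m : ℝ → Measure (ℝ × ℝ)} (hm : MemV T O A m)
    (H : MemR0 T O A b σ m0 μ m) :
    (Lam T m hm.2.2.1).real univ ≤ T := by
  have := time_marginal hT hA hm0 hm H (fun _ => 1) continuous_const (by simp)
  simpa [hT.le] using this

/-- The tightness test function. -/
def psi (δ x : ℝ) : ℝ := 1 - (1 + (δ * x) ^ 2)⁻¹

lemma psi_nonneg (δ x : ℝ) : 0 ≤ psi δ x := by
  have : (1 + (δ * x) ^ 2)⁻¹ ≤ 1 := inv_le_one_of_one_le₀ (by nlinarith [sq_nonneg (δ * x)])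
  unfold psi; linarith

lemma psi_le_sq (δ x : ℝ) : psi δ x ≤ δ ^ 2 * x ^ 2 := by
  have hp : 0 < 1 + (δ * x) ^ 2 := by positivity
  unfold psi
  have : 1 - (1 + (δ * x) ^ 2)⁻¹ = (δ * x) ^ 2 / (1 + (δ * x) ^ 2) := by field_simp; ring
  rw [this, div_le_iff₀ hp]
  nlinarith [sq_nonneg (δ * x), sq_nonneg ((δ * x) ^ 2)]

lemma psi_le_one (δ x : ℝ) : psi δ x ≤ 1 := by
  have : 0 ≤ (1 + (δ * x) ^ 2)⁻¹ := by positivity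
  unfold psi; linarith

lemma half_le_psi (δ x : ℝ) (h : 1 ≤ δ * |x|) : 1 / 2 ≤ psi δ x := by
  have h2 : 1 ≤ (δ * x) ^ 2 := by
    have : (δ * x) ^ 2 = (δ * |x|) ^ 2 := by rw [mul_pow, mul_pow, sq_abs]
    rw [this]; nlinarith
  have : (1 + (δ * x) ^ 2)⁻¹ ≤ 2⁻¹ := inv_anti₀ (by norm_num) (by linarith)
  unfold psi; linarith

/-- First derivative of `psi`. -/
def psi1 (δ x : ℝ) : ℝ := 2 * δ ^ 2 * x / (1 + (δ * x) ^ 2) ^ 2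
/-- Second derivative of `psi`. -/
def psi2 (δ x : ℝ) : ℝ := (2 * δ ^ 2 - 6 * δ ^ 4 * x ^ 2) / (1 + (δ * x) ^ 2) ^ 3

lemma psi_inner (δ x : ℝ) : HasDerivAt (fun x => 1 + (δ * x) ^ 2) (2 * δ ^ 2 * x) x := by
  have := (((hasDerivAt_id x).const_mul δ).pow 2).const_add 1
  refine HasDerivAt.congr_deriv this ?_
  simp; ring

lemma psi_deriv (δ x : ℝ) : HasDerivAt (psi δ) (psi1 δ x) x := by
  have hp : 1 + (δ * x) ^ 2 ≠ 0 := by positivity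
  have := ((psi_inner δ x).inv hp).const_sub 1
  refine HasDerivAt.congr_deriv this ?_
  unfold psi1; ring

lemma psi1_deriv (δ x : ℝ) : HasDerivAt (psi1 δ) (psi2 δ x) x := by
  have hp : 1 + (δ * x) ^ 2 ≠ 0 := by positivity
  have h1 := (hasDerivAt_id x).const_mul (2 * δ ^ 2)
  have := h1.div ((psi_inner δ x).pow 2) (pow_ne_zero 2 hp)
  refine HasDerivAt.congr_deriv this ?_
  unfold psi2
  simp
  field_simp
  ring

lemma psi2_cont (δ : ℝ) : Continuous (psi2 δ) := by
  unfold psi2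
  refine Continuous.div (by fun_prop) (by fun_prop) fun x => by positivity

lemma psi1_bound {δ : ℝ} (hδ : 0 ≤ δ) (x : ℝ) : |psi1 δ x| ≤ δ := by
  have hp : 0 < (1 + (δ * x) ^ 2) ^ 2 := by positivity
  unfold psi1
  rw [abs_div, abs_of_pos hp, div_le_iff₀ hp]
  have e : |2 * δ ^ 2 * x| = δ * (2 * |δ * x|) := by
    rw [abs_mul, abs_mul, abs_mul, abs_of_nonneg hδ, abs_of_nonneg (sq_nonneg δ)]; norm_num; ring
  rw [e]
  refine mul_le_mul_of_nonneg_left ?_ hδ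
  have h1 : (δ * x) ^ 2 = |δ * x| ^ 2 := (sq_abs _).symm
  rw [h1]
  set y := |δ * x|
  nlinarith [sq_nonneg (y - 1), sq_nonneg y, sq_nonneg (y ^ 2)]

lemma psi2_bound (δ : ℝ) (x : ℝ) : |psi2 δ x| ≤ 6 * δ ^ 2 := by
  have hp : 0 < (1 + (δ * x) ^ 2) ^ 3 := by positivity
  unfold psi2
  rw [abs_div, abs_of_pos hp, div_le_iff₀ hp]
  have e : (2 * δ ^ 2 - 6 * δ ^ 4 * x ^ 2) = δ ^ 2 * (2 - 6 * (δ * x) ^ 2) := by ring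
  rw [e, abs_mul, abs_of_nonneg (sq_nonneg δ), mul_comm 6 (δ ^ 2), mul_assoc]
  refine mul_le_mul_of_nonneg_left ?_ (sq_nonneg δ)
  set y := (δ * x) ^ 2
  have hy : 0 ≤ y := sq_nonneg _
  have : 1 + y ≤ (1 + y) ^ 3 := by nlinarith [mul_nonneg hy hy, mul_nonneg hy (mul_nonneg hy hy)]
  rw [abs_le]
  constructor <;> linarith


lemma tight_bound {T : ℝ} (hT : 0 < T) {O A : Set ℝ} (hA : IsCompact A) {d : ℕ}
    {b σ : ℝ → ℝ → Measure (ℝ × ℝ) → ℝ → ℝ}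
    {bbar σbar : ℝ → ℝ → (Fin d → ℝ) → ℝ → ℝ} {bhat σhat : ℝ → ℝ → Fin d → ℝ}
    (hb : MFCoeff T O A d b bbar bhat) (hσ : MFCoeff T O A d σ σbar σhat)
    {m0 : Measure ℝ} (hm0 : InitAssumption2 O m0) :
    ∃ W : ℝ, 0 ≤ W ∧ ∀ (μ : Measure (ℝ × ℝ)) (m : ℝ → Measure (ℝ × ℝ)) (hm : MemV T O A m),
      MemR0 T O A b σ m0 μ m → ∀ δ : ℝ, 0 < δ → δ ≤ 1 →
        μ.real {p | 1 ≤ δ * |p.2|} ≤ W * δ ∧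
        (Lam T m hm.2.2.1).real {q | 1 ≤ δ * |q.2.1|} ≤ W * δ := by
  obtain ⟨_, hbf, ⟨Bb, hBb⟩, -⟩ := hb
  obtain ⟨_, hσf, ⟨Bs, hBs⟩, -⟩ := hσ
  have hb' : ∀ t x ν a, |b t x ν a| ≤ |Bb| := fun t x ν a => by
    rw [hbf]; exact (hBb _ _ _ _).trans (le_abs_self _)
  have hs' : ∀ t x ν a, |σ t x ν a| ≤ |Bs| := fun t x ν a => by
    rw [hσf]; exact (hBs _ _ _ _).trans (le_abs_self _)
  set M2 := ∫ x, x ^ 2 ∂m0 with hM2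
  have hM20 : 0 ≤ M2 := integral_nonneg fun x => sq_nonneg x
  set D := |Bb| + 3 * |Bs| ^ 2 with hD
  have hD0 : 0 ≤ D := by positivity
  refine ⟨2 * (M2 + D * T) * (1 + T), by positivity, ?_⟩
  intro μ m hm H δ hδ hδ1
  have hmass := Lam_mass_le hT hA hm0 hm H
  have hfin := Lam_finite hm
  rw [memR0_iff hA hm] at H
  obtain ⟨hp, hs, H⟩ := H
  obtain ⟨hp0, -, hi2⟩ := hm0
  have hS : MeasurableSet (Icc (0:ℝ) T ×ˢ closure O) :=
    measurableSet_Icc.prod isClosed_closure.measurableSet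
  have hpc : Continuous (psi δ) :=
    continuous_iff_continuousAt.2 fun t => (psi_deriv δ t).continuousAt
  have hpsiB : ∀ x, |psi δ x| ≤ 7 ∧ |psi1 δ x| ≤ 7 ∧ |psi2 δ x| ≤ 7 := by
    intro x
    refine ⟨?_, (psi1_bound hδ.le x).trans (by linarith), (psi2_bound δ x).trans (by nlinarith)⟩
    rw [abs_of_nonneg (psi_nonneg _ _)]
    linarith [psi_le_one δ x]
  have hm0b : ∫ x, psi δ x ∂m0 ≤ δ * M2 := by
    have h1 : ∫ x, psi δ x ∂m0 ≤ ∫ x, δ ^ 2 * x ^ 2 ∂m0 := by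
      refine integral_mono_ae ?_ (hi2.const_mul _) (Eventually.of_forall (psi_le_sq δ))
      exact Integrable.of_bound hpc.aestronglyMeasurable 7 (Eventually.of_forall fun x => (hpsiB x).1)
    rw [integral_const_mul] at h1
    have : δ ^ 2 * M2 ≤ δ * M2 := mul_le_mul_of_nonneg_right (by nlinarith) hM20
    linarith
  -- bound on the generator
  have hL : ∀ t x ν a (f : ℝ), |b t x ν a * (f * psi1 δ x) + σ t x ν a ^ 2 / 2 * (f * psi2 δ x)|
      ≤ |f| * (D * δ) := by
    intro t x ν a f
    have e : b t x ν a * (f * psi1 δ x) + σ t x ν a ^ 2 / 2 * (f * psi2 δ x) =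
      f * (b t x ν a * psi1 δ x + σ t x ν a ^ 2 / 2 * psi2 δ x) := by ring
    rw [e, abs_mul]
    refine mul_le_mul_of_nonneg_left ?_ (abs_nonneg f)
    refine (abs_add_le _ _).trans ?_
    rw [abs_mul, abs_mul, abs_div, abs_pow]
    have h1 : |b t x ν a| * |psi1 δ x| ≤ |Bb| * δ :=
      mul_le_mul (hb' _ _ _ _) (psi1_bound hδ.le x) (abs_nonneg _) (abs_nonneg _)
    have h2 : |σ t x ν a| ^ 2 / |2| * |psi2 δ x| ≤ |Bs| ^ 2 / |2| * (6 * δ ^ 2) := by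
      have := hs' t x ν a
      have := psi2_bound δ x
      gcongr
    have h3 : |Bs| ^ 2 / |2| * (6 * δ ^ 2) ≤ 3 * |Bs| ^ 2 * δ := by
      rw [abs_two]
      have : |Bs| ^ 2 * δ ^ 2 ≤ |Bs| ^ 2 * δ :=
        mul_le_mul_of_nonneg_left (by nlinarith) (by positivity)
      nlinarith
    rw [hD]
    linarith
  have hpost : ∀ x : ℝ, 1 ≤ δ * |x| → 1 / 2 ≤ psi δ x := fun x => half_le_psi δ x
  have hiμ : Integrable (fun p : ℝ × ℝ => psi δ p.2) μ :=
    Integrable.of_bound (hpc.comp continuous_snd).aestronglyMeasurable 7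
      (Eventually.of_forall fun x => (hpsiB x.2).1)
  have hiΛ : Integrable (fun q : ℝ × ℝ × ℝ => psi δ q.2.1) (Lam T m hm.2.2.1) :=
    Integrable.of_bound (hpc.comp (continuous_fst.comp continuous_snd)).aestronglyMeasurable 7
      (Eventually.of_forall fun x => (hpsiB x.2.1).1)
  have hmδ : (D * δ) * (Lam T m hm.2.2.1).real univ ≤ D * δ * T :=
    mul_le_mul_of_nonneg_left hmass (by positivity)
  constructor
  · have hu := isCb12_prod T O (fun _ => 1) (fun _ => 0) (psi δ) (psi1 δ) (psi2 δ)
      (fun t => hasDerivAt_const t 1) continuous_const (psi_deriv δ) (psi1_deriv δ) (psi2_cont δ)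
      7 hpsiB
    have h := H _ _ _ _ hu (D * δ) (by
      intro t _ x _ ν _ _ a _
      simpa using hL t x ν a 1)
    simp only [one_mul, zero_mul, integral_zero, add_zero] at h
    have hmk := mul_meas_ge_le_integral_of_nonneg (μ := μ) (f := fun p : ℝ × ℝ => psi δ p.2)
      (Eventually.of_forall fun p => psi_nonneg _ _) hiμ (1 / 2)
    have hsub : μ.real {p | 1 ≤ δ * |p.2|} ≤ μ.real {p | 1 / 2 ≤ psi δ p.2} :=
      measureReal_mono fun p hp => hpost p.2 hp
    have : 0 ≤ (M2 + D * T) * δ * T := by positivity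
    nlinarith
  · have hf : ∀ t : ℝ, HasDerivAt (fun t => T - t) (-1) t := fun t => by
      simpa using (hasDerivAt_id t).const_sub T
    have hu := isCb12_prod T O (fun t => T - t) (fun _ => -1) (psi δ) (psi1 δ) (psi2 δ)
      hf continuous_const (psi_deriv δ) (psi1_deriv δ) (psi2_cont δ) 7 hpsiB
    have h := H _ _ _ _ hu (T * (D * δ)) (by
      intro t ht x _ ν _ _ a _
      refine (hL t x ν a (T - t)).trans ?_
      refine mul_le_mul_of_nonneg_right ?_ (by positivity)
      rw [abs_of_nonneg (by linarith [ht.2])]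
      linarith [ht.1])
    have hae : ∀ᵐ p ∂μ, p ∈ (Icc (0:ℝ) T ×ˢ closure O) := by
      rw [ae_iff]; exact hs
    have hnn : 0 ≤ ∫ p : ℝ × ℝ, (T - p.1) * psi δ p.2 ∂μ := by
      refine integral_nonneg_of_ae ?_
      filter_upwards [hae] with p hp
      exact mul_nonneg (by linarith [hp.1.2]) (psi_nonneg _ _)
    simp only [sub_zero, integral_const_mul] at h
    have hmk := mul_meas_ge_le_integral_of_nonneg (μ := Lam T m hm.2.2.1)
      (f := fun q : ℝ × ℝ × ℝ => psi δ q.2.1)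
      (Eventually.of_forall fun p => psi_nonneg _ _) hiΛ (1 / 2)
    have hsub : (Lam T m hm.2.2.1).real {q | 1 ≤ δ * |q.2.1|} ≤
        (Lam T m hm.2.2.1).real {q | 1 / 2 ≤ psi δ q.2.1} :=
      measureReal_mono fun p hp => hpost p.2.1 hp
    have h5 : T * ((D * δ) * (Lam T m hm.2.2.1).real univ) ≤ T * (D * δ * T) :=
      mul_le_mul_of_nonneg_left hmδ hT.le
    have h6 : T * ∫ x, psi δ x ∂m0 ≤ T * (δ * M2) := mul_le_mul_of_nonneg_left hm0b hT.le
    have : 0 ≤ (M2 + D * T) * δ := by positivity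
    nlinarith


lemma extract_prob {E : Type*} [TopologicalSpace E] [TopologicalSpace.MetrizableSpace E]
    [SecondCountableTopology E] [MeasurableSpace E] [BorelSpace E]
    (P : ℕ → Measure E) (hP : ∀ n, IsProbabilityMeasure (P n)) (K : ℕ → Set E)
    (hK : ∀ k, IsCompact (K k)) (W : ℝ) (hW : 0 ≤ W)
    (h : ∀ n k : ℕ, (P n).real (K k)ᶜ ≤ W * (1 / ((k:ℝ) + 1))) :
    ∃ φ : ℕ → ℕ, StrictMono φ ∧ ∃ Q : Measure E, IsProbabilityMeasure Q ∧
      ∀ f : E → ℝ, Continuous f → (∃ C : ℝ, ∀ p, |f p| ≤ C) →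
        Tendsto (fun n => ∫ p, f p ∂(P (φ n))) atTop (𝓝 (∫ p, f p ∂Q)) := by
  let u : ℕ → NNReal := fun k => Real.toNNReal (W * (1 / ((k:ℝ) + 1)))
  have hu : Tendsto u atTop (𝓝 0) := by
    have h1 : Tendsto (fun k : ℕ => W * (1 / ((k:ℝ) + 1))) atTop (𝓝 (W * 0)) :=
      tendsto_one_div_add_atTop_nhds_zero_nat.const_mul W
    rw [mul_zero] at h1
    have := (continuous_real_toNNReal.tendsto 0).comp h1
    rw [Real.toNNReal_zero] at this
    exact this
  have hc := isCompact_setOfPred_probabilityMeasure_mass_eq_compl_isCompact_le hu hK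
    (Or.inl inferInstance)
  let X : ℕ → ProbabilityMeasure E := fun n => ⟨P n, hP n⟩
  obtain ⟨Q, -, φ, hφ, hQ⟩ := hc.tendsto_subseq (x := X) (by
    intro n k
    rw [← NNReal.coe_le_coe]
    refine (h n k).trans ?_
    exact Real.le_coe_toNNReal _)
  refine ⟨φ, hφ, Q, inferInstance, fun f hf ⟨C, hC⟩ => ?_⟩
  rw [ProbabilityMeasure.tendsto_iff_forall_integral_tendsto] at hQ
  exact hQ (BoundedContinuousFunction.ofNormedAddCommGroup f hf C hC)

lemma extract_fin {T : ℝ} (hT : 0 < T) (L : ℕ → Measure (ℝ × ℝ × ℝ))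
    (hL : ∀ n, IsFiniteMeasure (L n)) (hmass : ∀ n, (L n).real univ ≤ T)
    (hs : ∀ n, ∀ᵐ q ∂(L n), q.1 ≤ T) (K : ℕ → Set (ℝ × ℝ × ℝ))
    (hK : ∀ k, IsCompact (K k)) (W : ℝ) (hW : 0 ≤ W)
    (h : ∀ n k : ℕ, (L n).real (K k)ᶜ ≤ W * (1 / ((k:ℝ) + 1))) :
    ∃ φ : ℕ → ℕ, StrictMono φ ∧ ∃ Λ : Measure (ℝ × ℝ × ℝ), IsFiniteMeasure Λ ∧
      ∀ f : ℝ × ℝ × ℝ → ℝ, Continuous f → (∃ C : ℝ, ∀ p, |f p| ≤ C) →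
        Tendsto (fun n => ∫ p, f p ∂(L (φ n))) atTop (𝓝 (∫ p, f p ∂Λ)) := by
  let z : ℝ × ℝ × ℝ := (T + 1, 0, 0)
  let P : ℕ → Measure (ℝ × ℝ × ℝ) := fun n =>
    ENNReal.ofReal T⁻¹ • L n + ENNReal.ofReal (1 - T⁻¹ * (L n).real univ) • Measure.dirac z
  have hTi : 0 < T⁻¹ := inv_pos.2 hT
  have hnn : ∀ n, 0 ≤ 1 - T⁻¹ * (L n).real univ := fun n => by
    have := mul_le_mul_of_nonneg_left (hmass n) hTi.le
    rw [inv_mul_cancel₀ hT.ne'] at this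
    linarith
  have hP : ∀ n, IsProbabilityMeasure (P n) := fun n => by
    constructor
    simp only [P, Measure.add_apply, Measure.smul_apply, measure_univ, smul_eq_mul, mul_one]
    rw [← ofReal_measureReal (μ := L n) (s := univ), ← ENNReal.ofReal_mul hTi.le,
      ← ENNReal.ofReal_add (by positivity) (hnn n)]
    simp
  obtain ⟨φ, hφ, Q, hQ, hconv⟩ := extract_prob P hP (fun k => insert z (K k))
    (fun k => (hK k).insert z) (T⁻¹ * W) (by positivity) (by
      intro n k
      have h1 : P n (insert z (K k))ᶜ ≤ ENNReal.ofReal (T⁻¹ * (W * (1 / ((k:ℝ) + 1)))) := by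
        have h0 : Measure.dirac z (insert z (K k))ᶜ = 0 := by
          rw [Measure.dirac_apply' _ ((hK k).insert z).measurableSet.compl]
          simp
        simp only [P, Measure.add_apply, Measure.smul_apply, smul_eq_mul, h0, mul_zero, add_zero]
        rw [ENNReal.ofReal_mul hTi.le]
        gcongr
        refine (measure_mono (compl_subset_compl.2 (subset_insert z (K k)))).trans ?_
        rw [← ofReal_measureReal (μ := L n)]
        exact ENNReal.ofReal_le_ofReal (h n k)
      rw [mul_assoc]
      exact ENNReal.toReal_le_of_le_ofReal (by positivity) h1)
  let χ : ℝ × ℝ × ℝ → NNReal := fun q => Real.toNNReal (min 1 (T + 1 - q.1))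
  have hχc : Continuous χ := by fun_prop
  have hχ1 : ∀ q, (χ q : ℝ) ≤ 1 := fun q => by
    simp only [χ, Real.coe_toNNReal']
    exact max_le (min_le_left _ _) zero_le_one
  have hχz : χ z = 0 := by simp [χ, z]
  have hχT : ∀ q : ℝ × ℝ × ℝ, q.1 ≤ T → χ q = 1 := fun q hq => by
    have : min 1 (T + 1 - q.1) = 1 := min_eq_left (by linarith)
    simp [χ, this]
  have hfinχ : IsFiniteMeasure (Q.withDensity fun q => (χ q : ENNReal)) := by
    refine isFiniteMeasure_withDensity (ne_of_lt ?_)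
    refine lt_of_le_of_lt (lintegral_mono (g := fun _ => 1) fun q => ?_) (by simp)
    have : χ q ≤ 1 := by exact_mod_cast hχ1 q
    change (χ q : ENNReal) ≤ 1
    exact_mod_cast this
  refine ⟨φ, hφ, ENNReal.ofReal T • Q.withDensity (fun q => (χ q : ENNReal)), ?_, ?_⟩
  · exact Measure.smul_finite _ ENNReal.ofReal_ne_top
  · rintro f hf ⟨C, hC⟩
    have hg : Continuous fun q => (χ q : ℝ) * f q := by fun_prop
    have hgb : ∀ q, |(χ q : ℝ) * f q| ≤ C := fun q => by
      rw [abs_mul, abs_of_nonneg (NNReal.coe_nonneg (χ q))]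
      calc (χ q : ℝ) * |f q| ≤ 1 * |f q| := by gcongr; exact hχ1 q
        _ ≤ C := by rw [one_mul]; exact hC q
    have h1 := (hconv _ hg ⟨C, hgb⟩).const_mul T
    have e2 : ∫ p, f p ∂(ENNReal.ofReal T • Q.withDensity (fun q => (χ q : ENNReal)))
        = T * ∫ q, (χ q : ℝ) * f q ∂Q := by
      rw [integral_smul_measure, integral_withDensity_eq_integral_smul hχc.measurable,
        ENNReal.toReal_ofReal hT.le]
      rfl
    rw [e2]
    refine h1.congr fun n => ?_
    have hi : ∀ ν : Measure (ℝ × ℝ × ℝ), IsFiniteMeasure ν →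
        Integrable (fun q => (χ q : ℝ) * f q) ν := fun ν _ =>
      Integrable.of_bound hg.aestronglyMeasurable C (Eventually.of_forall hgb)
    have := hL (φ n)
    simp only [P]
    rw [integral_add_measure ((hi _ this).smul_measure ENNReal.ofReal_ne_top)
      ((hi _ inferInstance).smul_measure ENNReal.ofReal_ne_top),
      integral_smul_measure, integral_smul_measure, integral_dirac, hχz,
      ENNReal.toReal_ofReal hTi.le]
    simp only [NNReal.coe_zero, zero_mul, smul_eq_mul, mul_zero, add_zero]
    rw [← mul_assoc, mul_inv_cancel₀ hT.ne', one_mul]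
    refine integral_congr_ae ?_
    filter_upwards [hs (φ n)] with q hq
    simp [hχT q hq]

lemma limit_support {E : Type*} [MetricSpace E] [SecondCountableTopology E]
    [MeasurableSpace E] [BorelSpace E] (P : ℕ → Measure E) (Q : Measure E)
    [hQ : IsFiniteMeasure Q] 
    (h : ∀ f : E → ℝ, Continuous f → (∃ C : ℝ, ∀ p, |f p| ≤ C) →
        Tendsto (fun n => ∫ p, f p ∂(P n)) atTop (𝓝 (∫ p, f p ∂Q)))
    (F : Set E) (hF : IsClosed F) (hP : ∀ n, P n Fᶜ = 0) : Q Fᶜ = 0 := by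
  rcases F.eq_empty_or_nonempty with rfl | hne
  · have h1 := h (fun _ => 1) continuous_const ⟨1, by simp⟩
    have h0 : ∀ n, P n = 0 := fun n => by
      have := hP n
      rwa [compl_empty, Measure.measure_univ_eq_zero] at this
    simp only [h0, integral_zero_measure] at h1
    have := tendsto_nhds_unique h1 tendsto_const_nhds
    simp only [integral_const, smul_eq_mul, mul_one] at this
    rw [measureReal_eq_zero_iff] at this
    simpa using this
  · let f : E → ℝ := fun x => min 1 (Metric.infDist x F)
    have hf : Continuous f := continuous_const.min (Metric.continuous_infDist_pt F)
    have hf0 : ∀ x, 0 ≤ f x := fun x => le_min zero_le_one Metric.infDist_nonneg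
    have hb : ∀ x, |f x| ≤ 1 := fun x => by
      rw [abs_of_nonneg (hf0 x)]; exact min_le_left _ _
    have h1 := h f hf ⟨1, hb⟩
    have h0 : ∀ n, ∫ p, f p ∂(P n) = 0 := fun n => by
      refine integral_eq_zero_of_ae ?_
      have : ∀ᵐ x ∂(P n), x ∈ F := by rw [ae_iff]; exact hP n
      filter_upwards [this] with x hx
      simp [f, Metric.infDist_zero_of_mem hx]
    simp only [h0] at h1
    have h2 := tendsto_nhds_unique h1 tendsto_const_nhds
    rw [integral_eq_zero_iff_of_nonneg hf0
      (Integrable.of_bound hf.aestronglyMeasurable 1 (Eventually.of_forall hb))] at h2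
    have : ∀ᵐ x ∂Q, x ∈ F := by
      filter_upwards [h2] with x hx
      have h3 : min 1 (Metric.infDist x F) = 0 := hx
      have h4 : Metric.infDist x F = 0 := by
        rcases min_choice 1 (Metric.infDist x F) with h | h
        · rw [h] at h3; norm_num at h3
        · rw [← h]; exact h3
      rw [← hF.closure_eq, Metric.mem_closure_iff_infDist_zero hne]
      exact h4
    exact ae_iff.1 this

lemma tietze_ext {F : Set (ℝ × ℝ)} (hF : IsClosed F) (v : ℝ × ℝ → ℝ) (hv : ContinuousOn v F)
    (C : ℝ) (hC : ∀ p ∈ F, |v p| ≤ C) :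
    ∃ h : ℝ × ℝ → ℝ, Continuous h ∧ (∀ p, |h p| ≤ |C|) ∧ ∀ p ∈ F, h p = v p := by
  obtain ⟨g, hg, hge⟩ := ContinuousMap.exists_extension_forall_mem_of_isClosedEmbedding
    (⟨F.domRestrict v, hv.domRestrict⟩ : C(F, ℝ)) (t := Icc (-|C|) |C|)
    (fun x => by
      have := (hC x.1 x.2).trans (le_abs_self C)
      exact abs_le.1 this) ⟨0, by simp⟩ hF.isClosedEmbedding_subtypeVal
  exact ⟨g, g.continuous, fun p => abs_le.2 (hg p), fun p hp => congrFun hge ⟨p, hp⟩⟩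

lemma disint {T : ℝ} {O A : Set ℝ} (hA : IsCompact A) (Λ : Measure (ℝ × ℝ × ℝ))
    [IsFiniteMeasure Λ] (hs : Λ ((Icc 0 T ×ˢ closure O ×ˢ A)ᶜ) = 0)
    (hle : Λ.fst ≤ volume.restrict (Icc 0 T)) :
    ∃ (m : ℝ → Measure (ℝ × ℝ)) (hm : MemV T O A m), Lam T m hm.2.2.1 = Λ := by
  set ν : Measure ℝ := volume.restrict (Icc 0 T) with hν
  set ρ := Λ.fst.rnDeriv ν with hρ
  have hρm : Measurable ρ := Measure.measurable_rnDeriv _ _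
  have hρ1 : ∀ᵐ t ∂ν, ρ t ≤ 1 := Measure.rnDeriv_le_one_of_le hle
  have hwd : ν.withDensity ρ = Λ.fst :=
    Measure.withDensity_rnDeriv_eq _ _ (Measure.absolutelyContinuous_of_le hle)
  set S : Set (ℝ × ℝ) := closure O ×ˢ A with hS
  have hSm : MeasurableSet S := isClosed_closure.measurableSet.prod hA.measurableSet
  let m : ℝ → Measure (ℝ × ℝ) := fun t => (min (ρ t) 1) • (Λ.condKernel t).restrict S
  have hmle : ∀ t, m t univ ≤ 1 := fun t => by
    simp only [m, Measure.smul_apply, smul_eq_mul, Measure.restrict_apply_univ]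
    calc min (ρ t) 1 * Λ.condKernel t S ≤ 1 * 1 := by
          gcongr
          · exact min_le_right _ _
          · exact prob_le_one
      _ = 1 := one_mul 1
  have hmm : ∀ B : Set (ℝ × ℝ), MeasurableSet B → Measurable fun t => m t B := by
    intro B hB
    simp only [m, Measure.smul_apply, smul_eq_mul, Measure.restrict_apply hB]
    exact (hρm.min measurable_const).mul (Kernel.measurable_coe _ (hB.inter hSm))
  have hm : MemV T O A m := by
    refine ⟨fun t => (hmle t).trans_lt (by simp), fun t => ?_, hmm, ?_⟩
    · simp only [m, Measure.smul_apply, smul_eq_mul]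
      rw [Measure.restrict_apply hSm.compl]
      simp
    · refine Integrable.of_bound (hmm _ MeasurableSet.univ).ennreal_toReal.aestronglyMeasurable 1
        (Eventually.of_forall fun t => ?_)
      rw [Real.norm_of_nonneg ENNReal.toReal_nonneg]
      exact ENNReal.toReal_le_of_le_ofReal zero_le_one (by simpa using hmle t)
  refine ⟨m, hm, ?_⟩
  ext s hsm
  rw [Lam_apply hm hsm]
  have hUm : MeasurableSet (Prod.snd ⁻¹' S : Set (ℝ × ℝ × ℝ)) := measurable_snd hSm
  have e1 : Λ s = Λ (s ∩ Prod.snd ⁻¹' S) := by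
    refine (measure_inter_conull (measure_mono_null ?_ hs)).symm
    rintro q hq hq2
    exact hq hq2.2
  have hmk : Measurable fun t => Λ.condKernel t {y | (t, y) ∈ s ∩ Prod.snd ⁻¹' S} :=
    Kernel.measurable_kernel_prodMk_left (hsm.inter hUm)
  rw [e1, ← Measure.lintegral_condKernel_mem (hsm.inter hUm), ← hwd,
    lintegral_withDensity_eq_lintegral_mul _ hρm hmk]
  refine lintegral_congr_ae ?_
  filter_upwards [hρ1] with t ht
  simp only [m, Measure.smul_apply, smul_eq_mul, Pi.mul_apply]
  rw [min_eq_left ht, Measure.restrict_apply (measurable_prodMk_left hsm)]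
  rfl


lemma memR0_compact {T : ℝ} (hT : 0 < T) {O A : Set ℝ} (hA : IsCompact A) {d : ℕ}
    {b σ : ℝ → ℝ → Measure (ℝ × ℝ) → ℝ → ℝ}
    {bbar σbar : ℝ → ℝ → (Fin d → ℝ) → ℝ → ℝ} {bhat σhat : ℝ → ℝ → Fin d → ℝ}
    (hb : MFCoeff T O A d b bbar bhat) (hσ : MFCoeff T O A d σ σbar σhat)
    {m0 : Measure ℝ} (hm0 : InitAssumption2 O m0)
    (μn : ℕ → Measure (ℝ × ℝ)) (mn : ℕ → ℝ → Measure (ℝ × ℝ))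
    (H : ∀ n, MemR0 T O A b σ m0 (μn n) (mn n)) :
      ∃ φ : ℕ → ℕ, StrictMono φ ∧
        ∃ (μ : Measure (ℝ × ℝ)) (m : ℝ → Measure (ℝ × ℝ)),
          MemR0 T O A b σ m0 μ m ∧
          WeakConv (fun k => μn (φ k)) μ ∧ ConvV T (fun k => mn (φ k)) m := by
  obtain ⟨W, hW, htight⟩ := tight_bound hT hA hb hσ hm0
  have hv : ∀ n, MemV T O A (mn n) := fun n => (H n).2.2.1
  have hFc : IsClosed (Icc (0:ℝ) T ×ˢ closure O) := isClosed_Icc.prod isClosed_closure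
  have hGc : IsClosed (Icc (0:ℝ) T ×ˢ closure O ×ˢ A) :=
    isClosed_Icc.prod (isClosed_closure.prod hA.isClosed)
  let L : ℕ → Measure (ℝ × ℝ × ℝ) := fun n => Lam T (mn n) (hv n).2.2.1
  have hLf : ∀ n, IsFiniteMeasure (L n) := fun n => Lam_finite (hv n)
  have hLs : ∀ n, L n ((Icc (0:ℝ) T ×ˢ closure O ×ˢ A)ᶜ) = 0 := fun n => Lam_compl hA (hv n)
  have hδ : ∀ k : ℕ, 0 < 1 / ((k:ℝ) + 1) ∧ 1 / ((k:ℝ) + 1) ≤ 1 := fun k => by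
    refine ⟨by positivity, ?_⟩
    rw [div_le_one (by positivity)]
    have : (0:ℝ) ≤ k := k.cast_nonneg
    linarith
  have habs : ∀ (k : ℕ) (x : ℝ), x ∉ Icc (-((k:ℝ) + 1)) ((k:ℝ) + 1) →
      1 ≤ 1 / ((k:ℝ) + 1) * |x| := fun k x hx => by
    have h0 : (0:ℝ) < (k:ℝ) + 1 := by positivity
    have : (k:ℝ) + 1 < |x| := by
      by_contra hc
      exact hx (abs_le.1 (not_lt.1 hc))
    rw [one_div_mul_eq_div, le_div_iff₀ h0]
    linarith
  -- first extraction
  obtain ⟨φ1, hφ1, μ, hμp, hμ⟩ := extract_prob μn (fun n => (H n).1)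
    (fun k => Icc 0 T ×ˢ Icc (-((k:ℝ) + 1)) ((k:ℝ) + 1))
    (fun k => isCompact_Icc.prod isCompact_Icc) W hW (by
      intro n k
      have := (H n).1
      refine le_trans ?_ (htight (μn n) (mn n) (hv n) (H n) _ (hδ k).1 (hδ k).2).1
      refine ENNReal.toReal_mono (measure_ne_top _ _) (measure_mono_ae ?_)
      have hs : ∀ᵐ p ∂(μn n), p ∈ Icc (0:ℝ) T ×ˢ closure O := by
        rw [ae_iff]; exact (H n).2.1
      filter_upwards [hs] with p hp hp2
      refine habs k p.2 fun hc => hp2 ⟨hp.1, hc⟩)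
  -- second extraction
  obtain ⟨φ2, hφ2, Λ, hΛf, hΛ⟩ := extract_fin hT (fun n => L (φ1 n)) (fun n => hLf _)
    (fun n => Lam_mass_le hT hA hm0 (hv _) (H _))
    (fun n => by
      have hs : ∀ᵐ q ∂(L (φ1 n)), q ∈ Icc (0:ℝ) T ×ˢ closure O ×ˢ A := by
        rw [ae_iff]; exact hLs _
      filter_upwards [hs] with q hq
      exact hq.1.2)
    (fun k => Icc 0 T ×ˢ Icc (-((k:ℝ) + 1)) ((k:ℝ) + 1) ×ˢ A)
    (fun k => isCompact_Icc.prod (isCompact_Icc.prod hA)) W hW (by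
      intro n k
      have := hLf (φ1 n)
      refine le_trans ?_ (htight _ _ (hv (φ1 n)) (H (φ1 n)) _ (hδ k).1 (hδ k).2).2
      refine ENNReal.toReal_mono (measure_ne_top _ _) (measure_mono_ae ?_)
      have hs : ∀ᵐ q ∂(L (φ1 n)), q ∈ Icc (0:ℝ) T ×ˢ closure O ×ˢ A := by
        rw [ae_iff]; exact hLs _
      filter_upwards [hs] with q hq hq2
      refine habs k q.2.1 fun hc => hq2 ⟨hq.1, hc, hq.2.2⟩)
  have hμ2 : ∀ f : ℝ × ℝ → ℝ, Continuous f → (∃ C : ℝ, ∀ p, |f p| ≤ C) →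
      Tendsto (fun n => ∫ p, f p ∂(μn (φ1 (φ2 n)))) atTop (𝓝 (∫ p, f p ∂μ)) :=
    fun f hf hC => (hμ f hf hC).comp hφ2.tendsto_atTop
  have hμs : μ ((Icc 0 T ×ˢ closure O)ᶜ) = 0 :=
    limit_support _ μ hμ2 _ hFc fun n => (H _).2.1
  have hΛs : Λ ((Icc 0 T ×ˢ closure O ×ˢ A)ᶜ) = 0 :=
    limit_support _ Λ hΛ _ hGc fun n => hLs _
  have hle : Λ.fst ≤ volume.restrict (Icc 0 T) := by
    refine measure_le_of_integral_le fun g hg hg0 hgC => ?_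
    obtain ⟨C, hC⟩ := hgC
    rw [Measure.fst, integral_map measurable_fst.aemeasurable hg.aestronglyMeasurable]
    refine le_of_tendsto' (hΛ (fun q => g q.1) (by fun_prop)
      ⟨C, fun q => by rw [abs_of_nonneg (hg0 _)]; exact hC _⟩) fun n => ?_
    exact time_marginal hT hA hm0 (hv _) (H _) g hg hg0
  obtain ⟨m, hm, hmΛ⟩ := disint hA Λ hΛs hle
  refine ⟨φ1 ∘ φ2, hφ1.comp hφ2, μ, m, ?_, hμ2, ?_⟩
  · rw [memR0_iff hA hm]
    refine ⟨hμp, hμs, fun u ut ux uxx hu C hC => ?_⟩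
    rw [hmΛ]
    obtain ⟨B, hB⟩ := hu.bdd
    obtain ⟨f, hf, hfB, hfe⟩ := tietze_ext hFc _ hu.cont B
      (fun p hp => (hB p.1 hp.1 p.2 hp.2).1)
    obtain ⟨g, hg, hgB, hge⟩ := tietze_ext hFc _ hu.cont_t B
      (fun p hp => (hB p.1 hp.1 p.2 hp.2).2.1)
    have ef : ∀ ν : Measure (ℝ × ℝ), ν ((Icc 0 T ×ˢ closure O)ᶜ) = 0 →
        ∫ p, f p ∂ν = ∫ p, u p.1 p.2 ∂ν := fun ν hν => by
      refine integral_congr_ae ?_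
      have hs : ∀ᵐ p ∂ν, p ∈ Icc (0:ℝ) T ×ˢ closure O := by rw [ae_iff]; exact hν
      filter_upwards [hs] with p hp
      exact hfe p hp
    have eg : ∀ ν : Measure (ℝ × ℝ × ℝ), ν ((Icc 0 T ×ˢ closure O ×ˢ A)ᶜ) = 0 →
        ∫ q, g (q.1, q.2.1) ∂ν = ∫ q, ut q.1 q.2.1 ∂ν := fun ν hν => by
      refine integral_congr_ae ?_
      have hs : ∀ᵐ q ∂ν, q ∈ Icc (0:ℝ) T ×ˢ closure O ×ˢ A := by rw [ae_iff]; exact hν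
      filter_upwards [hs] with q hq
      exact hge (q.1, q.2.1) ⟨hq.1, hq.2.1⟩
    have t1 := hμ2 f hf ⟨_, hfB⟩
    have t2 := hΛ (fun q => g (q.1, q.2.1)) (by fun_prop) ⟨_, fun q => hgB _⟩
    have t3 := hΛ (fun _ => 1) continuous_const ⟨1, by simp⟩
    simp only [integral_const, smul_eq_mul, mul_one] at t3
    rw [ef μ hμs] at t1
    rw [eg Λ hΛs] at t2
    refine le_of_tendsto_of_tendsto' t1
      ((tendsto_const_nhds.add t2).add (t3.const_mul C)) fun n => ?_
    rw [ef _ (H _).2.1, eg _ (hLs _)]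
    exact ((memR0_iff hA (hv _)).1 (H _)).2.2 u ut ux uxx hu C hC
  · rintro h hh ⟨C, hC⟩
    have hi : ∀ ν : Measure (ℝ × ℝ × ℝ), IsFiniteMeasure ν →
        Integrable (fun q : ℝ × ℝ × ℝ => h q.1 q.2) ν := fun ν _ =>
      Integrable.of_bound hh.aestronglyMeasurable C (Eventually.of_forall fun q => hC _ _)
    have t := hΛ (fun q => h q.1 q.2) hh ⟨C, fun q => hC _ _⟩
    rw [← hmΛ, integral_Lam hm (hi _ (Lam_finite hm))] at t
    refine t.congr fun n => ?_
    exact integral_Lam (hv _) (hi _ (hLf _))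

end Helpers

/-- Properties of the set `R₀`: under the mean-field assumptions,
`R₀` is (sequentially) compact, convex and nonempty; `R[m̄] ⊆ R₀` for every `m̄ ∈ V`;
and every `(μ, m) ∈ R₀` satisfies `m_t(Ō×A) ≤ 1` for Lebesgue-a.e. `t ∈ [0,T]`. -/
theorem memR0_properties
    (T : ℝ) (hT : 0 < T) (O A : Set ℝ) (hO : IsOpen O) (hA : IsCompact A)
    (d : ℕ) (hd : 0 < d)
    (b σ : ℝ → ℝ → Measure (ℝ × ℝ) → ℝ → ℝ)
    (bbar σbar : ℝ → ℝ → (Fin d → ℝ) → ℝ → ℝ) (bhat σhat : ℝ → ℝ → Fin d → ℝ)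
    (hb : MFCoeff T O A d b bbar bhat) (hσ : MFCoeff T O A d σ σbar σhat)
    (hσpos : ∀ t x ν a, 0 ≤ σ t x ν a)
    (m0 : Measure ℝ) (hm0 : InitAssumption2 O m0) :
    -- sequential compactness of R₀
    (∀ (μn : ℕ → Measure (ℝ × ℝ)) (mn : ℕ → ℝ → Measure (ℝ × ℝ)),
      (∀ n, MemR0 T O A b σ m0 (μn n) (mn n)) →
      ∃ φ : ℕ → ℕ, StrictMono φ ∧
        ∃ (μ : Measure (ℝ × ℝ)) (m : ℝ → Measure (ℝ × ℝ)),
          MemR0 T O A b σ m0 μ m ∧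
          WeakConv (fun k => μn (φ k)) μ ∧ ConvV T (fun k => mn (φ k)) m) ∧
    -- convexity of R₀
    (∀ (μ1 μ2 : Measure (ℝ × ℝ)) (m1 m2 : ℝ → Measure (ℝ × ℝ)),
      MemR0 T O A b σ m0 μ1 m1 → MemR0 T O A b σ m0 μ2 m2 →
      ∀ θ : ℝ, 0 ≤ θ → θ ≤ 1 →
        MemR0 T O A b σ m0
          (ENNReal.ofReal θ • μ1 + ENNReal.ofReal (1 - θ) • μ2)
          (fun t => ENNReal.ofReal θ • m1 t + ENNReal.ofReal (1 - θ) • m2 t)) ∧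
    -- nonemptiness of R₀
    (∃ (μ : Measure (ℝ × ℝ)) (m : ℝ → Measure (ℝ × ℝ)), MemR0 T O A b σ m0 μ m) ∧
    -- R[m̄] ⊆ R₀ for every m̄ ∈ V
    (∀ mbar : ℝ → Measure (ℝ × ℝ), MemV T O A mbar →
      ∀ (μ : Measure (ℝ × ℝ)) (m : ℝ → Measure (ℝ × ℝ)),
        MemRm T O A b σ m0 mbar μ m → MemR0 T O A b σ m0 μ m) ∧
    -- subprobability property on R₀
    (∀ (μ : Measure (ℝ × ℝ)) (m : ℝ → Measure (ℝ × ℝ)), MemR0 T O A b σ m0 μ m →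
      ∀ᵐ t ∂(volume.restrict (Set.Icc 0 T)), m t (closure O ×ˢ A) ≤ 1) := by
  exact ⟨fun μn mn H => memR0_compact hT hA hb hσ hm0 μn mn H,
    fun μ1 μ2 m1 m2 H1 H2 θ h0 h1 => memR0_convex hA μ1 μ2 m1 m2 H1 H2 θ h0 h1,
    memR0_nonempty hT hm0,
    fun mbar hmb μ m H => memRm_sub hA hb hσ hmb H,
    fun μ m H => memR0_subprob hT hA hm0 H⟩
end
end

section
/- Closed graph of the constraint correspondence (upper hemicontinuity): let (μ̄ⁿ, m̄ⁿ)_{n≥1}, (μⁿ, mⁿ)_{n≥1} ⊆ R₀ with (μⁿ, mⁿ) ∈ R[m̄ⁿ] for all n, and suppose μⁿ converges weakly to μ, mⁿ → m in V, μ̄ⁿ converges weakly to μ̄ and m̄ⁿ → m̄ in V. Then (μ, m) ∈ R[m̄]. -/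
open MeasureTheory Filter Set Topology

noncomputable section

lemma tietze_bdd {X : Type*} [TopologicalSpace X] [NormalSpace X] {s : Set X} (hs : IsClosed s)
    {f : X → ℝ} (hf : ContinuousOn f s) {C : ℝ} (hC0 : 0 ≤ C) (hC : ∀ x ∈ s, |f x| ≤ C) :
    ∃ g : X → ℝ, Continuous g ∧ (∀ x, |g x| ≤ C) ∧ ∀ x ∈ s, g x = f x := by
  obtain ⟨g, hg, hgf⟩ := ContinuousMap.exists_restrict_eq_forall_mem_of_closed
    (⟨s.domRestrict f, continuousOn_iff_continuous_domRestrict.mp hf⟩ : C(s, ℝ)) (t := Icc (-C) C)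
    (fun x => abs_le.mp (hC x x.2)) ⟨0, by simpa using hC0⟩ hs
  refine ⟨g, g.continuous, fun x => abs_le.mpr (hg x), fun x hx => ?_⟩
  exact congrArg (fun h : C(s, ℝ) => h ⟨x, hx⟩) hgf

lemma ae_nonpos_of_cont {T : ℝ} {g : ℝ → ℝ} (hgm : Measurable g)
    (hg : IntegrableOn g (Icc 0 T))
    (h : ∀ ψ : ℝ → ℝ, Continuous ψ → (∀ t, 0 ≤ ψ t) → (∀ t, ψ t ≤ 1) →
      ∫ t in Icc 0 T, ψ t * g t ≤ 0) :
    ∀ᵐ t ∂(volume.restrict (Icc 0 T)), g t ≤ 0 := by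
  set μ := (volume : Measure ℝ).restrict (Icc 0 T)
  have hF : ∀ F : Set ℝ, IsClosed F → ∫ t in F, g t ∂μ ≤ 0 := by
    intro F hF
    have hδ : ∀ k : ℕ, (0:ℝ) < 1 / (k + 1) := fun k => Nat.one_div_pos_of_nat
    have hlim := thickenedIndicator_tendsto_indicator_closure hδ
      tendsto_one_div_add_atTop_nhds_zero_nat F
    rw [tendsto_pi_nhds] at hlim
    have h1 : Tendsto (fun k : ℕ => ∫ t, ((thickenedIndicator (hδ k) F t : NNReal) : ℝ) * g t ∂μ)
        atTop (𝓝 (∫ t, F.indicator g t ∂μ)) := by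
      refine tendsto_integral_of_dominated_convergence (fun t => |g t|) ?_ hg.abs ?_ ?_
      · intro k
        refine AEStronglyMeasurable.mul ?_ hg.aestronglyMeasurable
        exact (NNReal.continuous_coe.comp
          (thickenedIndicator (hδ k) F).continuous).aestronglyMeasurable
      · intro k
        refine ae_of_all _ fun t => ?_
        rw [norm_mul, Real.norm_eq_abs, Real.norm_eq_abs]
        have : (thickenedIndicator (hδ k) F t : NNReal) ≤ 1 := thickenedIndicator_le_one _ _ _
        have h2 : ((thickenedIndicator (hδ k) F t : NNReal) : ℝ) ≤ 1 := by exact_mod_cast this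
        rw [NNReal.abs_eq]
        exact mul_le_of_le_one_left (abs_nonneg _) h2
      · refine ae_of_all _ fun t => ?_
        have h3 := hlim t
        rw [hF.closure_eq] at h3
        have h4 := ((NNReal.continuous_coe.tendsto _).comp h3).mul_const (g t)
        have e : F.indicator g t = ((F.indicator (fun _ => (1 : NNReal)) t : NNReal) : ℝ) * g t := by
          by_cases ht : t ∈ F <;> simp [ht]
        rw [e]
        exact h4
    rw [integral_indicator hF.measurableSet] at h1
    refine le_of_tendsto h1 (Eventually.of_forall fun k => ?_)
    refine h _ (NNReal.continuous_coe.comp (thickenedIndicator (hδ k) F).continuous) ?_ ?_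
    · intro t; exact NNReal.coe_nonneg _
    · intro t
      have : (thickenedIndicator (hδ k) F t : NNReal) ≤ 1 := thickenedIndicator_le_one _ _ _
      exact_mod_cast this
  have hms : MeasurableSet {t | 0 < g t} := measurableSet_lt measurable_const hgm
  by_contra hne
  have hpos : 0 < μ {t | 0 < g t} := by
    rw [pos_iff_ne_zero]
    intro h0
    apply hne
    rw [ae_iff]
    simpa using h0
  obtain ⟨F, hFs, hFc, hFpos⟩ := hms.exists_lt_isCompact hpos
  have h1 := hF F hFc.isClosed
  have h2 : 0 < ∫ t in F, g t ∂μ := by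
    rw [setIntegral_pos_iff_support_of_nonneg_ae]
    · refine lt_of_lt_of_le hFpos (measure_mono fun t ht => ⟨?_, ht⟩)
      exact ne_of_gt (hFs ht)
    · exact (ae_restrict_iff' hFc.measurableSet).mpr (ae_of_all _ fun t ht => le_of_lt (hFs ht))
    · exact hg.integrable.restrict
  linarith

/-- bounded measurable functions are integrable on `[0,T]` -/
lemma integrableOn_of_bdd {T M : ℝ} {f : ℝ → ℝ} (hf : Measurable f) (hM : ∀ t, |f t| ≤ M) :
    IntegrableOn f (Icc 0 T) :=
  Integrable.of_bound hf.aestronglyMeasurable M (ae_of_all _ hM)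

lemma integrable_mul_bdd {T M : ℝ} {f g : ℝ → ℝ} (hf : Measurable f) (hM : ∀ t, |f t| ≤ M)
    (hg : IntegrableOn g (Icc 0 T)) :
    IntegrableOn (fun t => g t * f t) (Icc 0 T) :=
  Integrable.mul_bdd (c := M) hg hf.aestronglyMeasurable (ae_of_all _ hM)

lemma abs_int_mul_le {T M : ℝ} {f g : ℝ → ℝ} (hf : Measurable f) (hM : ∀ t, |f t| ≤ M)
    (hg : IntegrableOn g (Icc 0 T)) :
    |∫ t in Icc 0 T, g t * f t| ≤ M * ∫ t in Icc 0 T, |g t| := by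
  rw [← integral_const_mul]
  refine (abs_integral_le_integral_abs).trans ?_
  refine integral_mono (integrable_mul_bdd hf hM hg).abs (hg.abs.const_mul M) fun t => ?_
  simp only [abs_mul]
  rw [mul_comm]
  exact mul_le_mul_of_nonneg_right (hM t) (abs_nonneg _)

lemma exists_cont_approx {T : ℝ} {g : ℝ → ℝ} (hg : IntegrableOn g (Icc 0 T)) {δ : ℝ} (hδ : 0 < δ) :
    ∃ ψ : ℝ → ℝ, Continuous ψ ∧ (∃ C, ∀ t, |ψ t| ≤ C) ∧ IntegrableOn ψ (Icc 0 T) ∧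
      ∫ t in Icc 0 T, |g t - ψ t| ≤ δ := by
  obtain ⟨ψ, h1, h2⟩ := Integrable.exists_boundedContinuous_integral_sub_le hg hδ
  exact ⟨ψ, ψ.continuous, ⟨‖ψ‖, fun t => ψ.norm_coe_le_norm t⟩, h2, h1⟩

lemma weak_ext {T M : ℝ} {fn : ℕ → ℝ → ℝ} {f : ℝ → ℝ}
    (hfn : ∀ n, Measurable (fn n)) (hf : Measurable f)
    (hnM : ∀ n t, |fn n t| ≤ M) (hM : ∀ t, |f t| ≤ M)
    (hw : ∀ ψ : ℝ → ℝ, Continuous ψ → (∃ C, ∀ t, |ψ t| ≤ C) →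
      Tendsto (fun n => ∫ t in Icc 0 T, ψ t * fn n t) atTop (𝓝 (∫ t in Icc 0 T, ψ t * f t)))
    {g : ℝ → ℝ} (hg : IntegrableOn g (Icc 0 T)) :
    Tendsto (fun n => ∫ t in Icc 0 T, g t * fn n t) atTop (𝓝 (∫ t in Icc 0 T, g t * f t)) := by
  have hM0 : 0 ≤ M := (abs_nonneg _).trans (hM 0)
  rw [Metric.tendsto_atTop]
  intro ε hε
  obtain ⟨ψ, hψ, hψb, hψi, hδ⟩ := exists_cont_approx hg (δ := ε / (4 * (M + 1))) (by positivity)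
  obtain ⟨N, hN⟩ := Metric.tendsto_atTop.mp (hw ψ hψ hψb) (ε / 4) (by positivity)
  refine ⟨N, fun n hn => ?_⟩
  have key : ∀ k : ℝ → ℝ, Measurable k → (∀ t, |k t| ≤ M) →
      |(∫ t in Icc 0 T, g t * k t) - ∫ t in Icc 0 T, ψ t * k t| ≤ ε / 4 := by
    intro k hk hkM
    rw [← integral_sub (integrable_mul_bdd hk hkM hg) (integrable_mul_bdd hk hkM hψi)]
    simp_rw [← sub_mul]
    refine (abs_int_mul_le hk hkM (hg.sub hψi)).trans ?_
    calc M * ∫ t in Icc 0 T, |g t - ψ t| ≤ (M + 1) * (ε / (4 * (M + 1))) := by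
          gcongr
          linarith
      _ = ε / 4 := by field_simp
  have h1 := key (fn n) (hfn n) (hnM n)
  have h2 := key f hf hM
  have h3 := hN n hn
  rw [Real.dist_eq] at h3 ⊢
  rw [abs_le] at h1 h2
  rw [abs_lt] at h3 ⊢
  constructor <;> linarith

lemma bv_ext {T M K : ℝ} {f : ℝ → ℝ} (hf : Measurable f) (hM : ∀ t, |f t| ≤ M)
    (hbv : ∀ ψ : ℝ → ℝ, Continuous ψ → ∀ S, (∀ t ∈ Icc 0 T, |∫ s in 0..t, ψ s| ≤ S) →
      |∫ t in Icc 0 T, ψ t * f t| ≤ K * S) (hK : 0 ≤ K)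
    {g : ℝ → ℝ} (hg : IntegrableOn g (Icc 0 T)) {S : ℝ}
    (hS : ∀ t ∈ Icc 0 T, |∫ s in 0..t, g s| ≤ S) :
    |∫ t in Icc 0 T, g t * f t| ≤ K * S := by
  have hM0 : 0 ≤ M := (abs_nonneg _).trans (hM 0)
  refine le_of_forall_pos_le_add fun ε hε => ?_
  obtain ⟨ψ, hψ, hψb, hψi, hδ⟩ := exists_cont_approx hg (δ := ε / (K + M + 1)) (by positivity)
  set δ := ε / (K + M + 1)
  have hS' : ∀ t ∈ Icc 0 T, |∫ s in 0..t, ψ s| ≤ S + δ := by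
    intro t ht
    have hsub : Ioc 0 t ⊆ Icc 0 T := fun s hs => ⟨hs.1.le, hs.2.trans ht.2⟩
    have h1 : |(∫ s in 0..t, g s) - ∫ s in 0..t, ψ s| ≤ δ := by
      rw [intervalIntegral.integral_of_le ht.1, intervalIntegral.integral_of_le ht.1,
        ← integral_sub (hg.mono_set hsub) (hψi.mono_set hsub)]
      refine abs_integral_le_integral_abs.trans (le_trans ?_ hδ)
      exact setIntegral_mono_set (hg.sub hψi).abs (ae_of_all _ fun _ => abs_nonneg _)
        hsub.eventuallyLE
    have h2 := hS t ht
    rw [abs_le] at h1 h2 ⊢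
    constructor <;> linarith
  have h3 := hbv ψ hψ _ hS'
  have h4 : |(∫ t in Icc 0 T, g t * f t) - ∫ t in Icc 0 T, ψ t * f t| ≤ M * δ := by
    rw [← integral_sub (integrable_mul_bdd hf hM hg) (integrable_mul_bdd hf hM hψi)]
    simp_rw [← sub_mul]
    exact (abs_int_mul_le hf hM (hg.sub hψi)).trans (mul_le_mul_of_nonneg_left hδ hM0)
  have h5 : (K + M + 1) * δ = ε := by simp only [δ]; field_simp
  have h6 : 0 ≤ δ := by simp only [δ]; positivity
  rw [abs_le] at h3 h4 ⊢
  constructor <;> nlinarith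

lemma prim_uniform {T M : ℝ} {gn : ℕ → ℝ → ℝ}
    (hgn : ∀ n, Measurable (gn n)) (hnM : ∀ n t, |gn n t| ≤ M)
    (hpt : ∀ t ∈ Icc 0 T, Tendsto (fun n => ∫ s in 0..t, gn n s) atTop (𝓝 0))
    {ε : ℝ} (hε : 0 < ε) :
    ∀ᶠ n in atTop, ∀ t ∈ Icc 0 T, |∫ s in 0..t, gn n s| ≤ ε := by
  have hM0 : 0 ≤ M := (abs_nonneg _).trans (hnM 0 0)
  have hii : ∀ n a b, IntervalIntegrable (gn n) volume a b := fun n a b => by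
    rw [intervalIntegrable_iff, uIoc]
    exact Integrable.of_bound (hgn n).aestronglyMeasurable M (ae_of_all _ (hnM n))
  refine IsCompact.induction_on (p := fun s => ∀ᶠ n in atTop, ∀ t ∈ s, |∫ s in 0..t, gn n s| ≤ ε)
    (isCompact_Icc (a := (0:ℝ)) (b := T)) ?_ ?_ ?_ ?_
  · simp
  · intro s t hst ht
    filter_upwards [ht] with n hn x hx using hn x (hst hx)
  · intro s t hs ht
    filter_upwards [hs, ht] with n hn hn' x hx
    exact hx.elim (hn x) (hn' x)
  · intro t ht
    refine ⟨Metric.ball t (ε / (2 * (M + 1))), mem_nhdsWithin_of_mem_nhds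
      (Metric.ball_mem_nhds _ (by positivity)), ?_⟩
    have h1 := (Metric.tendsto_atTop.mp (hpt t ht) (ε / 2) (by positivity))
    obtain ⟨N, hN⟩ := h1
    filter_upwards [eventually_ge_atTop N] with n hn x hx
    have h2 := hN n hn
    rw [Real.dist_eq, sub_zero] at h2
    rw [Metric.mem_ball, Real.dist_eq] at hx
    have h3 : (∫ s in 0..x, gn n s) = (∫ s in 0..t, gn n s) + ∫ s in t..x, gn n s :=
      (intervalIntegral.integral_add_adjacent_intervals (hii n _ _) (hii n _ _)).symm
    have h4 : |∫ s in t..x, gn n s| ≤ M * |x - t| := by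
      rw [← Real.norm_eq_abs]
      exact intervalIntegral.norm_integral_le_of_norm_le_const fun s _ => hnM n s
    have h5 : M * |x - t| ≤ ε / 2 := by
      calc M * |x - t| ≤ (M + 1) * (ε / (2 * (M + 1))) := by gcongr; linarith
        _ = ε / 2 := by field_simp
    rw [h3]
    exact (abs_add_le _ _).trans (by linarith)

lemma bv_strong {T M K : ℝ} (hT : 0 < T) {fn : ℕ → ℝ → ℝ} {f : ℝ → ℝ}
    (hfn : ∀ n, Measurable (fn n)) (hf : Measurable f)
    (hnM : ∀ n t, |fn n t| ≤ M) (hM : ∀ t, |f t| ≤ M) (hK : 0 ≤ K)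
    (hbv : ∀ n, ∀ ψ : ℝ → ℝ, Continuous ψ → ∀ S, (∀ t ∈ Icc 0 T, |∫ s in 0..t, ψ s| ≤ S) →
      |∫ t in Icc 0 T, ψ t * fn n t| ≤ K * S)
    (hw : ∀ ψ : ℝ → ℝ, Continuous ψ → (∃ C, ∀ t, |ψ t| ≤ C) →
      Tendsto (fun n => ∫ t in Icc 0 T, ψ t * fn n t) atTop (𝓝 (∫ t in Icc 0 T, ψ t * f t))) :
    Tendsto (fun n => ∫ t in Icc 0 T, |fn n t - f t|) atTop (𝓝 0) := by
  have hw' : ∀ g : ℝ → ℝ, IntegrableOn g (Icc 0 T) →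
      Tendsto (fun n => ∫ t in Icc 0 T, g t * fn n t) atTop (𝓝 (∫ t in Icc 0 T, g t * f t)) :=
    fun g hg => weak_ext hfn hf hnM hM hw hg
  have hfi : IntegrableOn f (Icc 0 T) := integrableOn_of_bdd hf hM
  have hfni : ∀ n, IntegrableOn (fn n) (Icc 0 T) := fun n => integrableOn_of_bdd (hfn n) (hnM n)
  have hdm : ∀ n, Measurable (fun t => fn n t - f t) := fun n => (hfn n).sub hf
  have hdM : ∀ n t, |fn n t - f t| ≤ 2 * M := fun n t => by
    have h1 := hnM n t
    have h2 := hM t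
    rw [abs_le] at *
    constructor <;> linarith
  have hpt : ∀ t ∈ Icc 0 T, Tendsto (fun n => ∫ s in 0..t, (fn n s - f s)) atTop (𝓝 0) := by
    intro t ht
    have hsub : Ioc 0 t ⊆ Icc 0 T := fun s hs => ⟨hs.1.le, hs.2.trans ht.2⟩
    have h1 := hw' ((Ioc 0 t).indicator 1)
      ((integrable_indicator_iff measurableSet_Ioc).mpr
        (by
          have : IntegrableOn (fun _ : ℝ => (1:ℝ)) (Ioc 0 t) (volume.restrict (Icc 0 T)) :=
            integrable_const _
          exact this))
    have h2 : ∀ k : ℝ → ℝ, ∫ s in Icc 0 T, (Ioc 0 t).indicator 1 s * k s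
        = ∫ s in Ioc 0 t, k s := by
      intro k
      have : (fun s => (Ioc 0 t).indicator (1 : ℝ → ℝ) s * k s) = (Ioc 0 t).indicator k := by
        ext s
        by_cases hs : s ∈ Ioc 0 t <;> simp [hs]
      rw [this, setIntegral_indicator measurableSet_Ioc, inter_eq_self_of_subset_right hsub]
    simp_rw [h2] at h1
    have h3 := h1.sub_const (∫ s in Ioc 0 t, f s)
    rw [sub_self] at h3
    refine h3.congr fun n => ?_
    rw [intervalIntegral.integral_of_le ht.1,
      integral_sub ((hfni n).mono_set hsub) (hfi.mono_set hsub)]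
  -- square integrals tend to zero
  have hsq : Tendsto (fun n => ∫ t in Icc 0 T, (fn n t - f t) ^ 2) atTop (𝓝 0) := by
    have hA : Tendsto (fun n => ∫ t in Icc 0 T, (fn n t - f t) * fn n t) atTop (𝓝 0) := by
      rw [Metric.tendsto_atTop]
      intro ε hε
      obtain ⟨N, hN⟩ := eventually_atTop.mp 
        (prim_uniform hdm hdM hpt (ε := ε / (2 * (K + 1))) (by positivity))
      refine ⟨N, fun n hn => ?_⟩
      rw [Real.dist_eq, sub_zero]
      have h1 := bv_ext (hfn n) (hnM n) (hbv n) hK ((hfni n).sub hfi) (hN n hn)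
      simp only [Pi.sub_apply] at h1
      refine h1.trans_lt ?_
      calc K * (ε / (2 * (K + 1))) ≤ (K + 1) * (ε / (2 * (K + 1))) := by gcongr; linarith
        _ = ε / 2 := by field_simp
        _ < ε := by linarith
    have hB : Tendsto (fun n => ∫ t in Icc 0 T, f t * (fn n t - f t)) atTop (𝓝 0) := by
      have h1 := (hw' f hfi).sub_const (∫ t in Icc 0 T, f t * f t)
      rw [sub_self] at h1
      refine h1.congr fun n => ?_
      rw [← integral_sub (integrable_mul_bdd (hfn n) (hnM n) hfi) (integrable_mul_bdd hf hM hfi)]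
      simp_rw [mul_sub]
    have h2 := hA.sub hB
    rw [sub_self] at h2
    refine h2.congr fun n => ?_
    have hi : IntegrableOn (fun t => fn n t - f t) (Icc 0 T) := (hfni n).sub hfi
    rw [← integral_sub (integrable_mul_bdd (hfn n) (hnM n) hi)
      (integrable_mul_bdd (hdm n) (hdM n) hfi)]
    congr 1
    ext t
    ring
  rw [Metric.tendsto_atTop]
  intro ε hε
  set δ := ε / (2 * T)
  have hδ : 0 < δ := by simp only [δ]; positivity
  obtain ⟨N, hN⟩ := Metric.tendsto_atTop.mp hsq (ε * δ) (by positivity)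
  refine ⟨N, fun n hn => ?_⟩
  have h1 := hN n hn
  rw [Real.dist_eq, sub_zero] at h1 ⊢
  have h1' := (le_abs_self _).trans_lt h1
  rw [abs_of_nonneg (integral_nonneg fun _ => abs_nonneg _)]
  have hsqi : IntegrableOn (fun t => (fn n t - f t) ^ 2) (Icc 0 T) := by
    simp_rw [sq]
    exact integrable_mul_bdd (hdm n) (hdM n) ((hfni n).sub hfi)
  have hci : IntegrableOn (fun _ : ℝ => δ) (Icc 0 T) := by simp
  have h2 : ∫ t in Icc 0 T, |fn n t - f t| ≤
      ∫ t in Icc 0 T, ((fn n t - f t) ^ 2 / (2 * δ) + δ / 2) := by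
    have hi : IntegrableOn (fun t => fn n t - f t) (Icc 0 T) := (hfni n).sub hfi
    refine integral_mono hi.abs
      ((hsqi.div_const _).add (hci.div_const _)) fun t => ?_
    rw [← sq_abs (fn n t - f t)]
    set y := |fn n t - f t|
    rw [div_add_div _ _ (by positivity) (by positivity), le_div_iff₀ (by positivity)]
    nlinarith [sq_nonneg (y - δ)]
  rw [integral_add (hsqi.div_const _) (hci.div_const _), integral_div, integral_const] at h2
  simp only [measureReal_restrict_apply_univ, Real.volume_real_Icc_of_le hT.le, smul_eq_mul,
    sub_zero] at h2
  refine h2.trans_lt ?_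
  have h3 : (∫ t in Icc 0 T, (fn n t - f t) ^ 2) / (2 * δ) < ε / 2 := by
    rw [div_lt_iff₀ (by positivity)]
    nlinarith
  have h4 : T * (δ / 2) = ε / 4 := by simp only [δ]; field_simp; norm_num
  linarith

open ProbabilityTheory in
lemma exists_kernel {T : ℝ} {O A : Set ℝ} {m : ℝ → Measure (ℝ × ℝ)} (hm : MemV T O A m)
    (h1 : ∀ᵐ t ∂(volume.restrict (Icc 0 T)), (m t univ).toReal ≤ 1) :
    ∃ κ : Kernel ℝ (ℝ × ℝ), (∀ t, κ t univ ≤ 1) ∧ (∀ t, κ t ((closure O ×ˢ A)ᶜ) = 0) ∧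
      ∀ᵐ t ∂(volume.restrict (Icc 0 T)), m t = κ t := by
  classical
  obtain ⟨hfin, hsupp, hmeas, hmint⟩ := hm
  have hs : MeasurableSet {t | m t univ ≤ 1} :=
    measurableSet_le (hmeas univ MeasurableSet.univ) measurable_const
  refine ⟨⟨fun t => if m t univ ≤ 1 then m t else 0, ?_⟩, ?_, ?_, ?_⟩
  · exact Measurable.ite hs (Measure.measurable_of_measurable_coe _ hmeas) measurable_const
  · intro t
    change (if m t univ ≤ 1 then m t else 0) univ ≤ 1
    split_ifs with h
    · exact h
    · simp
  · intro t
    change (if m t univ ≤ 1 then m t else 0) _ = 0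
    split_ifs with h
    · exact hsupp t
    · simp
  · filter_upwards [h1] with t ht
    change m t = (if m t univ ≤ 1 then m t else 0)
    rw [if_pos]
    rw [← ENNReal.ofReal_toReal (hfin t).ne]
    simpa using ht

section
open ProbabilityTheory

variable {κ : Kernel ℝ (ℝ × ℝ)}

lemma isFiniteKernel_of_le (h : ∀ t, κ t univ ≤ 1) : IsFiniteKernel κ :=
  ⟨⟨1, by simp, h⟩⟩

lemma integrable_ker (h : ∀ t, κ t univ ≤ 1) {f : ℝ × ℝ → ℝ} (hf : Measurable f) {M : ℝ}
    (hM : ∀ p, |f p| ≤ M) (t : ℝ) : Integrable f (κ t) := by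
  have := isFiniteKernel_of_le h
  exact Integrable.of_bound hf.aestronglyMeasurable M (ae_of_all _ hM)

lemma ker_real_le (h : ∀ t, κ t univ ≤ 1) (t : ℝ) : (κ t univ).toReal ≤ 1 := by
  have := ENNReal.toReal_mono (by simp) (h t)
  simpa using this

lemma abs_int_ker_le (h : ∀ t, κ t univ ≤ 1) {f : ℝ × ℝ → ℝ} {M : ℝ}
    (hM : ∀ p, |f p| ≤ M) (t : ℝ) : |∫ p, f p ∂(κ t)| ≤ M := by
  have := isFiniteKernel_of_le h
  have hM0 : 0 ≤ M := (abs_nonneg _).trans (hM 0)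
  have h1 := norm_integral_le_of_norm_le_const (μ := κ t) (f := f) (C := M) (ae_of_all _ hM)
  refine h1.trans ?_
  exact mul_le_of_le_one_right hM0 (ker_real_le h t)

lemma measurable_int_ker (h : ∀ t, κ t univ ≤ 1) {f : ℝ × ℝ × ℝ → ℝ} (hf : Measurable f) :
    Measurable fun t => ∫ p, f (t, p) ∂(κ t) := by
  have := isFiniteKernel_of_le h
  exact (hf.stronglyMeasurable.integral_kernel_prod_right' (κ := κ)).measurable

/-- the test-function estimate behind the BV bound -/
lemma bv_R0 {T : ℝ} (hT : 0 < T) {O A : Set ℝ}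
    {b σ : ℝ → ℝ → Measure (ℝ × ℝ) → ℝ → ℝ} {m0 : Measure ℝ} {B : ℝ}
    (hbB : ∀ t x ν a, |b t x ν a| ≤ B) (hσB : ∀ t x ν a, |σ t x ν a| ≤ B)
    {φ φt φx φxx : ℝ → ℝ → ℝ} {M : ℝ}
    (hφ : Continuous fun p : ℝ × ℝ => φ p.1 p.2) (hφt : Continuous fun p : ℝ × ℝ => φt p.1 p.2)
    (hφx : Continuous fun p : ℝ × ℝ => φx p.1 p.2) (hφxx : Continuous fun p : ℝ × ℝ => φxx p.1 p.2)
    (hM : ∀ t x, |φ t x| ≤ M ∧ |φt t x| ≤ M ∧ |φx t x| ≤ M ∧ |φxx t x| ≤ M)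
    (hdt : ∀ t x, HasDerivAt (fun s => φ s x) (φt t x) t)
    (hdx : ∀ t x, HasDerivAt (fun y => φ t y) (φx t x) x)
    (hdxx : ∀ t x, HasDerivAt (fun y => φx t y) (φxx t x) x)
    {μ : Measure (ℝ × ℝ)} (h1 : ∀ t, κ t univ ≤ 1)
    (hR : MemR0 T O A b σ m0 μ (fun t => κ t))
    {ψ : ℝ → ℝ} (hψ : Continuous ψ) {S : ℝ} (hS : ∀ t ∈ Icc 0 T, |∫ s in 0..t, ψ s| ≤ S) :
    -((M + M * T + (B * M + B ^ 2 / 2 * M) * T) * S) ≤ ∫ t in Icc 0 T, ψ t * ∫ p, φ t p.1 ∂(κ t) := by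
  have := isFiniteKernel_of_le h1
  obtain ⟨hμp, hμs, hV, hineq⟩ := hR
  have hM0 : 0 ≤ M := (abs_nonneg _).trans (hM 0 0).1
  have hB0 : 0 ≤ B := (abs_nonneg _).trans (hbB 0 0 0 0)
  have hS0 : 0 ≤ S := (abs_nonneg _).trans (hS 0 ⟨le_rfl, hT.le⟩)
  set Ψ : ℝ → ℝ := fun t => ∫ s in 0..t, ψ s with hΨdef
  have hΨd : ∀ t, HasDerivAt Ψ (ψ t) t := fun t => hψ.integral_hasStrictDerivAt 0 t |>.hasDerivAt
  have hΨc : Continuous Ψ := continuous_iff_continuousAt.mpr fun t => (hΨd t).continuousAt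
  obtain ⟨Q, hQ⟩ := isCompact_Icc.exists_bound_of_continuousOn (s := Icc 0 T) hψ.continuousOn
  have hcb : IsCb12 T O (fun t x => Ψ t * φ t x) (fun t x => ψ t * φ t x + Ψ t * φt t x)
      (fun t x => Ψ t * φx t x) (fun t x => Ψ t * φxx t x) := by
    have c1 : Continuous fun p : ℝ × ℝ => Ψ p.1 := hΨc.comp continuous_fst
    have c2 : Continuous fun p : ℝ × ℝ => ψ p.1 := hψ.comp continuous_fst
    refine ⟨(c1.mul hφ).continuousOn, ((c2.mul hφ).add (c1.mul hφt)).continuousOn,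
      (c1.mul hφx).continuousOn, (c1.mul hφxx).continuousOn, ?_, ?_, ?_, ?_⟩
    · intro t _ x _
      exact ((hΨd t).mul (hdt t x)).hasDerivWithinAt
    · intro t _ x _
      exact ((hdx t x).const_mul (Ψ t)).hasDerivWithinAt
    · intro t _ x _
      exact ((hdxx t x).const_mul (Ψ t)).hasDerivWithinAt
    · refine ⟨S * M + Q * M, fun t ht x _ => ?_⟩
      have hS1 : |Ψ t| ≤ S := hS t ht
      have hQ1 : |ψ t| ≤ Q := hQ t ht
      have hQ0 : 0 ≤ Q := (abs_nonneg _).trans hQ1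
      obtain ⟨a1, a2, a3, a4⟩ := hM t x
      have e1 : |Ψ t * φ t x| ≤ S * M := by rw [abs_mul]; gcongr
      have e2 : |Ψ t * φt t x| ≤ S * M := by rw [abs_mul]; gcongr
      have e3 : |Ψ t * φx t x| ≤ S * M := by rw [abs_mul]; gcongr
      have e4 : |Ψ t * φxx t x| ≤ S * M := by rw [abs_mul]; gcongr
      have e5 : |ψ t * φ t x| ≤ Q * M := by rw [abs_mul]; gcongr
      have : 0 ≤ Q * M := by positivity
      refine ⟨by linarith, (abs_add_le _ _).trans (by linarith), by linarith, by linarith⟩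
  have h2 := hineq _ _ _ _ hcb ((B * M + B ^ 2 / 2 * M) * S) (by
    intro t ht x _ ν _ _ a _
    have hS1 : |Ψ t| ≤ S := hS t ht
    obtain ⟨a1, a2, a3, a4⟩ := hM t x
    have e1 := hbB t x ν a
    have e2 := hσB t x ν a
    have e3 : σ t x ν a ^ 2 ≤ B ^ 2 := by rw [← sq_abs]; gcongr
    have e4 : |b t x ν a * (Ψ t * φx t x)| ≤ B * (S * M) := by
      rw [abs_mul, abs_mul]; gcongr
    have e5 : |σ t x ν a ^ 2 / 2 * (Ψ t * φxx t x)| ≤ B ^ 2 / 2 * (S * M) := by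
      rw [abs_mul, abs_mul, abs_of_nonneg (by positivity : 0 ≤ σ t x ν a ^ 2 / 2)]; gcongr
    exact (abs_add_le _ _).trans (by linarith))
  have hΨ0 : Ψ 0 = 0 := by simp [hΨdef]
  simp only [hΨ0, zero_mul, integral_zero, zero_add] at h2
  have hL : |∫ p : ℝ × ℝ, Ψ p.1 * φ p.1 p.2 ∂μ| ≤ S * M := by
    have h3 : ∀ᵐ p ∂μ, ‖Ψ p.1 * φ p.1 p.2‖ ≤ S * M := by
      have : ∀ᵐ p ∂μ, p ∈ Icc 0 T ×ˢ closure O := by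
        rw [ae_iff]; exact hμs
      filter_upwards [this] with p hp
      have hS1 : |Ψ p.1| ≤ S := hS _ hp.1
      have := (hM p.1 p.2).1
      rw [norm_mul, Real.norm_eq_abs, Real.norm_eq_abs]; gcongr
    have := norm_integral_le_of_norm_le_const h3
    simpa using this
  have mφ : Measurable fun q : ℝ × ℝ × ℝ => φ q.1 q.2.1 :=
    (hφ.comp (continuous_fst.prodMk (continuous_fst.comp continuous_snd))).measurable
  have mφt : Measurable fun q : ℝ × ℝ × ℝ => φt q.1 q.2.1 :=
    (hφt.comp (continuous_fst.prodMk (continuous_fst.comp continuous_snd))).measurable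
  have hf1 := measurable_int_ker h1 mφ
  have hf2 := measurable_int_ker h1 mφt
  have hb1 : ∀ t, |∫ p, φ t p.1 ∂(κ t)| ≤ M := fun t =>
    abs_int_ker_le h1 (fun p : ℝ × ℝ => (hM t p.1).1) t
  have hb2 : ∀ t, |∫ p, φt t p.1 ∂(κ t)| ≤ M := fun t =>
    abs_int_ker_le h1 (fun p : ℝ × ℝ => (hM t p.1).2.1) t
  have hψi : IntegrableOn ψ (Icc 0 T) := hψ.continuousOn.integrableOn_compact isCompact_Icc
  have hΨi : IntegrableOn Ψ (Icc 0 T) := hΨc.continuousOn.integrableOn_compact isCompact_Icc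
  have h4 : (∫ t in Icc 0 T, ∫ p, (ψ t * φ t p.1 + Ψ t * φt t p.1) ∂(κ t)) =
      (∫ t in Icc 0 T, ψ t * ∫ p, φ t p.1 ∂(κ t)) + ∫ t in Icc 0 T, Ψ t * ∫ p, φt t p.1 ∂(κ t) := by
    rw [← integral_add (integrable_mul_bdd hf1 hb1 hψi) (integrable_mul_bdd hf2 hb2 hΨi)]
    congr 1
    ext t
    have i1 : Integrable (fun p : ℝ × ℝ => φ t p.1) (κ t) :=
      integrable_ker h1 (mφ.comp measurable_prodMk_left) (fun p => (hM t p.1).1) t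
    have i2 : Integrable (fun p : ℝ × ℝ => φt t p.1) (κ t) :=
      integrable_ker h1 (mφt.comp measurable_prodMk_left) (fun p => (hM t p.1).2.1) t
    rw [integral_add (i1.const_mul _) (i2.const_mul _), integral_const_mul, integral_const_mul]
  have h5 : |∫ t in Icc 0 T, Ψ t * ∫ p, φt t p.1 ∂(κ t)| ≤ M * (S * T) := by
    refine (abs_int_mul_le hf2 hb2 hΨi).trans ?_
    refine mul_le_mul_of_nonneg_left ?_ hM0
    have := norm_setIntegral_le_of_norm_le_const (μ := volume) (s := Icc 0 T) (f := fun t => |Ψ t|)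
      (C := S) (by simp) (fun t ht => by simpa using hS t ht)
    have h6 := (le_abs_self _).trans this
    simpa [Real.volume_real_Icc_of_le hT.le] using h6
  have h7 : ∫ t in Icc 0 T, (κ t univ).toReal ≤ T := by
    have := norm_setIntegral_le_of_norm_le_const (μ := volume) (s := Icc 0 T)
      (f := fun t => (κ t univ).toReal) (C := 1) (by simp)
      (fun t ht => by simpa using ker_real_le h1 t)
    have h6 := (le_abs_self _).trans this
    simpa [Real.volume_real_Icc_of_le hT.le] using h6
  rw [h4] at h2
  rw [abs_le] at hL h5
  have h8 : (B * M + B ^ 2 / 2 * M) * S * ∫ t in Icc 0 T, (κ t univ).toReal ≤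
      (B * M + B ^ 2 / 2 * M) * S * T := by gcongr
  nlinarith

end

section
open ProbabilityTheory
open scoped ContDiff

lemma smooth_package {φ : ℝ × ℝ → ℝ} (h : ContDiff ℝ ∞ φ) (hc : HasCompactSupport φ) :
    ∃ (φt φx φxx : ℝ → ℝ → ℝ) (M : ℝ), (Continuous fun p : ℝ × ℝ => φt p.1 p.2) ∧
      (Continuous fun p : ℝ × ℝ => φx p.1 p.2) ∧ (Continuous fun p : ℝ × ℝ => φxx p.1 p.2) ∧
      (∀ t x, |φ (t, x)| ≤ M ∧ |φt t x| ≤ M ∧ |φx t x| ≤ M ∧ |φxx t x| ≤ M) ∧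
      (∀ t x, HasDerivAt (fun s => φ (s, x)) (φt t x) t) ∧
      (∀ t x, HasDerivAt (fun y => φ (t, y)) (φx t x) x) ∧
      (∀ t x, HasDerivAt (fun y => φx t y) (φxx t x) x) := by
  have key : ∀ f : ℝ × ℝ → ℝ, ContDiff ℝ ∞ f → HasCompactSupport f → ∀ v : ℝ × ℝ,
      ContDiff ℝ ∞ (fun p => fderiv ℝ f p v) ∧ HasCompactSupport (fun p => fderiv ℝ f p v) := by
    intro f hf hfc v
    refine ⟨(hf.fderiv_right (m := ∞) (by simp)).clm_apply contDiff_const, ?_⟩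
    exact (hfc.fderiv ℝ).comp_left (g := fun L : ℝ × ℝ →L[ℝ] ℝ => L v) (by simp)
  have hline1 : ∀ f : ℝ × ℝ → ℝ, ContDiff ℝ ∞ f → ∀ t x : ℝ,
      HasDerivAt (fun s => f (s, x)) (fderiv ℝ f (t, x) (1, 0)) t := by
    intro f hf t x
    have h1 := (hf.differentiable (by simp)).differentiableAt.hasFDerivAt (x := (t, x))
    exact h1.comp_hasDerivAt t ((hasDerivAt_id t).prodMk (hasDerivAt_const t x))
  have hline2 : ∀ f : ℝ × ℝ → ℝ, ContDiff ℝ ∞ f → ∀ t x : ℝ,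
      HasDerivAt (fun y => f (t, y)) (fderiv ℝ f (t, x) (0, 1)) x := by
    intro f hf t x
    have h1 := (hf.differentiable (by simp)).differentiableAt.hasFDerivAt (x := (t, x))
    exact h1.comp_hasDerivAt x ((hasDerivAt_const x t).prodMk (hasDerivAt_id x))
  obtain ⟨ht, htc⟩ := key φ h hc (1, 0)
  obtain ⟨hx, hxc⟩ := key φ h hc (0, 1)
  obtain ⟨hxx, hxxc⟩ := key _ hx hxc (0, 1)
  obtain ⟨M0, hM0⟩ := hc.exists_bound_of_continuous h.continuous
  obtain ⟨M1, hM1⟩ := htc.exists_bound_of_continuous ht.continuous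
  obtain ⟨M2, hM2⟩ := hxc.exists_bound_of_continuous hx.continuous
  obtain ⟨M3, hM3⟩ := hxxc.exists_bound_of_continuous hxx.continuous
  refine ⟨fun t x => fderiv ℝ φ (t, x) (1, 0), fun t x => fderiv ℝ φ (t, x) (0, 1),
    fun t x => fderiv ℝ (fun p => fderiv ℝ φ p (0, 1)) (t, x) (0, 1),
    max (max M0 M1) (max M2 M3), ht.continuous, hx.continuous, hxx.continuous, ?_,
    hline1 φ h, hline2 φ h, hline2 _ hx⟩
  intro t x
  exact ⟨(hM0 (t, x)).trans (by simp), (hM1 (t, x)).trans (by simp), (hM2 (t, x)).trans (by simp),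
    (hM3 (t, x)).trans (by simp)⟩

lemma int_compProd {κ : Kernel ℝ (ℝ × ℝ)} (h1 : ∀ t, κ t univ ≤ 1) {T : ℝ}
    {h : ℝ × ℝ × ℝ → ℝ} (hm : Measurable h) {C : ℝ} (hC : ∀ q, |h q| ≤ C) :
    ∫ t in Icc 0 T, ∫ p, h (t, p) ∂(κ t) = ∫ q, h q ∂((volume.restrict (Icc 0 T)) ⊗ₘ κ) := by
  have := isFiniteKernel_of_le h1
  rw [Measure.integral_compProd]
  exact Integrable.of_bound hm.aestronglyMeasurable C (ae_of_all _ hC)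

lemma tail {κ : Kernel ℝ (ℝ × ℝ)} (h1 : ∀ t, κ t univ ≤ 1) (T : ℝ) {ε : ℝ} (hε : 0 < ε) :
    ∃ (χ : ℝ × ℝ → ℝ) (R : ℝ), 0 ≤ R ∧ ContDiff ℝ ∞ χ ∧ HasCompactSupport χ ∧ (∀ p, 0 ≤ χ p) ∧
      (∀ p, χ p ≤ 1) ∧ (∀ t x, R < |x| → χ (t, x) = 0) ∧
      ∫ t in Icc 0 T, ∫ p, (1 - χ (t, p.1)) ∂(κ t) < ε := by
  have := isFiniteKernel_of_le h1
  let χ : ℕ → ContDiffBump (0 : ℝ × ℝ) := fun k => ⟨k + 1, k + 2, by positivity, by linarith⟩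
  have hcont : ∀ k, Continuous (χ k) := fun k => (χ k).continuous
  have hlim : Tendsto (fun k => ∫ q : ℝ × ℝ × ℝ, (1 - χ k (q.1, q.2.1))
      ∂((volume.restrict (Icc 0 T)) ⊗ₘ κ)) atTop (𝓝 (∫ q : ℝ × ℝ × ℝ, 0
      ∂((volume.restrict (Icc 0 T)) ⊗ₘ κ))) := by
    refine tendsto_integral_of_dominated_convergence (fun _ => 1) ?_ (integrable_const _) ?_ ?_
    · intro k
      have := hcont k
      exact Continuous.aestronglyMeasurable (by fun_prop)
    · intro k
      refine ae_of_all _ fun q => ?_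
      have a1 := (χ k).nonneg' (q.1, q.2.1)
      have a2 := (χ k).le_one (x := (q.1, q.2.1))
      rw [Real.norm_eq_abs, abs_le]
      constructor <;> linarith
    · refine ae_of_all _ fun q => ?_
      obtain ⟨N, hN⟩ := exists_nat_ge ‖((q.1, q.2.1) : ℝ × ℝ)‖
      refine tendsto_const_nhds.congr' ?_
      filter_upwards [eventually_ge_atTop N] with k hk
      have : χ k (q.1, q.2.1) = 1 := by
        apply (χ k).one_of_mem_closedBall
        rw [mem_closedBall_zero_iff]
        have : (N : ℝ) ≤ k := by exact_mod_cast hk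
        change _ ≤ (k : ℝ) + 1
        linarith
      rw [this, sub_self]
  rw [integral_zero] at hlim
  obtain ⟨k, hk⟩ := (hlim.eventually_lt_const hε).exists
  refine ⟨χ k, k + 2, by positivity, (χ k).contDiff, (χ k).hasCompactSupport,
    fun p => (χ k).nonneg, fun p => (χ k).le_one, ?_, ?_⟩
  · intro t x hx
    apply (χ k).zero_of_le_dist
    rw [dist_zero_right]
    change (k : ℝ) + 2 ≤ _
    have : ‖x‖ ≤ ‖(t, x)‖ := norm_snd_le (t, x)
    rw [Real.norm_eq_abs] at this
    linarith
  · rw [int_compProd h1 (C := 1) (h := fun q : ℝ × ℝ × ℝ => 1 - χ k (q.1, q.2.1))]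
    · exact hk
    · have := hcont k
      exact Continuous.measurable (by fun_prop)
    · intro q
      have a1 := (χ k).nonneg' (q.1, q.2.1)
      have a2 := (χ k).le_one (x := (q.1, q.2.1))
      rw [abs_le]
      constructor <;> linarith

lemma strong_conv {T : ℝ} (hT : 0 < T) {O A : Set ℝ}
    {b σ : ℝ → ℝ → Measure (ℝ × ℝ) → ℝ → ℝ} {m0 : Measure ℝ} {B : ℝ}
    (hbB : ∀ t x ν a, |b t x ν a| ≤ B) (hσB : ∀ t x ν a, |σ t x ν a| ≤ B)
    {κn : ℕ → Kernel ℝ (ℝ × ℝ)} {κ : Kernel ℝ (ℝ × ℝ)}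
    (hn1 : ∀ n t, κn n t univ ≤ 1) (h1 : ∀ t, κ t univ ≤ 1)
    {μn : ℕ → Measure (ℝ × ℝ)}
    (hR : ∀ n, MemR0 T O A b σ m0 (μn n) (fun t => κn n t))
    (hconv : ConvV T (fun n t => κn n t) (fun t => κ t))
    {c : ℝ × ℝ → ℝ} (hc : Continuous c) {C : ℝ} (hC : ∀ p, |c p| ≤ C) :
    Tendsto (fun n => ∫ t in Icc 0 T, |(∫ p, c (t, p.1) ∂(κn n t)) - ∫ p, c (t, p.1) ∂(κ t)|)
      atTop (𝓝 0) := by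
  have hC0 : 0 ≤ C := (abs_nonneg _).trans (hC 0)
  rw [Metric.tendsto_atTop]
  intro ε hε
  set D := 2 * T + 2 * C + 4 with hD
  have hD0 : 0 < D := by positivity
  set δ := min 1 (ε / (2 * D)) with hδdef
  have hδ : 0 < δ := by positivity
  have hδ1 : δ ≤ 1 := min_le_left _ _
  have hδD : δ * D ≤ ε / 2 := by
    calc δ * D ≤ ε / (2 * D) * D := by gcongr; exact min_le_right _ _
      _ = ε / 2 := by field_simp
  obtain ⟨χ, R, -, hχs, hχc, hχ0, hχ1, -, hχt⟩ := tail h1 T hδ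
  obtain ⟨g, hgs, hgc, -⟩ := hc.exists_contDiff_approx (⊤ : ℕ∞) (ε := fun _ => δ)
    continuous_const (fun _ => hδ)
  set φ : ℝ × ℝ → ℝ := fun p => χ p * g p with hφdef
  have hφs : ContDiff ℝ ∞ φ := hχs.mul hgs
  have hφc : HasCompactSupport φ := hχc.mul_right
  obtain ⟨φt, φx, φxx, M, ct, cx, cxx, hM, dt, dx, dxx⟩ := smooth_package hφs hφc
  have hM0 : 0 ≤ M := (abs_nonneg _).trans (hM 0 0).1
  have hB0 : 0 ≤ B := (abs_nonneg _).trans (hbB 0 0 0 0)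
  have cφ : Continuous φ := hφs.continuous
  have cχ : Continuous χ := hχs.continuous
  have mφ : Measurable fun q : ℝ × ℝ × ℝ => φ (q.1, q.2.1) := Continuous.measurable (by fun_prop)
  have mχ : Measurable fun q : ℝ × ℝ × ℝ => 1 - χ (q.1, q.2.1) :=
    Continuous.measurable (by fun_prop)
  have mc : Measurable fun q : ℝ × ℝ × ℝ => c (q.1, q.2.1) := Continuous.measurable (by fun_prop)
  have hχb : ∀ p, |1 - χ p| ≤ 1 := fun p => by
    have a1 := hχ0 p
    have a2 := hχ1 p
    rw [abs_le]
    constructor <;> linarith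
  -- strong convergence for the smooth approximation
  have hstrong : Tendsto (fun n => ∫ t in Icc 0 T,
      |(∫ p, φ (t, p.1) ∂(κn n t)) - ∫ p, φ (t, p.1) ∂(κ t)|) atTop (𝓝 0) := by
    refine bv_strong (M := M) (K := M + M * T + (B * M + B ^ 2 / 2 * M) * T) hT
      (fun n => measurable_int_ker (hn1 n) mφ) (measurable_int_ker h1 mφ)
      (fun n t => abs_int_ker_le (hn1 n) (fun p : ℝ × ℝ => (hM t p.1).1) t)
      (fun t => abs_int_ker_le h1 (fun p : ℝ × ℝ => (hM t p.1).1) t) (by positivity) ?_ ?_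
    · intro n ψ hψ S hS
      have e1 := bv_R0 (φ := fun t x => φ (t, x)) hT hbB hσB cφ ct cx cxx hM dt dx dxx (hn1 n)
        (hR n) hψ hS
      have e2 := bv_R0 (φ := fun t x => φ (t, x)) hT hbB hσB cφ ct cx cxx hM dt dx dxx (hn1 n)
        (hR n) (ψ := fun t => - ψ t) hψ.neg (S := S)
        (fun t ht => by rw [intervalIntegral.integral_neg, abs_neg]; exact hS t ht)
      simp only [neg_mul, integral_neg] at e2
      rw [abs_le]
      constructor <;> linarith
    · intro ψ hψ ⟨Q, hQ⟩
      have e := hconv (fun t p => ψ t * φ (t, p.1)) (by fun_prop) ⟨Q * M, fun t p => by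
        rw [abs_mul]
        exact mul_le_mul (hQ t) (hM t p.1).1 (abs_nonneg _) ((abs_nonneg _).trans (hQ t))⟩
      simpa only [integral_const_mul] using e
  have htail : Tendsto (fun n => ∫ t in Icc 0 T, ∫ p, (1 - χ (t, p.1)) ∂(κn n t)) atTop
      (𝓝 (∫ t in Icc 0 T, ∫ p, (1 - χ (t, p.1)) ∂(κ t))) :=
    hconv (fun t p => 1 - χ (t, p.1)) (by fun_prop) ⟨1, fun t p => hχb _⟩
  -- pointwise comparison
  have hcmp : ∀ p, |c p - φ p| ≤ δ + (C + 1) * (1 - χ p) := by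
    intro p
    have a1 : |g p - c p| < δ := hgc p
    have a2 := hC p
    have a3 := hχ0 p
    have a4 := hχ1 p
    have e : c p - φ p = (1 - χ p) * c p + χ p * (c p - g p) := by simp only [hφdef]; ring
    rw [e]
    refine (abs_add_le _ _).trans ?_
    rw [abs_mul, abs_mul, abs_of_nonneg a3, abs_of_nonneg (by linarith : 0 ≤ 1 - χ p), abs_sub_comm]
    have b1 : (1 - χ p) * |c p| ≤ (1 - χ p) * C :=
      mul_le_mul_of_nonneg_left a2 (by linarith)
    have b2 : χ p * |g p - c p| ≤ 1 * δ := by gcongr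
    nlinarith
  have hker : ∀ κ' : Kernel ℝ (ℝ × ℝ), (∀ t, κ' t univ ≤ 1) → ∀ t,
      |(∫ p, c (t, p.1) ∂(κ' t)) - ∫ p, φ (t, p.1) ∂(κ' t)| ≤
        δ + (C + 1) * ∫ p, (1 - χ (t, p.1)) ∂(κ' t) := by
    intro κ' hκ' t
    have := isFiniteKernel_of_le hκ'
    have i1 : Integrable (fun p : ℝ × ℝ => c (t, p.1)) (κ' t) :=
      integrable_ker hκ' (mc.comp measurable_prodMk_left) (fun p => hC _) t
    have i2 : Integrable (fun p : ℝ × ℝ => φ (t, p.1)) (κ' t) :=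
      integrable_ker hκ' (mφ.comp measurable_prodMk_left) (fun p => (hM t p.1).1) t
    have i3 : Integrable (fun p : ℝ × ℝ => 1 - χ (t, p.1)) (κ' t) :=
      integrable_ker hκ' (mχ.comp measurable_prodMk_left) (fun p => hχb _) t
    rw [← integral_sub i1 i2]
    refine abs_integral_le_integral_abs.trans ?_
    refine (integral_mono (i1.sub i2).abs ((integrable_const δ).add (i3.const_mul (C + 1)))
      (fun p => hcmp (t, p.1))).trans ?_
    rw [integral_add' (integrable_const δ) (i3.const_mul (C + 1)), integral_const,
      integral_const_mul]
    have : (κ' t).real univ • δ ≤ δ := mul_le_of_le_one_left hδ.le (ker_real_le hκ' t)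
    linarith
  obtain ⟨N, hN⟩ := eventually_atTop.mp
    ((hstrong.eventually_lt_const hδ).and (htail.eventually_lt_const hχt))
  refine ⟨N, fun n hn => ?_⟩
  obtain ⟨hs1, hs2⟩ := hN n hn
  rw [Real.dist_eq, sub_zero, abs_of_nonneg (integral_nonneg fun _ => abs_nonneg _)]
  have hI : ∀ κ' : Kernel ℝ (ℝ × ℝ), (∀ t, κ' t univ ≤ 1) →
      IntegrableOn (fun t => ∫ p, (1 - χ (t, p.1)) ∂(κ' t)) (Icc 0 T) := fun κ' h =>
    integrableOn_of_bdd (M := 1) (measurable_int_ker h mχ)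
      (fun t => abs_int_ker_le h (fun p : ℝ × ℝ => hχb (t, p.1)) t)
  have hIφ : ∀ κ' : Kernel ℝ (ℝ × ℝ), (∀ t, κ' t univ ≤ 1) →
      IntegrableOn (fun t => ∫ p, φ (t, p.1) ∂(κ' t)) (Icc 0 T) := fun κ' h =>
    integrableOn_of_bdd (M := M) (measurable_int_ker h mφ)
      (fun t => abs_int_ker_le h (fun p : ℝ × ℝ => (hM t p.1).1) t)
  have hIc : ∀ κ' : Kernel ℝ (ℝ × ℝ), (∀ t, κ' t univ ≤ 1) →
      IntegrableOn (fun t => ∫ p, c (t, p.1) ∂(κ' t)) (Icc 0 T) := fun κ' h =>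
    integrableOn_of_bdd (M := C) (measurable_int_ker h mc)
      (fun t => abs_int_ker_le h (fun p : ℝ × ℝ => hC (t, p.1)) t)
  have j1 : IntegrableOn (fun t => |(∫ p, φ (t, p.1) ∂(κn n t)) - ∫ p, φ (t, p.1) ∂(κ t)|)
    (Icc 0 T) := ((hIφ _ (hn1 n)).sub (hIφ _ h1)).abs
  have j2 : IntegrableOn (fun t => |(∫ p, c (t, p.1) ∂(κn n t)) - ∫ p, c (t, p.1) ∂(κ t)|)
    (Icc 0 T) := ((hIc _ (hn1 n)).sub (hIc _ h1)).abs
  have jd : IntegrableOn (fun _ : ℝ => 2 * δ) (Icc 0 T) := integrable_const _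
  have j3 := (hI _ (hn1 n)).const_mul (C + 1)
  have j4 := (hI _ h1).const_mul (C + 1)
  have hfin := integral_mono j2 (((j1.add jd).add j3).add j4) (fun t => by
    have a1 := hker _ (hn1 n) t
    have a2 := hker _ h1 t
    simp only [Pi.add_apply]
    rw [abs_le] at a1 a2
    have a3 := le_abs_self ((∫ p, φ (t, p.1) ∂(κn n t)) - ∫ p, φ (t, p.1) ∂(κ t))
    have a4 := neg_abs_le ((∫ p, φ (t, p.1) ∂(κn n t)) - ∫ p, φ (t, p.1) ∂(κ t))
    rw [abs_le]
    constructor <;> linarith)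
  rw [integral_add' ((j1.add jd).add j3) j4, integral_add' (j1.add jd) j3, integral_add' j1 jd] at hfin
  simp only [integral_const_mul, integral_const, measureReal_restrict_apply_univ, Real.volume_real_Icc_of_le hT.le, smul_eq_mul,
    sub_zero] at hfin
  have k1 : (C + 1) * ∫ t in Icc 0 T, ∫ p, (1 - χ (t, p.1)) ∂(κn n t) ≤ (C + 1) * δ := by gcongr
  have k2 : (C + 1) * ∫ t in Icc 0 T, ∫ p, (1 - χ (t, p.1)) ∂(κ t) ≤ (C + 1) * δ := by gcongr
  rw [hD] at hδD
  nlinarith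

end

section
open ProbabilityTheory
open scoped BoundedContinuousFunction

lemma stronglyMeasurable_cmap {K : Type*} [TopologicalSpace K] [CompactSpace K]
    [SecondCountableTopology C(K, ℝ)] {G : ℝ → C(K, ℝ)}
    {s : Set K} (hsc : s.Countable) (hsd : Dense s)
    (hG : ∀ k, Measurable fun t => G t k) : StronglyMeasurable G := by
  borelize C(K, ℝ)
  refine Measurable.stronglyMeasurable ?_
  have hball : ∀ (f : C(K, ℝ)) (r : ℝ), 0 ≤ r → MeasurableSet {t | dist (G t) f ≤ r} := by
    intro f r hr
    have e : {t | dist (G t) f ≤ r} = ⋂ k ∈ s, {t | |G t k - f k| ≤ r} := by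
      ext t
      simp only [mem_setOf_eq, mem_iInter, ContinuousMap.dist_le hr, Real.dist_eq]
      refine ⟨fun h k _ => h k, fun h => ?_⟩
      have hcl : IsClosed {k | |G t k - f k| ≤ r} :=
        isClosed_le (by fun_prop) continuous_const
      intro k
      have : closure s ⊆ {k | |G t k - f k| ≤ r} := closure_minimal (fun k hk => h k hk) hcl
      exact this (hsd k)
    rw [e]
    exact MeasurableSet.biInter hsc fun k _ =>
      measurableSet_le (continuous_abs.measurable.comp ((hG k).sub_const _)) measurable_const
  refine measurable_of_isOpen fun U hU => ?_
  have e : G ⁻¹' U = ⋃ (i : ℕ) (q : ℚ) (_ : 0 ≤ (q:ℝ) ∧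
      Metric.closedBall (TopologicalSpace.denseSeq C(K, ℝ) i) q ⊆ U),
      {t | dist (G t) (TopologicalSpace.denseSeq C(K, ℝ) i) ≤ q} := by
    ext t
    simp only [mem_preimage, mem_iUnion, mem_setOf_eq, exists_prop]
    constructor
    · intro ht
      obtain ⟨ε, hε, hU'⟩ := Metric.isOpen_iff.mp hU _ ht
      obtain ⟨q, hq1, hq2⟩ := exists_rat_btwn (show (0:ℝ) < ε / 2 by positivity)
      obtain ⟨i, hi⟩ := (TopologicalSpace.denseRange_denseSeq C(K, ℝ)).exists_dist_lt (G t) hq1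
      refine ⟨i, q, ⟨hq1.le, fun f hf => hU' ?_⟩, hi.le⟩
      rw [Metric.mem_closedBall] at hf
      rw [Metric.mem_ball]
      have := dist_triangle_right f (G t) (TopologicalSpace.denseSeq C(K, ℝ) i)
      linarith
    · rintro ⟨i, q, ⟨_, h⟩, h2⟩
      exact h h2
  rw [e]
  exact MeasurableSet.iUnion fun i => MeasurableSet.iUnion fun q => MeasurableSet.iUnion fun h =>
    hball _ _ h.1

lemma est_ker {κ : Kernel ℝ (ℝ × ℝ)} (h1 : ∀ t, κ t univ ≤ 1) {T : ℝ} {A : Set ℝ}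
    (hκA : ∀ t, ∀ᵐ p ∂(κ t), p.2 ∈ A) {N L w : ℝ × ℝ × ℝ → ℝ} {C D : ℝ}
    (hN : Measurable N) (hL : Measurable L) (hw : Measurable w)
    (hNC : ∀ q, |N q| ≤ C) (hLC : ∀ q, |L q| ≤ C) (hwD : ∀ q, |w q| ≤ D)
    {E : ℝ → ℝ} (hE : IntegrableOn E (Icc 0 T)) (hE0 : ∀ t, 0 ≤ E t)
    (hcmp : ∀ t (p : ℝ × ℝ), p.2 ∈ A → |N (t, p) - L (t, p)| ≤ E t + w (t, p)) :
    |(∫ t in Icc 0 T, ∫ p, N (t, p) ∂(κ t)) - ∫ t in Icc 0 T, ∫ p, L (t, p) ∂(κ t)| ≤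
      (∫ t in Icc 0 T, E t) + ∫ t in Icc 0 T, ∫ p, w (t, p) ∂(κ t) := by
  have := isFiniteKernel_of_le h1
  have I : ∀ {f : ℝ × ℝ × ℝ → ℝ} {M : ℝ}, Measurable f → (∀ q, |f q| ≤ M) →
      IntegrableOn (fun t => ∫ p, f (t, p) ∂(κ t)) (Icc 0 T) := fun {f M} hf hM =>
    integrableOn_of_bdd (M := M) (measurable_int_ker h1 hf)
      (fun t => abs_int_ker_le h1 (fun p : ℝ × ℝ => hM (t, p)) t)
  have i : ∀ {f : ℝ × ℝ × ℝ → ℝ} {M : ℝ}, Measurable f → (∀ q, |f q| ≤ M) → ∀ t,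
      Integrable (fun p => f (t, p)) (κ t) := fun {f M} hf hM t =>
    integrable_ker h1 (hf.comp measurable_prodMk_left) (fun p => hM _) t
  rw [← integral_sub (I hN hNC) (I hL hLC), ← integral_add hE (I hw hwD)]
  refine abs_integral_le_integral_abs.trans ?_
  refine integral_mono ((I hN hNC).sub (I hL hLC)).abs (hE.add (I hw hwD)) fun t => ?_
  simp only [Pi.add_apply]
  rw [← integral_sub (i hN hNC t) (i hL hLC t)]
  refine abs_integral_le_integral_abs.trans ?_
  refine (integral_mono_ae ((i hN hNC t).sub (i hL hLC t)).abs
    ((integrable_const (E t)).add (i hw hwD t)) ((hκA t).mono fun p hp => hcmp t p hp)).trans ?_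
  rw [integral_add' (integrable_const (E t)) (i hw hwD t), integral_const]
  have : (κ t).real univ • E t ≤ E t := mul_le_of_le_one_left (hE0 t) (ker_real_le h1 t)
  linarith

lemma conv_B {T : ℝ} {A : Set ℝ} (hA : IsCompact A)
    {κn : ℕ → Kernel ℝ (ℝ × ℝ)} {κ : Kernel ℝ (ℝ × ℝ)}
    (hn1 : ∀ n t, κn n t univ ≤ 1) (h1 : ∀ t, κ t univ ≤ 1)
    (hnA : ∀ n t, ∀ᵐ p ∂(κn n t), p.2 ∈ A) (hκA : ∀ t, ∀ᵐ p ∂(κ t), p.2 ∈ A)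
    (hconv : ConvV T (fun n t => κn n t) (fun t => κ t))
    {L : ℝ × ℝ × ℝ → ℝ} {Ln : ℕ → ℝ × ℝ × ℝ → ℝ} {C : ℝ}
    (hL : Measurable L) (hLn : ∀ n, Measurable (Ln n))
    (hLC : ∀ q, |L q| ≤ C) (hLnC : ∀ n q, |Ln n q| ≤ C)
    (cL : ∀ t, ContinuousOn (fun p : ℝ × ℝ => L (t, p)) (univ ×ˢ A))
    (cLn : ∀ n t, ContinuousOn (fun p : ℝ × ℝ => Ln n (t, p)) (univ ×ˢ A))
    (hunif : ∀ R, ∀ᵐ t ∂(volume.restrict (Icc 0 T)),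
      TendstoUniformlyOn (fun n (p : ℝ × ℝ) => Ln n (t, p)) (fun p => L (t, p)) atTop
        (Icc (-R) R ×ˢ A)) :
    Tendsto (fun n => ∫ t in Icc 0 T, ∫ p, Ln n (t, p) ∂(κn n t)) atTop
      (𝓝 (∫ t in Icc 0 T, ∫ p, L (t, p) ∂(κ t))) := by
  have hC0 : 0 ≤ C := (abs_nonneg _).trans (hLC 0)
  rw [Metric.tendsto_atTop]
  intro ε hε
  obtain ⟨δ, hδ, hδε⟩ : ∃ δ > 0, δ * (4 * C + 4) < ε :=
    ⟨ε / (2 * (4 * C + 4)), by positivity, by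
      rw [div_mul_eq_mul_div, div_lt_iff₀ (by positivity)]; nlinarith⟩
  obtain ⟨χ, R, hR, hχs, -, hχ0, hχ1, hχR, hχt⟩ := tail h1 T hδ
  have cχ : Continuous χ := hχs.continuous
  have hχb : ∀ p, |1 - χ p| ≤ 1 := fun p => by
    have a1 := hχ0 p
    have a2 := hχ1 p
    rw [abs_le]
    constructor <;> linarith
  set K : Set (ℝ × ℝ) := Icc (-R) R ×ˢ A with hK
  have hKc : IsCompact K := isCompact_Icc.prod hA
  have hKA : K ⊆ univ ×ˢ A := prod_mono (subset_univ _) subset_rfl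
  have : CompactSpace K := isCompact_iff_compactSpace.mp hKc
  obtain ⟨s, hsc, hsd⟩ := TopologicalSpace.exists_countable_dense K
  let G : ℝ → C(K, ℝ) := fun t => ⟨fun k => L (t, k.1),
    ((cL t).mono hKA).comp_continuous continuous_subtype_val (fun k => k.2)⟩
  let Gn : ℕ → ℝ → C(K, ℝ) := fun n t => ⟨fun k => Ln n (t, k.1),
    ((cLn n t).mono hKA).comp_continuous continuous_subtype_val (fun k => k.2)⟩
  have mG : StronglyMeasurable G := stronglyMeasurable_cmap hsc hsd fun k =>
    hL.comp (measurable_id.prodMk measurable_const)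
  have mGn : ∀ n, StronglyMeasurable (Gn n) := fun n => stronglyMeasurable_cmap hsc hsd fun k =>
    (hLn n).comp (measurable_id.prodMk measurable_const)
  have bG : ∀ t, ‖G t‖ ≤ C := fun t => (ContinuousMap.norm_le _ hC0).mpr fun k => hLC _
  have bGn : ∀ n t, ‖Gn n t‖ ≤ C := fun n t => (ContinuousMap.norm_le _ hC0).mpr fun k => hLnC n _
  have iG : IntegrableOn G (Icc 0 T) := ⟨mG.aestronglyMeasurable,
    HasFiniteIntegral.of_bounded (C := C) (ae_of_all _ bG)⟩
  have iGn : ∀ n, IntegrableOn (Gn n) (Icc 0 T) := fun n => ⟨(mGn n).aestronglyMeasurable,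
    HasFiniteIntegral.of_bounded (C := C) (ae_of_all _ (bGn n))⟩
  -- L¹ convergence of the restricted integrands
  have hD : Tendsto (fun n => ∫ t in Icc 0 T, ‖Gn n t - G t‖) atTop (𝓝 0) := by
    have := tendsto_integral_of_dominated_convergence (μ := volume.restrict (Icc 0 T))
      (F := fun n t => ‖Gn n t - G t‖) (f := fun _ => (0:ℝ)) (fun _ => 2 * C)
      (fun n => ((iGn n).sub iG).norm.aestronglyMeasurable) (integrable_const _)
      (fun n => ae_of_all _ fun t => by
        rw [norm_norm]
        refine (norm_sub_le _ _).trans ?_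
        have a1 := bGn n t
        have a2 := bG t
        linarith) (by
        filter_upwards [hunif R] with t ht
        rw [← tendsto_iff_norm_sub_tendsto_zero (f := fun n => Gn n t) (b := G t),
          ContinuousMap.tendsto_iff_tendstoUniformly]
        exact tendstoUniformlyOn_iff_tendstoUniformly_comp_coe.mp ht)
    simpa using this
  obtain ⟨G', hG', iG'⟩ := iG.exists_boundedContinuous_integral_sub_le hδ
  have cG' : Continuous fun q : (univ ×ˢ K : Set (ℝ × ℝ × ℝ)) => G' q.1.1 ⟨q.1.2, q.2.2⟩ := by
    have c1 : Continuous fun q : (univ ×ˢ K : Set (ℝ × ℝ × ℝ)) => G' q.1.1 :=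
      G'.continuous.comp (by fun_prop)
    have c2 : Continuous fun q : (univ ×ˢ K : Set (ℝ × ℝ × ℝ)) => (⟨q.1.2, q.2.2⟩ : K) :=
      Continuous.subtype_mk (by fun_prop) _
    exact ContinuousEval.continuous_eval.comp (c1.prodMk c2)
  classical
  let f : ℝ × ℝ × ℝ → ℝ := fun q => if h : q.2 ∈ K then max (-C) (min C (G' q.1 ⟨q.2, h⟩)) else 0
  have cf : ContinuousOn f (univ ×ˢ K) := by
    rw [continuousOn_iff_continuous_domRestrict]
    have : (univ ×ˢ K).domRestrict f = fun q => max (-C) (min C (G' q.1.1 ⟨q.1.2, q.2.2⟩)) := by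
      funext q
      simp only [Set.domRestrict_apply, f]
      rw [dif_pos q.2.2]
    rw [this]
    fun_prop
  have bf : ∀ q ∈ (univ ×ˢ K : Set (ℝ × ℝ × ℝ)), |f q| ≤ C := by
    intro q hq
    simp only [f]
    rw [dif_pos hq.2, abs_le]
    exact ⟨le_max_left _ _, max_le (by linarith) (min_le_left _ _)⟩
  obtain ⟨L', cL', bL', hL'⟩ := tietze_bdd (isClosed_univ.prod hKc.isClosed) cf hC0 bf
  have hclamp : ∀ x y : ℝ, |y| ≤ C → |y - max (-C) (min C x)| ≤ |y - x| := by
    intro x y hy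
    rw [abs_le] at hy
    rcases le_total C x with h | h
    · rw [min_eq_left h, max_eq_right (by linarith)]
      rw [abs_of_nonpos (by linarith), abs_of_nonpos (by linarith)]; linarith
    · rw [min_eq_right h]
      rcases le_total (-C) x with h' | h'
      · rw [max_eq_right h']
      · rw [max_eq_left h', abs_of_nonneg (by linarith), abs_of_nonneg (by linarith)]; linarith
  have hcmp : ∀ (N : ℝ × ℝ × ℝ → ℝ) (H : ℝ → C(K, ℝ)), (∀ q, |N q| ≤ C) →
      (∀ t k, H t k = N (t, k.1)) → ∀ t (p : ℝ × ℝ), p.2 ∈ A →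
      |N (t, p) - L' (t, p)| ≤ ‖H t - G' t‖ + 2 * C * (1 - χ (t, p.1)) := by
    intro N H hN hH t p hp
    have a1 := hχ1 (t, p.1)
    by_cases hx : |p.1| ≤ R
    · have hpK : p ∈ K := ⟨abs_le.mp hx, hp⟩
      rw [hL' (t, p) ⟨mem_univ _, hpK⟩]
      simp only [f]
      rw [dif_pos hpK]
      refine (hclamp _ _ (hN _)).trans ?_
      have := (H t - G' t).norm_coe_le_norm ⟨p, hpK⟩
      rw [ContinuousMap.sub_apply, hH, Real.norm_eq_abs] at this
      refine this.trans ?_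
      have : 0 ≤ 2 * C * (1 - χ (t, p.1)) := mul_nonneg (by linarith) (by linarith)
      linarith
    · rw [hχR t p.1 (not_le.mp hx)]
      have b1 := abs_sub (N (t, p)) (L' (t, p))
      have b2 := hN (t, p)
      have b3 := bL' (t, p)
      have b4 := norm_nonneg (H t - G' t)
      linarith
  have mw : Measurable fun q : ℝ × ℝ × ℝ => 2 * C * (1 - χ (q.1, q.2.1)) :=
    Continuous.measurable (by fun_prop)
  have bw : ∀ q : ℝ × ℝ × ℝ, |2 * C * (1 - χ (q.1, q.2.1))| ≤ 2 * C := fun q => by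
    rw [abs_mul, abs_of_nonneg (by linarith : 0 ≤ 2 * C)]
    exact mul_le_of_le_one_right (by linarith) (hχb _)
  have e0 := est_ker h1 (T := T) hκA hL cL'.measurable mw hLC bL' bw (iG.sub iG').norm
    (fun t => norm_nonneg _) (hcmp L G hLC fun _ _ => rfl)
  have en := fun n => est_ker (hn1 n) (T := T) (hnA n) (hLn n) cL'.measurable mw (hLnC n) bL' bw
    ((iGn n).sub iG').norm (fun t => norm_nonneg _) (hcmp (Ln n) (Gn n) (hLnC n) fun _ _ => rfl)
  have htri : ∀ n, ∫ t in Icc 0 T, ‖Gn n t - G' t‖ ≤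
      (∫ t in Icc 0 T, ‖Gn n t - G t‖) + ∫ t in Icc 0 T, ‖G t - G' t‖ := by
    intro n
    have := integral_mono ((iGn n).sub iG').norm (((iGn n).sub iG).norm.add (iG.sub iG').norm)
      (fun t => norm_sub_le_norm_sub_add_norm_sub (Gn n t) (G t) (G' t))
    rwa [integral_add' ((iGn n).sub iG).norm (iG.sub iG').norm] at this
  have htail : Tendsto (fun n => ∫ t in Icc 0 T, ∫ p, (1 - χ (t, p.1)) ∂(κn n t)) atTop
      (𝓝 (∫ t in Icc 0 T, ∫ p, (1 - χ (t, p.1)) ∂(κ t))) :=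
    hconv (fun t p => 1 - χ (t, p.1)) (by fun_prop) ⟨1, fun t p => hχb _⟩
  have hlim : Tendsto (fun n => ∫ t in Icc 0 T, ∫ p, L' (t, p) ∂(κn n t)) atTop
      (𝓝 (∫ t in Icc 0 T, ∫ p, L' (t, p) ∂(κ t))) :=
    hconv (fun t p => L' (t, p)) cL' ⟨C, fun t p => bL' _⟩
  obtain ⟨N1, hN1⟩ := Metric.tendsto_atTop.mp hlim δ hδ
  obtain ⟨N2, hN2⟩ := eventually_atTop.mp
    ((hD.eventually_lt_const hδ).and (htail.eventually_lt_const hχt))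
  refine ⟨max N1 N2, fun n hn => ?_⟩
  have f1 := hN1 n ((le_max_left _ _).trans hn)
  obtain ⟨f2, f3⟩ := hN2 n ((le_max_right _ _).trans hn)
  have f4 := en n
  have f5 := htri n
  simp only [integral_const_mul, Pi.sub_apply] at e0 f4
  rw [Real.dist_eq, abs_lt] at f1
  rw [abs_le] at e0 f4
  have k1 : 2 * C * ∫ t in Icc 0 T, ∫ p, (1 - χ (t, p.1)) ∂(κn n t) ≤ 2 * C * δ := by gcongr
  have k2 : 2 * C * ∫ t in Icc 0 T, ∫ p, (1 - χ (t, p.1)) ∂(κ t) ≤ 2 * C * δ := by gcongr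
  rw [Real.dist_eq, abs_lt]
  constructor <;> nlinarith

end

section
open ProbabilityTheory

lemma conv_A {E : Type*} [NormedAddCommGroup E] [MeasurableSpace E] [BorelSpace E]
    [SecondCountableTopology E] {T : ℝ} {A : Set ℝ} (hA : IsCompact A)
    {κn : ℕ → Kernel ℝ (ℝ × ℝ)} {κ : Kernel ℝ (ℝ × ℝ)}
    (hn1 : ∀ n t, κn n t univ ≤ 1) (h1 : ∀ t, κ t univ ≤ 1)
    (hnA : ∀ n t, ∀ᵐ p ∂(κn n t), p.2 ∈ A) (hκA : ∀ t, ∀ᵐ p ∂(κ t), p.2 ∈ A)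
    (hconv : ConvV T (fun n t => κn n t) (fun t => κ t))
    {Φ : ℝ → E → ℝ × ℝ → ℝ} {C : ℝ} (hΦC : ∀ t y p, |Φ t y p| ≤ C)
    (mΦ : Measurable fun q : ℝ × E × ℝ × ℝ => Φ q.1 q.2.1 q.2.2)
    (cΦ : ∀ t, ContinuousOn (Function.uncurry (Φ t)) (univ ×ˢ (univ ×ˢ A)))
    {Yn : ℕ → ℝ → E} {Y : ℝ → E} {Q : ℝ} (mYn : ∀ n, Measurable (Yn n)) (mY : Measurable Y)
    (bYn : ∀ n t, ‖Yn n t‖ ≤ Q) (bY : ∀ t, ‖Y t‖ ≤ Q)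
    (hY : Tendsto (fun n => ∫ t in Icc 0 T, ‖Yn n t - Y t‖) atTop (𝓝 0)) :
    Tendsto (fun n => ∫ t in Icc 0 T, ∫ p, Φ t (Yn n t) p ∂(κn n t)) atTop
      (𝓝 (∫ t in Icc 0 T, ∫ p, Φ t (Y t) p ∂(κ t))) := by
  refine tendsto_of_subseq_tendsto fun ns hns => ?_
  have iY : ∀ n, IntegrableOn (Yn n - Y) (Icc 0 T) := fun n =>
    ⟨((mYn n).sub mY).aestronglyMeasurable,
      HasFiniteIntegral.of_bounded (C := Q + Q) (ae_of_all _ fun t =>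
        (norm_sub_le _ _).trans (add_le_add (bYn n t) (bY t)))⟩
  have hmeas : TendstoInMeasure (volume.restrict (Icc 0 T)) (fun n => Yn (ns n)) atTop Y := by
    refine tendstoInMeasure_of_tendsto_eLpNorm one_ne_zero
      (fun n => (mYn _).aestronglyMeasurable) mY.aestronglyMeasurable ?_
    have e : ∀ n, eLpNorm (Yn (ns n) - Y) 1 (volume.restrict (Icc 0 T)) =
        ENNReal.ofReal (∫ t in Icc 0 T, ‖Yn (ns n) t - Y t‖) := fun n => by
      rw [eLpNorm_one_eq_lintegral_enorm, ← ofReal_integral_norm_eq_lintegral_enorm (iY (ns n))]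
      rfl
    simp only [e]
    have := (ENNReal.continuous_ofReal.tendsto 0).comp (hY.comp hns)
    rw [ENNReal.ofReal_zero] at this
    exact this
  obtain ⟨ms, hms, hae⟩ := hmeas.exists_seq_tendsto_ae
  refine ⟨ms, ?_⟩
  have htend : Tendsto (fun n => ns (ms n)) atTop atTop := hns.comp hms.tendsto_atTop
  have mcomp : ∀ y : ℝ → E, Measurable y → Measurable fun q : ℝ × ℝ × ℝ => Φ q.1 (y q.1) q.2 :=
    fun y hy => mΦ.comp (measurable_fst.prodMk ((hy.comp measurable_fst).prodMk measurable_snd))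
  have ccomp : ∀ t (y : E), ContinuousOn (fun p : ℝ × ℝ => Φ t y p) (univ ×ˢ A) := fun t y =>
    (cΦ t).comp (f := fun p : ℝ × ℝ => (y, p)) (by fun_prop) (fun p hp => ⟨mem_univ _, hp⟩)
  refine conv_B (L := fun q => Φ q.1 (Y q.1) q.2) (Ln := fun n q => Φ q.1 (Yn (ns (ms n)) q.1) q.2)
    (κn := fun n => κn (ns (ms n))) (C := C) hA (fun n => hn1 _) h1 (fun n => hnA _) hκA ?_
    (mcomp _ mY) (fun n => mcomp _ (mYn _)) (fun q => hΦC _ _ _) (fun n q => hΦC _ _ _)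
    (fun t => ccomp t (Y t)) (fun n t => ccomp t (Yn (ns (ms n)) t)) ?_
  · intro h hc hb
    exact (hconv h hc hb).comp htend
  · intro R
    filter_upwards [hae] with t ht
    intro u hu
    obtain ⟨v, hv, hvu⟩ := (isCompact_Icc.prod hA : IsCompact (Icc (-R) R ×ˢ A)).mem_uniformity_of_prod
      (f := Φ t) (s := univ) (q := Y t)
      ((cΦ t).mono (prod_mono subset_rfl (prod_mono (subset_univ _) subset_rfl))) (mem_univ _)
      (symm_le_uniformity hu)
    rw [nhdsWithin_univ] at hv
    filter_upwards [ht hv] with n hn p hp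
    exact hvu _ hn p hp

lemma exists_hat_ext {T : ℝ} {O A : Set ℝ} {d : ℕ}
    {c : ℝ → ℝ → Measure (ℝ × ℝ) → ℝ → ℝ} {cbar : ℝ → ℝ → (Fin d → ℝ) → ℝ → ℝ}
    {chat : ℝ → ℝ → Fin d → ℝ} (h : MFCoeff T O A d c cbar chat) :
    ∃ (g : Fin d → ℝ × ℝ → ℝ) (C : ℝ), 0 ≤ C ∧ (∀ i, Continuous (g i)) ∧ (∀ i p, |g i p| ≤ C) ∧
      ∀ t ∈ Icc 0 T, ∀ ν : Measure (ℝ × ℝ), ν ((closure O ×ˢ A)ᶜ) = 0 → ∀ x a,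
        c t x ν a = cbar t x (fun i => ∫ p, g i (t, p.1) ∂ν) a := by
  obtain ⟨-, hc, -, -, -, hcont, C, hC⟩ := h
  have hC0 : 0 ≤ C := (norm_nonneg _).trans (hC 0 0)
  have : ∀ i, ∃ g : ℝ × ℝ → ℝ, Continuous g ∧ (∀ p, |g p| ≤ C) ∧
      ∀ p ∈ Icc 0 T ×ˢ closure O, g p = chat p.1 p.2 i := fun i =>
    tietze_bdd (isClosed_Icc.prod isClosed_closure) (continuousOn_pi.mp hcont i) hC0
      (fun p _ => (norm_le_pi_norm (chat p.1 p.2) i).trans (hC _ _))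
  choose g g1 g2 g3 using this
  refine ⟨g, C, hC0, g1, g2, fun t ht ν hν x a => ?_⟩
  rw [hc]
  congr 1
  funext i
  refine integral_congr_ae ?_
  have : ∀ᵐ p ∂ν, p ∈ closure O ×ˢ A := by rwa [ae_iff]
  filter_upwards [this] with p hp
  exact (g3 i (t, p.1) ⟨ht, hp.1⟩).symm

lemma conv_kernel {T : ℝ} (hT : 0 < T) {O A : Set ℝ} (hA : IsCompact A) {d : ℕ}
    {b σ : ℝ → ℝ → Measure (ℝ × ℝ) → ℝ → ℝ}
    {bbar σbar : ℝ → ℝ → (Fin d → ℝ) → ℝ → ℝ} {bhat σhat : ℝ → ℝ → Fin d → ℝ}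
    (hb : MFCoeff T O A d b bbar bhat) (hσ : MFCoeff T O A d σ σbar σhat)
    {m0 : Measure ℝ}
    {κn κbn : ℕ → Kernel ℝ (ℝ × ℝ)} {κ κb : Kernel ℝ (ℝ × ℝ)}
    (hn1 : ∀ n t, κn n t univ ≤ 1) (h1 : ∀ t, κ t univ ≤ 1)
    (hbn1 : ∀ n t, κbn n t univ ≤ 1) (hb1 : ∀ t, κb t univ ≤ 1)
    (hns : ∀ n t, κn n t ((closure O ×ˢ A)ᶜ) = 0) (hs : ∀ t, κ t ((closure O ×ˢ A)ᶜ) = 0)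
    (hbns : ∀ n t, κbn n t ((closure O ×ˢ A)ᶜ) = 0) (hbs : ∀ t, κb t ((closure O ×ˢ A)ᶜ) = 0)
    {μn : ℕ → Measure (ℝ × ℝ)}
    (hR : ∀ n, MemR0 T O A b σ m0 (μn n) (fun t => κbn n t))
    (hconv : ConvV T (fun n t => κn n t) (fun t => κ t))
    (hbconv : ConvV T (fun n t => κbn n t) (fun t => κb t))
    {ut ux uxx : ℝ × ℝ → ℝ} {M : ℝ} (ct : Continuous ut) (cx : Continuous ux)
    (cxx : Continuous uxx) (hMt : ∀ p, |ut p| ≤ M) (hMx : ∀ p, |ux p| ≤ M)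
    (hMxx : ∀ p, |uxx p| ≤ M) :
    Tendsto (fun n => ∫ t in Icc 0 T, ∫ p, (ut (t, p.1) + (b t p.1 (κbn n t) p.2 * ux (t, p.1)
        + σ t p.1 (κbn n t) p.2 ^ 2 / 2 * uxx (t, p.1))) ∂(κn n t)) atTop
      (𝓝 (∫ t in Icc 0 T, ∫ p, (ut (t, p.1) + (b t p.1 (κb t) p.2 * ux (t, p.1)
        + σ t p.1 (κb t) p.2 ^ 2 / 2 * uxx (t, p.1))) ∂(κ t))) := by
  obtain ⟨gb, C1, hC1, gb1, gb2, gb3⟩ := exists_hat_ext hb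
  obtain ⟨gs, C2, hC2, gs1, gs2, gs3⟩ := exists_hat_ext hσ
  obtain ⟨-, eb, ⟨B1, hB1⟩, mb, cb, -, -⟩ := hb
  obtain ⟨-, es, ⟨B2, hB2⟩, ms, cs, -, -⟩ := hσ
  set B := max B1 B2 with hB
  have hbB : ∀ t x ν a, |b t x ν a| ≤ B := fun t x ν a => by
    rw [eb]; exact (hB1 _ _ _ _).trans (le_max_left _ _)
  have hσB : ∀ t x ν a, |σ t x ν a| ≤ B := fun t x ν a => by
    rw [es]; exact (hB2 _ _ _ _).trans (le_max_right _ _)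
  have hM0 : 0 ≤ M := (abs_nonneg _).trans (hMt 0)
  have hB0 : 0 ≤ B := (abs_nonneg _).trans (hbB 0 0 0 0)
  let Z : Kernel ℝ (ℝ × ℝ) → ℝ → (Fin d → ℝ) × (Fin d → ℝ) := fun κ' t =>
    (fun i => ∫ p, gb i (t, p.1) ∂(κ' t), fun i => ∫ p, gs i (t, p.1) ∂(κ' t))
  have mZ : ∀ κ' : Kernel ℝ (ℝ × ℝ), (∀ t, κ' t univ ≤ 1) → Measurable (Z κ') := by
    intro κ' h
    refine Measurable.prodMk ?_ ?_
    · exact measurable_pi_lambda _ fun i =>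
        measurable_int_ker h (f := fun q => gb i (q.1, q.2.1))
          (Continuous.measurable ((gb1 i).comp (by fun_prop)))
    · exact measurable_pi_lambda _ fun i =>
        measurable_int_ker h (f := fun q => gs i (q.1, q.2.1))
          (Continuous.measurable ((gs1 i).comp (by fun_prop)))
  have bZ : ∀ κ' : Kernel ℝ (ℝ × ℝ), (∀ t, κ' t univ ≤ 1) → ∀ t, ‖Z κ' t‖ ≤ max C1 C2 := by
    intro κ' h t
    refine max_le_max ?_ ?_
    · exact (pi_norm_le_iff_of_nonneg hC1).mpr fun i =>
        abs_int_ker_le h (fun p : ℝ × ℝ => gb2 i (t, p.1)) t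
    · exact (pi_norm_le_iff_of_nonneg hC2).mpr fun i =>
        abs_int_ker_le h (fun p : ℝ × ℝ => gs2 i (t, p.1)) t
  have iZ : ∀ n, IntegrableOn (fun t => Z (κbn n) t - Z κb t) (Icc 0 T) := fun n =>
    ⟨((mZ _ (hbn1 n)).sub (mZ _ hb1)).aestronglyMeasurable,
      HasFiniteIntegral.of_bounded (C := max C1 C2 + max C1 C2) (ae_of_all _ fun t =>
        (norm_sub_le _ _).trans (add_le_add (bZ _ (hbn1 n) t) (bZ _ hb1 t)))⟩
  have hZ : Tendsto (fun n => ∫ t in Icc 0 T, ‖Z (κbn n) t - Z κb t‖) atTop (𝓝 0) := by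
    have t1 : ∀ i, Tendsto (fun n => ∫ t in Icc 0 T,
        |(∫ p, gb i (t, p.1) ∂(κbn n t)) - ∫ p, gb i (t, p.1) ∂(κb t)|) atTop (𝓝 0) := fun i =>
      strong_conv hT hbB hσB hbn1 hb1 hR hbconv (gb1 i) (gb2 i)
    have t2 : ∀ i, Tendsto (fun n => ∫ t in Icc 0 T,
        |(∫ p, gs i (t, p.1) ∂(κbn n t)) - ∫ p, gs i (t, p.1) ∂(κb t)|) atTop (𝓝 0) := fun i =>
      strong_conv hT hbB hσB hbn1 hb1 hR hbconv (gs1 i) (gs2 i)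
    have t3 := (tendsto_finsetSum Finset.univ fun i _ => t1 i).add
      (tendsto_finsetSum Finset.univ fun i _ => t2 i)
    simp only [Finset.sum_const_zero, add_zero] at t3
    refine squeeze_zero (fun n => integral_nonneg fun t => norm_nonneg _) (fun n => ?_) t3
    have ii1 : ∀ i, IntegrableOn (fun t =>
        |(∫ p, gb i (t, p.1) ∂(κbn n t)) - ∫ p, gb i (t, p.1) ∂(κb t)|) (Icc 0 T) := fun i =>
      (((iZ n).fst).eval i).abs
    have ii2 : ∀ i, IntegrableOn (fun t =>
        |(∫ p, gs i (t, p.1) ∂(κbn n t)) - ∫ p, gs i (t, p.1) ∂(κb t)|) (Icc 0 T) := fun i =>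
      (((iZ n).snd).eval i).abs
    rw [← integral_finsetSum _ fun i _ => ii1 i, ← integral_finsetSum _ fun i _ => ii2 i,
      ← integral_add (integrable_finsetSum _ fun i _ => ii1 i)
        (integrable_finsetSum _ fun i _ => ii2 i)]
    refine integral_mono (iZ n).norm ((integrable_finsetSum _ fun i _ => ii1 i).add
        (integrable_finsetSum _ fun i _ => ii2 i)) fun t => ?_
    have hpi : ∀ v : Fin d → ℝ, ‖v‖ ≤ ∑ i, |v i| := fun v =>
      (pi_norm_le_iff_of_nonneg (Finset.sum_nonneg fun i _ => abs_nonneg _)).mpr fun i =>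
        Finset.single_le_sum (f := fun i => |v i|) (fun i _ => abs_nonneg _) (Finset.mem_univ i)
    refine max_le ?_ ?_
    · refine (hpi _).trans (le_add_of_nonneg_right ?_)
      exact Finset.sum_nonneg fun i _ => abs_nonneg _
    · refine (hpi _).trans (le_add_of_nonneg_left ?_)
      exact Finset.sum_nonneg fun i _ => abs_nonneg _
  let Φ : ℝ → (Fin d → ℝ) × (Fin d → ℝ) → ℝ × ℝ → ℝ := fun t y p =>
    ut (t, p.1) + (bbar t p.1 y.1 p.2 * ux (t, p.1) + σbar t p.1 y.2 p.2 ^ 2 / 2 * uxx (t, p.1))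
  have key := conv_A (T := T) hA hn1 h1 (κn := κn) (κ := κ) (Φ := Φ)
    (C := M + (B * M + B ^ 2 / 2 * M))
    (fun n t => (show ∀ᵐ p ∂(κn n t), p ∈ closure O ×ˢ A by rw [ae_iff]; exact hns n t).mono
      fun p hp => hp.2)
    (fun t => (show ∀ᵐ p ∂(κ t), p ∈ closure O ×ˢ A by rw [ae_iff]; exact hs t).mono
      fun p hp => hp.2) hconv ?_ ?_ ?_ (fun n => mZ _ (hbn1 n)) (mZ _ hb1)
      (fun n => bZ _ (hbn1 n)) (bZ _ hb1) hZ
  · have eq : ∀ κ1 κ2 : Kernel ℝ (ℝ × ℝ), (∀ t, κ2 t ((closure O ×ˢ A)ᶜ) = 0) →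
        ∫ t in Icc 0 T, ∫ p, (ut (t, p.1) + (b t p.1 (κ2 t) p.2 * ux (t, p.1)
          + σ t p.1 (κ2 t) p.2 ^ 2 / 2 * uxx (t, p.1))) ∂(κ1 t) =
        ∫ t in Icc 0 T, ∫ p, Φ t (Z κ2 t) p ∂(κ1 t) := by
      intro κ1 κ2 h
      refine setIntegral_congr_fun measurableSet_Icc fun t ht => ?_
      refine integral_congr_ae (ae_of_all _ fun p => ?_)
      simp only [Φ, Z]
      rw [gb3 t ht _ (h t), gs3 t ht _ (h t)]
    rw [eq _ _ hbs]
    exact key.congr fun n => (eq _ _ (hbns n)).symm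
  · intro t y p
    have a1 := hMt (t, p.1)
    have a2 := hMx (t, p.1)
    have a3 := hMxx (t, p.1)
    have a4 : |bbar t p.1 y.1 p.2| ≤ B := (hB1 _ _ _ _).trans (le_max_left _ _)
    have a5 : |σbar t p.1 y.2 p.2| ≤ B := (hB2 _ _ _ _).trans (le_max_right _ _)
    simp only [Φ]
    refine (abs_add_le _ _).trans (add_le_add a1 ((abs_add_le _ _).trans (add_le_add ?_ ?_)))
    · rw [abs_mul]; gcongr
    · rw [abs_mul, abs_div, abs_pow, abs_of_pos (two_pos : (0:ℝ) < 2)]; gcongr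
  · simp only [Φ]
    have k1 : Measurable fun q : ℝ × ((Fin d → ℝ) × (Fin d → ℝ)) × ℝ × ℝ =>
        bbar q.1 q.2.2.1 q.2.1.1 q.2.2.2 :=
      mb.comp (g := fun q : ℝ × ℝ × (Fin d → ℝ) × ℝ => bbar q.1 q.2.1 q.2.2.1 q.2.2.2)
        (f := fun q : ℝ × ((Fin d → ℝ) × (Fin d → ℝ)) × ℝ × ℝ =>
          (q.1, q.2.2.1, q.2.1.1, q.2.2.2)) (by fun_prop)
    have k2 : Measurable fun q : ℝ × ((Fin d → ℝ) × (Fin d → ℝ)) × ℝ × ℝ =>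
        σbar q.1 q.2.2.1 q.2.1.2 q.2.2.2 :=
      ms.comp (g := fun q : ℝ × ℝ × (Fin d → ℝ) × ℝ => σbar q.1 q.2.1 q.2.2.1 q.2.2.2)
        (f := fun q : ℝ × ((Fin d → ℝ) × (Fin d → ℝ)) × ℝ × ℝ =>
          (q.1, q.2.2.1, q.2.1.2, q.2.2.2)) (by fun_prop)
    have k3 := ct.measurable
    have k4 := cx.measurable
    have k5 := cxx.measurable
    fun_prop
  · intro t
    have k1 : ContinuousOn (fun q : ((Fin d → ℝ) × (Fin d → ℝ)) × ℝ × ℝ =>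
        bbar t q.2.1 q.1.1 q.2.2) (univ ×ˢ (univ ×ˢ A)) :=
      (cb t).comp (f := fun q : ((Fin d → ℝ) × (Fin d → ℝ)) × ℝ × ℝ => (q.2.1, q.1.1, q.2.2))
        (by fun_prop) (fun q hq => ⟨mem_univ _, mem_univ _, hq.2.2⟩)
    have k2 : ContinuousOn (fun q : ((Fin d → ℝ) × (Fin d → ℝ)) × ℝ × ℝ =>
        σbar t q.2.1 q.1.2 q.2.2) (univ ×ˢ (univ ×ˢ A)) :=
      (cs t).comp (f := fun q : ((Fin d → ℝ) × (Fin d → ℝ)) × ℝ × ℝ => (q.2.1, q.1.2, q.2.2))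
        (by fun_prop) (fun q hq => ⟨mem_univ _, mem_univ _, hq.2.2⟩)
    have k3 : ContinuousOn (fun q : ((Fin d → ℝ) × (Fin d → ℝ)) × ℝ × ℝ => ut (t, q.2.1))
      (univ ×ˢ (univ ×ˢ A)) := Continuous.continuousOn (by fun_prop)
    have k4 : ContinuousOn (fun q : ((Fin d → ℝ) × (Fin d → ℝ)) × ℝ × ℝ => ux (t, q.2.1))
      (univ ×ˢ (univ ×ˢ A)) := Continuous.continuousOn (by fun_prop)
    have k5 : ContinuousOn (fun q : ((Fin d → ℝ) × (Fin d → ℝ)) × ℝ × ℝ => uxx (t, q.2.1))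
      (univ ×ˢ (univ ×ˢ A)) := Continuous.continuousOn (by fun_prop)
    exact k3.add ((k1.mul k4).add (((k2.pow 2).div_const 2).mul k5))

end

section
open ProbabilityTheory

lemma isCb12_time {T : ℝ} (O : Set ℝ) {ψ : ℝ → ℝ} (hψ : Continuous ψ)
    (h0 : ∀ t, 0 ≤ ψ t) (h1 : ∀ t, ψ t ≤ 1) :
    IsCb12 T O (fun t _ => ∫ s in t..T, ψ s) (fun t _ => -ψ t) (fun _ _ => 0) (fun _ _ => 0) := by
  have hd : ∀ t, HasDerivAt (fun s => ∫ r in s..T, ψ r) (-ψ t) t := fun t =>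
    intervalIntegral.integral_hasDerivAt_left (hψ.intervalIntegrable _ _)
      (hψ.stronglyMeasurableAtFilter _ _) hψ.continuousAt
  have hc : Continuous fun s => ∫ r in s..T, ψ r :=
    continuous_iff_continuousAt.mpr fun t => (hd t).continuousAt
  refine ⟨(hc.comp continuous_fst).continuousOn, (hψ.neg.comp continuous_fst).continuousOn,
    continuousOn_const, continuousOn_const, fun t _ x _ => (hd t).hasDerivWithinAt,
    fun t _ x _ => hasDerivWithinAt_const _ _ _, fun t _ x _ => hasDerivWithinAt_const _ _ _,
    T + 1, fun t ht x _ => ?_⟩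
  have hT : 0 ≤ T := ht.1.trans ht.2
  have : |∫ s in t..T, ψ s| ≤ T := by
    have := intervalIntegral.norm_integral_le_of_norm_le_const (a := t) (b := T) (C := 1) (f := ψ)
      (fun x _ => by rw [Real.norm_eq_abs, abs_of_nonneg (h0 x)]; exact h1 x)
    rw [one_mul, abs_of_nonneg (sub_nonneg.mpr ht.2), Real.norm_eq_abs] at this
    linarith [ht.1]
  have h2 : |-ψ t| ≤ 1 := by rw [abs_neg, abs_of_nonneg (h0 t)]; exact h1 t
  refine ⟨by linarith, by linarith, ?_, ?_⟩ <;> simp <;> linarith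

lemma mass_ae {T : ℝ} {O A : Set ℝ} {m : ℝ → Measure (ℝ × ℝ)} (hm : MemV T O A m)
    (h : ∀ ψ : ℝ → ℝ, Continuous ψ → (∀ t, 0 ≤ ψ t) → (∀ t, ψ t ≤ 1) →
      ∫ t in Icc 0 T, ψ t * (m t univ).toReal ≤ ∫ t in Icc 0 T, ψ t) :
    ∀ᵐ t ∂(volume.restrict (Icc 0 T)), (m t univ).toReal ≤ 1 := by
  have mm : Measurable fun t => (m t univ).toReal := (hm.2.2.1 univ MeasurableSet.univ).ennreal_toReal
  have i1 : IntegrableOn (fun _ : ℝ => (1:ℝ)) (Icc 0 T) := integrable_const _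
  have := ae_nonpos_of_cont (T := T) (g := fun t => (m t univ).toReal - 1) (mm.sub_const 1)
    (hm.2.2.2.sub i1) (fun ψ hψ h0 h1 => by
      have hb : ∀ t, |ψ t| ≤ 1 := fun t => by rw [abs_of_nonneg (h0 t)]; exact h1 t
      have j1 : IntegrableOn (fun t => ψ t * (m t univ).toReal) (Icc 0 T) :=
        Integrable.bdd_mul hm.2.2.2 hψ.aestronglyMeasurable (ae_of_all _ hb)
      have j2 : IntegrableOn ψ (Icc 0 T) := integrableOn_of_bdd hψ.measurable hb
      have e : ∫ t in Icc 0 T, ψ t * ((m t univ).toReal - 1) =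
          (∫ t in Icc 0 T, ψ t * (m t univ).toReal) - ∫ t in Icc 0 T, ψ t := by
        rw [← integral_sub j1 j2]
        congr 1
        funext t
        ring
      rw [e]
      linarith [h ψ hψ h0 h1])
  filter_upwards [this] with t ht
  linarith

lemma time_test {T : ℝ} (hT : 0 < T) {O : Set ℝ} {m0 : Measure ℝ}
    (hm0 : InitAssumption2 O m0) {m : ℝ → Measure (ℝ × ℝ)} {μ : Measure (ℝ × ℝ)}
    (hμ : μ ((Icc 0 T ×ˢ closure O)ᶜ) = 0) {ψ : ℝ → ℝ} (h0 : ∀ t, 0 ≤ ψ t)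
    (h : ∫ p : ℝ × ℝ, (∫ s in p.1..T, ψ s) ∂μ ≤ (∫ _, (∫ s in 0..T, ψ s) ∂m0) +
      ∫ t in Icc 0 T, ∫ _, -ψ t ∂(m t)) :
    ∫ t in Icc 0 T, ψ t * (m t univ).toReal ≤ ∫ t in Icc 0 T, ψ t := by
  have := hm0.1
  have a1 : 0 ≤ ∫ p : ℝ × ℝ, (∫ s in p.1..T, ψ s) ∂μ := by
    refine integral_nonneg_of_ae ?_
    have : ∀ᵐ p ∂μ, p ∈ Icc 0 T ×ˢ closure O := by rwa [ae_iff]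
    filter_upwards [this] with p hp
    exact intervalIntegral.integral_nonneg hp.1.2 fun s _ => h0 s
  simp only [integral_const, smul_eq_mul, probReal_univ, one_mul] at h
  have e : ∫ t in Icc 0 T, (m t).real univ * -ψ t = -∫ t in Icc 0 T, ψ t * (m t univ).toReal := by
    rw [← integral_neg]
    congr 1
    funext t
    simp only [Measure.real]
    ring
  rw [e, intervalIntegral.integral_of_le hT.le, ← integral_Icc_eq_integral_Ioc] at h
  linarith

lemma mass_R0 {T : ℝ} (hT : 0 < T) {O A : Set ℝ} {b σ : ℝ → ℝ → Measure (ℝ × ℝ) → ℝ → ℝ}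
    {m0 : Measure ℝ} (hm0 : InitAssumption2 O m0) {m : ℝ → Measure (ℝ × ℝ)} {μ : Measure (ℝ × ℝ)}
    (h : MemR0 T O A b σ m0 μ m) {ψ : ℝ → ℝ} (hψ : Continuous ψ) (h0 : ∀ t, 0 ≤ ψ t)
    (h1 : ∀ t, ψ t ≤ 1) :
    ∫ t in Icc 0 T, ψ t * (m t univ).toReal ≤ ∫ t in Icc 0 T, ψ t := by
  refine time_test hT hm0 h.2.1 h0 ?_
  have := h.2.2.2 _ _ _ _ (isCb12_time O hψ h0 h1) 0 (fun t _ x _ ν _ _ a _ => by simp)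
  rwa [zero_mul, add_zero] at this

lemma mass_Rm {T : ℝ} (hT : 0 < T) {O A : Set ℝ} {b σ : ℝ → ℝ → Measure (ℝ × ℝ) → ℝ → ℝ}
    {m0 : Measure ℝ} (hm0 : InitAssumption2 O m0) {mbar m : ℝ → Measure (ℝ × ℝ)}
    {μ : Measure (ℝ × ℝ)}
    (h : MemRm T O A b σ m0 mbar μ m) {ψ : ℝ → ℝ} (hψ : Continuous ψ) (h0 : ∀ t, 0 ≤ ψ t)
    (h1 : ∀ t, ψ t ≤ 1) :
    ∫ t in Icc 0 T, ψ t * (m t univ).toReal ≤ ∫ t in Icc 0 T, ψ t := by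
  refine time_test hT hm0 h.2.1 h0 ?_
  have := h.2.2.2 _ _ _ _ (isCb12_time O hψ h0 h1)
  simp only [mul_zero, add_zero] at this
  exact this.le

lemma mass_lim {T : ℝ} {mn : ℕ → ℝ → Measure (ℝ × ℝ)} {m : ℝ → Measure (ℝ × ℝ)}
    (hconv : ConvV T mn m)
    (h : ∀ n, ∀ ψ : ℝ → ℝ, Continuous ψ → (∀ t, 0 ≤ ψ t) → (∀ t, ψ t ≤ 1) →
      ∫ t in Icc 0 T, ψ t * (mn n t univ).toReal ≤ ∫ t in Icc 0 T, ψ t)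
    (ψ : ℝ → ℝ) (hψ : Continuous ψ) (h0 : ∀ t, 0 ≤ ψ t) (h1 : ∀ t, ψ t ≤ 1) :
    ∫ t in Icc 0 T, ψ t * (m t univ).toReal ≤ ∫ t in Icc 0 T, ψ t := by
  have c := hconv (fun t _ => ψ t) (by fun_prop) ⟨1, fun t p => by
    rw [abs_of_nonneg (h0 t)]; exact h1 t⟩
  have e : ∀ m' : ℝ → Measure (ℝ × ℝ), ∫ t in Icc 0 T, ∫ _, ψ t ∂(m' t) =
      ∫ t in Icc 0 T, ψ t * (m' t univ).toReal := fun m' => by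
    simp only [integral_const, smul_eq_mul, Measure.real, mul_comm]
  simp only [e] at c
  exact le_of_tendsto' c fun n => h n ψ hψ h0 h1

lemma convV_congr {T : ℝ} {mn mn' : ℕ → ℝ → Measure (ℝ × ℝ)} {m m' : ℝ → Measure (ℝ × ℝ)}
    (hn : ∀ n, ∀ᵐ t ∂(volume.restrict (Icc 0 T)), mn n t = mn' n t)
    (h : ∀ᵐ t ∂(volume.restrict (Icc 0 T)), m t = m' t) (hc : ConvV T mn m) :
    ConvV T mn' m' := by
  intro g cg bg
  have := hc g cg bg
  rw [integral_congr_ae (h.mono fun t ht => by simp only [ht] :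
    (fun t => ∫ p, g t p ∂(m t)) =ᵐ[volume.restrict (Icc 0 T)] fun t => ∫ p, g t p ∂(m' t))] at this
  refine this.congr fun n => integral_congr_ae ((hn n).mono fun t ht => ?_)
  simp only [ht]

lemma memR0_congr {T : ℝ} {O A : Set ℝ} {b σ : ℝ → ℝ → Measure (ℝ × ℝ) → ℝ → ℝ}
    {m0 : Measure ℝ} {m : ℝ → Measure (ℝ × ℝ)} {κ : Kernel ℝ (ℝ × ℝ)} {μ : Measure (ℝ × ℝ)}
    (h1 : ∀ t, κ t univ ≤ 1) (hs : ∀ t, κ t ((closure O ×ˢ A)ᶜ) = 0)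
    (hm : ∀ᵐ t ∂(volume.restrict (Icc 0 T)), m t = κ t)
    (h : MemR0 T O A b σ m0 μ m) : MemR0 T O A b σ m0 μ (fun t => κ t) := by
  refine ⟨h.1, h.2.1, ⟨fun t => (h1 t).trans_lt ENNReal.one_lt_top, hs,
    fun B hB => Kernel.measurable_coe κ hB, ?_⟩, ?_⟩
  · exact h.2.2.1.2.2.2.congr (hm.mono fun t ht => by simp only [ht])
  · intro u ut ux uxx hu C hC
    have := h.2.2.2 u ut ux uxx hu C hC
    rw [integral_congr_ae (hm.mono fun t ht => by simp only [ht] :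
      (fun t => ∫ p, ut t p.1 ∂(m t)) =ᵐ[volume.restrict (Icc 0 T)] fun t => ∫ p, ut t p.1 ∂(κ t)),
      integral_congr_ae (hm.mono fun t ht => by simp only [ht] :
      (fun t => (m t univ).toReal) =ᵐ[volume.restrict (Icc 0 T)] fun t => (κ t univ).toReal)] at this
    exact this

lemma weak_support {F : Set (ℝ × ℝ)} (hF : IsClosed F) {μn : ℕ → Measure (ℝ × ℝ)}
    {μ : Measure (ℝ × ℝ)} (hp : ∀ n, IsProbabilityMeasure (μn n)) (hμ : IsProbabilityMeasure μ)
    (hn : ∀ n, μn n Fᶜ = 0) (hc : WeakConv μn μ) : μ Fᶜ = 0 := by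
  have hne : F.Nonempty := by
    by_contra hne
    rw [not_nonempty_iff_eq_empty] at hne
    have := hn 0
    rw [hne, compl_empty, measure_univ] at this
    exact one_ne_zero this
  have ch : Continuous fun p : ℝ × ℝ => min (Metric.infDist p F) 1 :=
    (Metric.continuous_infDist_pt F).min continuous_const
  have h0 : ∀ p : ℝ × ℝ, 0 ≤ min (Metric.infDist p F) 1 := fun p =>
    le_min Metric.infDist_nonneg zero_le_one
  have hb : ∀ p : ℝ × ℝ, |min (Metric.infDist p F) 1| ≤ 1 := fun p => by
    rw [abs_of_nonneg (h0 p)]; exact min_le_right _ _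
  have c := hc _ ch ⟨1, hb⟩
  have e : ∀ n, ∫ p, min (Metric.infDist p F) 1 ∂(μn n) = 0 := fun n => by
    refine integral_eq_zero_of_ae ?_
    have : ∀ᵐ p ∂(μn n), p ∈ F := by rw [ae_iff]; exact hn n
    filter_upwards [this] with p hp
    simp [Metric.infDist_zero_of_mem hp]
  simp only [e] at c
  have z := tendsto_nhds_unique c tendsto_const_nhds
  have i : Integrable (fun p : ℝ × ℝ => min (Metric.infDist p F) 1) μ :=
    Integrable.of_bound ch.aestronglyMeasurable 1 (ae_of_all _ hb)
  rw [integral_eq_zero_iff_of_nonneg h0 i] at z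
  have : ∀ᵐ p ∂μ, p ∈ F := by
    filter_upwards [z] with p hp
    rw [hF.mem_iff_infDist_zero hne]
    simp only [Pi.zero_apply] at hp
    rcases min_choice (Metric.infDist p F) 1 with h | h
    · rw [h] at hp; exact hp
    · rw [h] at hp; norm_num at hp
  rwa [ae_iff] at this

end

/-- Closed graph of the constraint correspondence — upper
hemicontinuity: if `(μ̄ⁿ, m̄ⁿ) ⊆ R₀`, `(μⁿ, mⁿ) ∈ R[m̄ⁿ]` for all `n`, and
`μⁿ ⇀ μ`, `mⁿ → m` in `V`, `μ̄ⁿ ⇀ μ̄`, `m̄ⁿ → m̄` in `V`, then `(μ, m) ∈ R[m̄]`. -/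
theorem constraint_correspondence_closed_graph
    (T : ℝ) (hT : 0 < T) (O A : Set ℝ) (hO : IsOpen O) (hA : IsCompact A)
    (d : ℕ) (hd : 0 < d)
    (b σ : ℝ → ℝ → Measure (ℝ × ℝ) → ℝ → ℝ)
    (bbar σbar : ℝ → ℝ → (Fin d → ℝ) → ℝ → ℝ) (bhat σhat : ℝ → ℝ → Fin d → ℝ)
    (hb : MFCoeff T O A d b bbar bhat) (hσ : MFCoeff T O A d σ σbar σhat)
    (hσpos : ∀ t x ν a, 0 ≤ σ t x ν a)
    (m0 : Measure ℝ) (hm0 : InitAssumption2 O m0)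
    (μbarn μn : ℕ → Measure (ℝ × ℝ)) (mbarn mn : ℕ → ℝ → Measure (ℝ × ℝ))
    (hR0 : ∀ n, MemR0 T O A b σ m0 (μbarn n) (mbarn n))
    (hRn : ∀ n, MemRm T O A b σ m0 (mbarn n) (μn n) (mn n))
    (μ μbar : Measure (ℝ × ℝ)) (m mbar : ℝ → Measure (ℝ × ℝ))
    (hμ : IsProbabilityMeasure μ) (hμbar : IsProbabilityMeasure μbar)
    (hm : MemV T O A m) (hmbar : MemV T O A mbar)
    (hμconv : WeakConv μn μ) (hmconv : ConvV T mn m)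
    (hμbarconv : WeakConv μbarn μbar) (hmbarconv : ConvV T mbarn mbar) :
    MemRm T O A b σ m0 mbar μ m := by
  have hsupp : μ ((Set.Icc 0 T ×ˢ closure O)ᶜ) = 0 :=
    weak_support (isClosed_Icc.prod isClosed_closure) (fun n => (hRn n).1) hμ
      (fun n => (hRn n).2.1) hμconv
  have q1 := fun n => mass_ae (hR0 n).2.2.1 fun ψ h h0 h1 => mass_R0 hT hm0 (hR0 n) h h0 h1
  have q2 := fun n => mass_ae (hRn n).2.2.1 fun ψ h h0 h1 => mass_Rm hT hm0 (hRn n) h h0 h1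
  have q3 := mass_ae hmbar (mass_lim hmbarconv
    fun n ψ h h0 h1 => mass_R0 hT hm0 (hR0 n) h h0 h1)
  have q4 := mass_ae hm (mass_lim hmconv fun n ψ h h0 h1 => mass_Rm hT hm0 (hRn n) h h0 h1)
  choose κbn kb1 kbs kbe using fun n => exists_kernel (hR0 n).2.2.1 (q1 n)
  choose κn k1 ks ke using fun n => exists_kernel (hRn n).2.2.1 (q2 n)
  obtain ⟨κb, lb1, lbs, lbe⟩ := exists_kernel hmbar q3
  obtain ⟨κ, l1, ls, le'⟩ := exists_kernel hm q4
  refine ⟨hμ, hsupp, hm, fun u ut ux uxx hu => ?_⟩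
  obtain ⟨M, hM⟩ := hu.bdd
  have hcl : IsClosed (Icc 0 T ×ˢ closure O) := isClosed_Icc.prod isClosed_closure
  have hext : ∀ f : ℝ → ℝ → ℝ, ContinuousOn (fun p : ℝ × ℝ => f p.1 p.2) (Icc 0 T ×ˢ closure O) →
      (∀ t ∈ Icc (0:ℝ) T, ∀ x ∈ closure O, |f t x| ≤ M) → ∃ g : ℝ × ℝ → ℝ, Continuous g ∧
      (∀ p, |g p| ≤ |M|) ∧ ∀ p ∈ Icc 0 T ×ˢ closure O, g p = f p.1 p.2 := fun f hf hb =>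
    tietze_bdd hcl hf (abs_nonneg M) fun p hp => (hb _ hp.1 _ hp.2).trans (le_abs_self M)
  obtain ⟨v, cv, bv, ev⟩ := hext u hu.cont fun t ht x hx => (hM t ht x hx).1
  obtain ⟨vt, cvt, bvt, evt⟩ := hext ut hu.cont_t fun t ht x hx => (hM t ht x hx).2.1
  obtain ⟨vx, cvx, bvx, evx⟩ := hext ux hu.cont_x fun t ht x hx => (hM t ht x hx).2.2.1
  obtain ⟨vxx, cvxx, bvxx, evxx⟩ := hext uxx hu.cont_xx fun t ht x hx => (hM t ht x hx).2.2.2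
  have key := conv_kernel hT hA hb hσ k1 l1 kb1 lb1 ks ls kbs lbs
    (fun n => memR0_congr (kb1 n) (kbs n) (kbe n) (hR0 n))
    (convV_congr ke le' hmconv) (convV_congr kbe lbe hmbarconv) cvt cvx cvxx bvt bvx bvxx
  have hrhs : ∀ (m1 m2 : ℝ → Measure (ℝ × ℝ)) (κ1 κ2 : ProbabilityTheory.Kernel ℝ (ℝ × ℝ)),
      (∀ᵐ t ∂(volume.restrict (Icc 0 T)), m1 t = κ1 t) →
      (∀ᵐ t ∂(volume.restrict (Icc 0 T)), m2 t = κ2 t) →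
      (∀ t, κ1 t ((closure O ×ˢ A)ᶜ) = 0) →
      ∫ t in Set.Icc 0 T, (∫ p, (ut t p.1 + (b t p.1 (m2 t) p.2 * ux t p.1
                + σ t p.1 (m2 t) p.2 ^ 2 / 2 * uxx t p.1)) ∂(m1 t)) =
      ∫ t in Set.Icc 0 T, (∫ p, (vt (t, p.1) + (b t p.1 (κ2 t) p.2 * vx (t, p.1)
                + σ t p.1 (κ2 t) p.2 ^ 2 / 2 * vxx (t, p.1))) ∂(κ1 t)) := by
    intro m1 m2 κ1 κ2 e1 e2 s1
    refine integral_congr_ae ?_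
    filter_upwards [e1, e2, ae_restrict_mem measurableSet_Icc] with t h1 h2 ht
    rw [h1, h2]
    refine integral_congr_ae ?_
    have : ∀ᵐ p ∂(κ1 t), p ∈ closure O ×ˢ A := by rw [ae_iff]; exact s1 t
    filter_upwards [this] with p hp
    have hq : (t, p.1) ∈ Icc 0 T ×ˢ closure O := ⟨ht, hp.1⟩
    rw [evt _ hq, evx _ hq, evxx _ hq]
  have hlhs : ∀ μ' : Measure (ℝ × ℝ), μ' ((Set.Icc 0 T ×ˢ closure O)ᶜ) = 0 →
      ∫ p, u p.1 p.2 ∂μ' = ∫ p, v p ∂μ' := by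
    intro μ' h
    refine integral_congr_ae ?_
    have : ∀ᵐ p ∂μ', p ∈ Icc 0 T ×ˢ closure O := by rwa [ae_iff]
    filter_upwards [this] with p hp
    exact (ev p hp).symm
  rw [hlhs μ hsupp, hrhs m mbar κ κb le' lbe ls]
  have c1 := hμconv v cv ⟨_, bv⟩
  refine tendsto_nhds_unique c1 ((key.const_add (∫ x, u 0 x ∂m0)).congr fun n => ?_)
  rw [← hlhs _ (hRn n).2.1, (hRn n).2.2.2 u ut ux uxx hu,
    hrhs (mn n) (mbarn n) (κn n) (κbn n) (ke n) (kbe n) (ks n)]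
end
end
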